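/- arXiv:1901.07841 — 2 statements merged into one kernel-verified Lean document; each statement's English description precedes it below -/
import Mathlib

section
/- Nonexpansiveness of the penalized solution operator Q^ρ: assume (H.1) and (H.4), and let ρ ≥ 0. Then for any u, v ∈ [C⁰₁(ℝ^d)]^M, sup_{i∈ℐ} |((Q^ρ u)_i − (Q^ρ v)_i)⁺|_0 ≤ sup_{i∈ℐ} |(u_i − v_i)⁺|_0, where f⁺ = max(f,0). Consequently, if u ≤ v componentwise then Q^ρ u ≤ Q^ρ v componentwise. -/
noncomputable section
open scoped BigOperators RealInnerProductSpace
open Filter Topology Matrix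

namespace HJBQVI

abbrev E (d : ℕ) : Type := EuclideanSpace ℝ (Fin d)

variable {d d' M : ℕ}

/-- Frobenius norm of a matrix. -/
def frobNorm (A : Matrix (Fin d) (Fin d') ℝ) : ℝ :=
  Real.sqrt (∑ k, ∑ l, (A k l) ^ 2)

/-- Hessian matrix of a real-valued function, via the second iterated Fréchet derivative. -/
def hess (φ : E d → ℝ) (x : E d) : Matrix (Fin d) (Fin d) ℝ :=
  Matrix.of fun i j =>
    iteratedFDeriv ℝ 2 φ x ![EuclideanSpace.single i (1 : ℝ), EuclideanSpace.single j (1 : ℝ)]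

/-- Semiconcavity with constant `C`. -/
def Semiconcave (φ : E d → ℝ) (C : ℝ) : Prop :=
  ∀ x h : E d, φ (x + h) - 2 * φ x + φ (x - h) ≤ C * ‖h‖ ^ 2

/-- Membership in `C⁰₁(ℝ^d)`: bounded, continuous, Lipschitz. -/
def InC01 (f : E d → ℝ) : Prop :=
  Continuous f ∧ (∃ C, ∀ x, |f x| ≤ C) ∧ ∃ L, ∀ x y, |f x - f y| ≤ L * ‖x - y‖

/-- Uniform boundedness of a system of functions. -/
def Bdd (u : Fin M → E d → ℝ) : Prop := ∃ C, ∀ i x, |u i x| ≤ C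

/-- Coefficient data for the weakly coupled HJB operator. -/
structure HJBData (d d' M : ℕ) (𝒜 : Type) [MetricSpace 𝒜] where
  A : Fin M → Set 𝒜
  σm : Fin M → 𝒜 → E d → Matrix (Fin d) (Fin d') ℝ
  bv : Fin M → 𝒜 → E d → E d
  cz : Fin M → 𝒜 → E d → ℝ
  runCost : Fin M → 𝒜 → E d → ℝ
  dcp : Fin M → Fin M → 𝒜 → E d → ℝ

variable {𝒜 𝒵 : Type} [MetricSpace 𝒜] [MetricSpace 𝒵]

/-- The linear operator `L^α_i(x, s, p, X)`. -/
def HJBData.L (P : HJBData d d' M 𝒜) (i : Fin M) (α : 𝒜) (x : E d)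
    (s : Fin M → ℝ) (p : E d) (X : Matrix (Fin d) (Fin d) ℝ) : ℝ :=
  - Matrix.trace (((1 : ℝ) / 2) • (P.σm i α x * (P.σm i α x)ᵀ) * X)
  - ⟪P.bv i α x, p⟫ + P.cz i α x * s i - P.runCost i α x
  - ∑ j ∈ Finset.univ.erase i, P.dcp i j α x * s j

/-- The Hamiltonian `sup_{α ∈ A_i} L^α_i`. -/
def HJBData.Ham (P : HJBData d d' M 𝒜) (i : Fin M) (x : E d)
    (s : Fin M → ℝ) (p : E d) (X : Matrix (Fin d) (Fin d) ℝ) : ℝ :=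
  sSup ((fun α => P.L i α x s p X) '' P.A i)

/-- Data of the impulse intervention operator. -/
structure ImpulseData (d M : ℕ) (𝒵 : Type) [MetricSpace 𝒵] where
  Z : Fin M → E d → Set 𝒵
  Γ : Fin M → E d → 𝒵 → E d
  K : Fin M → E d → 𝒵 → ℝ

/-- The intervention operator `(M_i u)(x) = min_{z ∈ Z_i(x)} [u_i(Γ_i(x,z)) + K_i(x,z)]`. -/
def ImpulseData.Mop (Q : ImpulseData d M 𝒵) (i : Fin M) (u : Fin M → E d → ℝ) (x : E d) : ℝ :=
  sInf ((fun z => u i (Q.Γ i x z) + Q.K i x z) '' Q.Z i x)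

/-- Type of (possibly nonlocal) degenerate elliptic operators. -/
abbrev Op (d M : ℕ) : Type :=
  Fin M → E d → (Fin M → E d → ℝ) → E d → Matrix (Fin d) (Fin d) ℝ → ℝ

/-- Viscosity subsolution (upper semicontinuous, tested from above by C² functions). -/
def IsSubsolution (F : Op d M) (u : Fin M → E d → ℝ) : Prop :=
  (∀ i, UpperSemicontinuous (u i)) ∧
  ∀ (i : Fin M) (φ : E d → ℝ), ContDiff ℝ 2 φ → ∀ x : E d,
    IsLocalMax (fun y => u i y - φ y) x → F i x u (gradient φ x) (hess φ x) ≤ 0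

/-- Viscosity supersolution. -/
def IsSupersolution (F : Op d M) (u : Fin M → E d → ℝ) : Prop :=
  (∀ i, LowerSemicontinuous (u i)) ∧
  ∀ (i : Fin M) (φ : E d → ℝ), ContDiff ℝ 2 φ → ∀ x : E d,
    IsLocalMin (fun y => u i y - φ y) x → 0 ≤ F i x u (gradient φ x) (hess φ x)

/-- Viscosity solution: continuous and both a sub- and a supersolution. -/
def IsSolution (F : Op d M) (u : Fin M → E d → ℝ) : Prop :=
  (∀ i, Continuous (u i)) ∧ IsSubsolution F u ∧ IsSupersolution F u

/-- Pure HJB operator. -/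
def Fhjb (P : HJBData d d' M 𝒜) : Op d M :=
  fun i x u p X => P.Ham i x (fun j => u j x) p X

/-- Obstacle problem operator with obstacle `Ψ`. -/
def Fob (P : HJBData d d' M 𝒜) (Ψ : Fin M → E d → ℝ) : Op d M :=
  fun i x u p X => max (P.Ham i x (fun j => u j x) p X) (u i x - Ψ i x)

/-- Penalized obstacle problem operator. -/
def FobPen (P : HJBData d d' M 𝒜) (Ψ : Fin M → E d → ℝ) (ρ : ℝ) : Op d M :=
  fun i x u p X => P.Ham i x (fun j => u j x) p X + ρ * max (u i x - Ψ i x) 0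

/-- The HJBQVI operator. -/
def Fqvi (P : HJBData d d' M 𝒜) (Q : ImpulseData d M 𝒵) : Op d M :=
  fun i x u p X => max (P.Ham i x (fun j => u j x) p X) (u i x - Q.Mop i u x)

/-- The penalized HJBQVI operator with penalty parameter `ρ`. -/
def Fpen (P : HJBData d d' M 𝒜) (Q : ImpulseData d M 𝒵) (ρ : ℝ) : Op d M :=
  fun i x u p X => P.Ham i x (fun j => u j x) p X + ρ * max (u i x - Q.Mop i u x) 0

/-- Assumption (H.1). -/
def H1 (P : HJBData d d' M 𝒜) (C lam0 : ℝ) : Prop :=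
  0 < lam0 ∧
  (∀ i, (P.A i).Nonempty ∧ IsCompact (P.A i)) ∧
  ∀ i, ∀ α ∈ P.A i,
    (∀ k l, Continuous fun x => P.σm i α x k l) ∧
    Continuous (P.bv i α) ∧ Continuous (P.cz i α) ∧ Continuous (P.runCost i α) ∧
    (∀ j, Continuous (P.dcp i j α)) ∧
    (∀ x, frobNorm (P.σm i α x) ≤ C) ∧
    (∀ x y, frobNorm (P.σm i α x - P.σm i α y) ≤ C * ‖x - y‖) ∧
    (∀ x, ‖P.bv i α x‖ ≤ C) ∧ (∀ x y, ‖P.bv i α x - P.bv i α y‖ ≤ C * ‖x - y‖) ∧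
    (∀ x, |P.cz i α x| ≤ C) ∧ (∀ x y, |P.cz i α x - P.cz i α y| ≤ C * ‖x - y‖) ∧
    (∀ x, |P.runCost i α x| ≤ C) ∧
    (∀ x y, |P.runCost i α x - P.runCost i α y| ≤ C * ‖x - y‖) ∧
    (∀ j, (∀ x, |P.dcp i j α x| ≤ C) ∧ ∀ x y, |P.dcp i j α x - P.dcp i j α y| ≤ C * ‖x - y‖) ∧
    (∀ j ∈ Finset.univ.erase i, ∀ x, 0 ≤ P.dcp i j α x) ∧
    ∀ x, lam0 ≤ P.cz i α x - ∑ j ∈ Finset.univ.erase i, P.dcp i j α x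

/-- Assumption (H.2). -/
def H2 (Q : ImpulseData d M 𝒵) (κ₀ : ℝ) : Prop :=
  0 < κ₀ ∧
  (∀ i x, (Q.Z i x).Nonempty ∧ IsCompact (Q.Z i x)) ∧
  (∀ i, Continuous fun p : E d × 𝒵 => Q.Γ i p.1 p.2) ∧
  (∀ i, Continuous fun p : E d × 𝒵 => Q.K i p.1 p.2) ∧
  (∀ (i : Fin M) (x : E d), ∀ ε > (0 : ℝ), ∃ δ > (0 : ℝ), ∀ y, dist y x < δ →
      Metric.hausdorffDist (Q.Z i x) (Q.Z i y) < ε) ∧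
  ∀ i x, ∀ z ∈ Q.Z i x, κ₀ ≤ Q.K i x z

/-- Assumption (H.3): `λ₀ > sup_{i,α} ([σ^α_i]₁² + [b^α_i]₁)`. -/
def H3 (P : HJBData d d' M 𝒜) (lam0 : ℝ) : Prop :=
  ∃ Kσ Kb : ℝ, 0 ≤ Kσ ∧ 0 ≤ Kb ∧ Kσ ^ 2 + Kb < lam0 ∧
    ∀ i, ∀ α ∈ P.A i,
      (∀ x y, frobNorm (P.σm i α x - P.σm i α y) ≤ Kσ * ‖x - y‖) ∧
      ∀ x y, ‖P.bv i α x - P.bv i α y‖ ≤ Kb * ‖x - y‖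

/-- Assumption (H.4): the intervention operator preserves Lipschitz functions,
`[M_i u]₁ ≤ sup_j [u_j]₁ + C`. -/
def H4 (Q : ImpulseData d M 𝒵) (C : ℝ) : Prop :=
  0 ≤ C ∧ ∀ u : Fin M → E d → ℝ, (∀ i, InC01 (u i)) →
    ∀ L : ℝ, 0 ≤ L → (∀ i x y, |u i x - u i y| ≤ L * ‖x - y‖) →
      ∀ i x y, |Q.Mop i u x - Q.Mop i u y| ≤ (L + C) * ‖x - y‖

/-- `C¹` regularity with bounded and Lipschitz derivative. -/
def C1Bound {F : Type} [NormedAddCommGroup F] [NormedSpace ℝ F] (f : E d → F) (C : ℝ) : Prop :=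
  ContDiff ℝ 1 f ∧ (∀ x, ‖fderiv ℝ f x‖ ≤ C) ∧
    ∀ x y, ‖fderiv ℝ f x - fderiv ℝ f y‖ ≤ C * ‖x - y‖

/-- Assumption (H.5). -/
def H5 (P : HJBData d d' M 𝒜) (C : ℝ) : Prop :=
  ∀ i, ∀ α ∈ P.A i,
    (∀ k l, C1Bound (fun x => P.σm i α x k l) C) ∧
    C1Bound (P.bv i α) C ∧ C1Bound (P.cz i α) C ∧
    (∀ j, C1Bound (P.dcp i j α) C) ∧
    Semiconcave (P.runCost i α) C

/-- Assumption (H.6): the intervention operator preserves semiconcave functions,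
`[M_i u]_{2,+} ≤ sup_j [u_j]_{2,+} + C`. -/
def H6 (Q : ImpulseData d M 𝒵) (C : ℝ) : Prop :=
  0 ≤ C ∧ ∀ u : Fin M → E d → ℝ, (∀ i, Continuous (u i)) → (∃ B, ∀ i x, |u i x| ≤ B) →
    ∀ Cu : ℝ, 0 ≤ Cu → (∀ i, Semiconcave (u i) Cu) →
      ∀ i, Semiconcave (fun x => Q.Mop i u x) (Cu + C)

/-- Switching intervention operator `(M_i u)(x) = min_{j ≠ i} [u_j(x) + k_{ij}(x)]`. -/
def Msw (k : Fin M → Fin M → E d → ℝ) (i : Fin M) (u : Fin M → E d → ℝ) (x : E d) : ℝ :=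
  sInf ((fun j => u j x + k i j x) '' {j | j ≠ i})

/-- The switching HJBQVI operator. -/
def Fsw (P : HJBData d d' M 𝒜) (k : Fin M → Fin M → E d → ℝ) : Op d M :=
  fun i x u p X => max (P.Ham i x (fun j => u j x) p X) (u i x - Msw k i u x)

/-- The componentwise penalized switching system operator. -/
def FswPen (P : HJBData d d' M 𝒜) (k : Fin M → Fin M → E d → ℝ) (ρ : ℝ) : Op d M :=
  fun i x u p X => P.Ham i x (fun j => u j x) p X
    + ρ * ∑ j ∈ Finset.univ.erase i, max (u i x - u j x - k i j x) 0

/-- Assumption (H.7) on signed switching costs. -/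
def H7 (k : Fin M → Fin M → E d → ℝ) (κ₀ C : ℝ) : Prop :=
  0 < κ₀ ∧ 0 ≤ C ∧
  (∀ i x, k i i x = 0) ∧
  (∀ i j l, j ≠ i → ∀ x : E d, κ₀ ≤ k i j x + k j l x - k i l x) ∧
  (∀ i j, (∀ x, |k i j x| ≤ C) ∧ ∀ x y, |k i j x - k i j y| ≤ C * ‖x - y‖) ∧
  ∀ i j (x : E d), k i j x < κ₀ → ∃ h₀ > (0 : ℝ), ∀ h : E d, ‖h‖ < h₀ →
    k i j (x + h) - 2 * k i j x + k i j (x - h) ≤ C * ‖h‖ ^ 2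

/-- `k̃_i = min{min_{j≠i}(k_{ji} − ε), 0}`. -/
def ktil (k : Fin M → Fin M → E d → ℝ) (ε : ℝ) (i : Fin M) (x : E d) : ℝ :=
  sInf (insert 0 ((fun j => k j i x - ε) '' {j | j ≠ i}))

/-- Strict viscosity subsolution with margin `g`: `F_i(x, u, Dφ, D²φ) ≤ g` at
every local maximum of `u_i − φ`. -/
def IsStrictSubsolution (F : Op d M) (g : ℝ) (u : Fin M → E d → ℝ) : Prop :=
  (∀ i, UpperSemicontinuous (u i)) ∧
  ∀ (i : Fin M) (φ : E d → ℝ), ContDiff ℝ 2 φ → ∀ x : E d,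
    IsLocalMax (fun y => u i y - φ y) x → F i x u (gradient φ x) (hess φ x) ≤ g

/-- Half-relaxed upper limit `u*(x) = limsup_{ρ→∞, y→x} u^ρ(y)`. -/
def relaxSup (u : ℕ → E d → ℝ) (x : E d) : ℝ :=
  Filter.limsup (fun p : ℕ × E d => u p.1 p.2) (Filter.atTop ×ˢ nhds x)

/-- Half-relaxed lower limit `u_*(x) = liminf_{ρ→∞, y→x} u^ρ(y)`. -/
def relaxInf (u : ℕ → E d → ℝ) (x : E d) : ℝ :=
  Filter.liminf (fun p : ℕ × E d => u p.1 p.2) (Filter.atTop ×ˢ nhds x)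

/-- Set of optimal impulse controls `𝒵^v_i(x)`. -/
def argminSet (Q : ImpulseData d M 𝒵) (v : Fin M → E d → ℝ) (i : Fin M) (x : E d) : Set 𝒵 :=
  {z | z ∈ Q.Z i x ∧ ∀ z' ∈ Q.Z i x,
    v i (Q.Γ i x z) + Q.K i x z ≤ v i (Q.Γ i x z') + Q.K i x z'}


section ConvexAnalysis

variable {H : Type*} [NormedAddCommGroup H] [InnerProductSpace ℝ H]

/-- `p` is a subgradient of `f` at `x`. -/
def IsSubgradient (f : H → ℝ) (x p : H) : Prop := ∀ z, f x + ⟪p, z - x⟫ ≤ f z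

theorem exists_max_of_quadratic_decay {X : Type*} [PseudoMetricSpace X] [ProperSpace X]
    (f : X → ℝ) (hf : Continuous f) (o : X) (a c : ℝ) (hc : 0 < c)
    (hle : ∀ x, f x ≤ a - c * dist x o ^ 2) : ∃ x, ∀ y, f y ≤ f x := by
  have : Nonempty X := ⟨o⟩
  refine hf.exists_forall_ge ?_
  have h1 : Tendsto (fun x => dist x o) (cocompact X) atTop := tendsto_dist_right_cocompact_atTop o
  have h2 : Tendsto (fun x => a - c * dist x o ^ 2) (cocompact X) atBot := by
    have h3 : Tendsto (fun x => -(c * dist x o ^ 2)) (cocompact X) atBot :=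
      tendsto_neg_atTop_atBot.comp
        (((tendsto_pow_atTop two_ne_zero).comp h1).const_mul_atTop hc)
    simpa [sub_eq_add_neg] using tendsto_atBot_add_const_left _ a h3
  exact tendsto_atBot_mono hle h2

theorem IsSubgradient.monotone {f : H → ℝ} {x y p q : H} (hp : IsSubgradient f x p)
    (hq : IsSubgradient f y q) : 0 ≤ ⟪p - q, x - y⟫ := by
  have h1 := hp y
  have h2 := hq x
  have h3 : ⟪p, y - x⟫ = - ⟪p, x - y⟫ := by rw [← inner_neg_right, neg_sub]
  rw [inner_sub_left]
  linarith

theorem convexOn_of_subgradients {f : H → ℝ} (hf : ∀ x, ∃ p, IsSubgradient f x p) :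
    ConvexOn ℝ Set.univ f := by
  refine ⟨convex_univ, fun x _ y _ a b ha hb hab => ?_⟩
  obtain ⟨p, hp⟩ := hf (a • x + b • y)
  have h1 := hp x
  have h2 := hp y
  have h3 : a * ⟪p, x - (a • x + b • y)⟫ + b * ⟪p, y - (a • x + b • y)⟫ = 0 := by
    rw [← real_inner_smul_right, ← real_inner_smul_right, ← inner_add_right]
    have : a • (x - (a • x + b • y)) + b • (y - (a • x + b • y)) = 0 := by
      have hb' : b = 1 - a := by linarith
      subst hb'
      module
    rw [this, inner_zero_right]
  simp only [smul_eq_mul]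
  have h4 : f (a • x + b • y) = a * f (a • x + b • y) + b * f (a • x + b • y) := by
    rw [← add_mul, hab, one_mul]
  nlinarith [mul_le_mul_of_nonneg_left h1 ha, mul_le_mul_of_nonneg_left h2 hb]

theorem continuous_of_subgradients [FiniteDimensional ℝ H] {f : H → ℝ}
    (hf : ∀ x, ∃ p, IsSubgradient f x p) : Continuous f :=
  continuousOn_univ.1 ((convexOn_of_subgradients hf).continuousOn isOpen_univ)

/-- A convex function which is bounded below has an everywhere defined resolvent. -/
theorem exists_resolvent [FiniteDimensional ℝ H] {f : H → ℝ}
    (hf : ∀ x, ∃ p, IsSubgradient f x p) (c : ℝ) (hc : ∀ x, c ≤ f x) :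
    ∃ J : H → H, ∀ ξ, IsSubgradient f (J ξ) (ξ - J ξ) := by
  have hcont := continuous_of_subgradients hf
  have hconv := convexOn_of_subgradients hf
  have key : ∀ ξ : H, ∃ x, IsSubgradient f x (ξ - x) := by
    intro ξ
    have := FiniteDimensional.proper_real H
    obtain ⟨x, hx⟩ := exists_max_of_quadratic_decay
      (fun x => -(f x + (1 / 2) * dist x ξ ^ 2)) (by fun_prop) ξ (-c) (1 / 2) (by norm_num)
      (fun x => by linarith [hc x])
    refine ⟨x, fun z => ?_⟩
    have step : ∀ t : ℝ, 0 < t → t ≤ 1 →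
        f x + ⟪ξ - x, z - x⟫ ≤ f z + t * (1 / 2 * ‖z - x‖ ^ 2) := by
      intro t ht ht1
      have h1 := hx (x + t • (z - x))
      have h2 := hconv.2 (Set.mem_univ x) (Set.mem_univ z) (by linarith : 0 ≤ 1 - t) ht.le
        (by ring)
      have h3 : (1 - t) • x + t • z = x + t • (z - x) := by module
      rw [h3] at h2
      simp only [smul_eq_mul, dist_eq_norm] at h1 h2
      have h4 : x + t • (z - x) - ξ = (x - ξ) + t • (z - x) := by abel
      have h5 : ‖x + t • (z - x) - ξ‖ ^ 2
          = ‖x - ξ‖ ^ 2 + 2 * (t * ⟪x - ξ, z - x⟫) + t ^ 2 * ‖z - x‖ ^ 2 := by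
        rw [h4, norm_add_sq_real, norm_smul, real_inner_smul_right, mul_pow, Real.norm_eq_abs,
          sq_abs]
      have h6 : ⟪ξ - x, z - x⟫ = - ⟪x - ξ, z - x⟫ := by rw [← inner_neg_left, neg_sub]
      rw [h5] at h1
      rw [h6]
      have h7 : 0 ≤ t * (f z - f x + ⟪x - ξ, z - x⟫ + t * (1 / 2 * ‖z - x‖ ^ 2)) := by nlinarith
      have h8 := nonneg_of_mul_nonneg_right h7 ht
      linarith
    refine le_of_forall_pos_le_add fun ε hε => ?_
    set A := 1 / 2 * ‖z - x‖ ^ 2 with hA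
    have hA0 : 0 ≤ A := by positivity
    have h := step (min 1 (ε / (A + 1))) (by positivity) (min_le_left _ _)
    have h' : min 1 (ε / (A + 1)) * A ≤ ε := by
      calc min 1 (ε / (A + 1)) * A ≤ ε / (A + 1) * (A + 1) := by
            apply mul_le_mul (min_le_right _ _) (by linarith) hA0 (by positivity)
        _ = ε := by field_simp
    linarith
  choose J hJ using key
  exact ⟨J, hJ⟩

theorem resolvent_lipschitz {f : H → ℝ} {J : H → H}
    (hJ : ∀ ξ, IsSubgradient f (J ξ) (ξ - J ξ)) : LipschitzWith 1 J := by
  refine LipschitzWith.of_dist_le_mul fun ξ η => ?_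
  have h := (hJ ξ).monotone (hJ η)
  have h1 : ξ - J ξ - (η - J η) = (ξ - η) - (J ξ - J η) := by abel
  rw [h1, inner_sub_left, real_inner_self_eq_norm_sq] at h
  have h2 := real_inner_le_norm (ξ - η) (J ξ - J η)
  simp only [dist_eq_norm, NNReal.coe_one, one_mul]
  by_contra! hlt
  nlinarith [norm_nonneg (ξ - η)]

theorem resolvent_eq_of_subgradient {f : H → ℝ} {J : H → H}
    (hJ : ∀ ξ, IsSubgradient f (J ξ) (ξ - J ξ)) {x p : H} (hp : IsSubgradient f x p) :
    J (x + p) = x := by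
  have h := (hJ (x + p)).monotone hp
  have h1 : x + p - J (x + p) - p = -(J (x + p) - x) := by abel
  rw [h1, inner_neg_left, real_inner_self_eq_norm_sq] at h
  have h2 : ‖J (x + p) - x‖ = 0 := by nlinarith [norm_nonneg (J (x + p) - x)]
  exact sub_eq_zero.1 (norm_eq_zero.1 h2)

/-- If a convex function is touched from above by a paraboloid, then the gradient of the
paraboloid is the only subgradient. -/
theorem IsSubgradient.eq_of_touching {f : H → ℝ} {x p q : H} {K : ℝ} (hK : 0 ≤ K)
    (hq : IsSubgradient f x q)
    (hup : ∀ z, f z ≤ f x + ⟪p, z - x⟫ + K / 2 * ‖z - x‖ ^ 2) : q = p := by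
  by_contra hne
  have hn : 0 < ‖q - p‖ := norm_pos_iff.2 (sub_ne_zero.2 hne)
  have h : ∀ t : ℝ, 0 < t → ‖q - p‖ ^ 2 ≤ t * (K / 2 * ‖q - p‖ ^ 2) := by
    intro t ht
    have h1 := hq (x + t • (q - p))
    have h2 := hup (x + t • (q - p))
    simp only [add_sub_cancel_left, real_inner_smul_right, norm_smul, Real.norm_eq_abs,
      abs_of_pos ht] at h1 h2
    have h3 : ⟪q, q - p⟫ - ⟪p, q - p⟫ = ‖q - p‖ ^ 2 := by
      rw [← inner_sub_left, real_inner_self_eq_norm_sq]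
    have h4 : t * ‖q - p‖ ^ 2 ≤ t * (t * (K / 2 * ‖q - p‖ ^ 2)) := by
      have h5 : t * ‖q - p‖ ^ 2 = t * ⟪q, q - p⟫ - t * ⟪p, q - p⟫ := by rw [← h3]; ring
      rw [h5]; linarith
    exact le_of_mul_le_mul_left h4 ht
  have h5 := h (1 / (K + 1)) (by positivity)
  have h6 : 1 / (K + 1) * (K / 2 * ‖q - p‖ ^ 2) = (K / (K + 1)) / 2 * ‖q - p‖ ^ 2 := by ring
  have h7 : K / (K + 1) ≤ 1 := by rw [div_le_one (by positivity)]; linarith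
  rw [h6] at h5
  nlinarith [sq_pos_of_pos hn]

/-- At a point where a convex function is touched from above by a paraboloid, its
subdifferential is pointwise Lipschitz. -/
theorem norm_subgradient_sub_le {f : H → ℝ} {x p : H} {K : ℝ} (hK : 0 ≤ K)
    (hp : IsSubgradient f x p)
    (hup : ∀ z, f z ≤ f x + ⟪p, z - x⟫ + K / 2 * ‖z - x‖ ^ 2)
    {z q : H} (hq : IsSubgradient f z q) : ‖q - p‖ ≤ 2 * K * ‖z - x‖ := by
  by_cases hqp : q - p = 0
  · rw [hqp, norm_zero]; positivity
  have hn : 0 < ‖q - p‖ := norm_pos_iff.2 hqp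
  by_cases hzx : z - x = 0
  · have hzx' : z = x := sub_eq_zero.1 hzx
    subst hzx'
    exact absurd (sub_eq_zero.2 (hq.eq_of_touching hK hup)) hqp
  have hr : 0 < ‖z - x‖ := norm_pos_iff.2 hzx
  set t := ‖z - x‖ / ‖q - p‖ with ht
  have htpos : 0 < t := by positivity
  have h1 := hq (z + t • (q - p))
  have h2 := hup (z + t • (q - p))
  have h3 := hp z
  have h4 : z + t • (q - p) - x = (z - x) + t • (q - p) := by abel
  rw [h4, inner_add_right] at h2
  simp only [add_sub_cancel_left, real_inner_smul_right] at h1 h2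
  have h5 : ⟪q, q - p⟫ - ⟪p, q - p⟫ = ‖q - p‖ ^ 2 := by
    rw [← inner_sub_left, real_inner_self_eq_norm_sq]
  have h6 : ‖(z - x) + t • (q - p)‖ ≤ 2 * ‖z - x‖ := by
    refine (norm_add_le _ _).trans ?_
    rw [norm_smul, Real.norm_eq_abs, abs_of_pos htpos, ht, div_mul_cancel₀ _ hn.ne']
    linarith
  have h7 : ‖(z - x) + t • (q - p)‖ ^ 2 ≤ (2 * ‖z - x‖) ^ 2 := by gcongr
  have h8 : t * ‖q - p‖ ^ 2 = ‖z - x‖ * ‖q - p‖ := by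
    rw [ht]; field_simp
  have h9 : ‖z - x‖ * ‖q - p‖ ≤ ‖z - x‖ * (2 * K * ‖z - x‖) := by
    rw [← h8, ← h5]
    nlinarith [mul_le_mul_of_nonneg_left h7 (by linarith : 0 ≤ K / 2)]
  exact le_of_mul_le_mul_left h9 hr

/-- Integration of an approximately affine slope. -/
theorem le_of_slope_le {φ s : ℝ → ℝ} {s₀ b ε : ℝ}
    (hφ : ∀ t ∈ Set.Icc (0 : ℝ) 1, ∀ t' ∈ Set.Icc (0 : ℝ) 1, t ≤ t' →
      φ t' - φ t ≤ s t' * (t' - t))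
    (hs : ∀ t ∈ Set.Icc (0 : ℝ) 1, s t - s₀ - t * b ≤ ε) :
    φ 1 - φ 0 - s₀ - b / 2 ≤ ε := by
  have step : ∀ n : ℕ, 0 < n → φ 1 - φ 0 - s₀ - b / 2 ≤ ε + |b| / (2 * n) := by
    intro n hn
    have hn' : (0 : ℝ) < n := by exact_mod_cast hn
    have key : ∀ m : ℕ, m ≤ n → φ (m / n) - φ 0 ≤
        (m / n : ℝ) * (s₀ + ε + |b| / (2 * n)) + b / 2 * (m / n) ^ 2 := by
      intro m
      induction m with
      | zero => intro _; simp
      | succ m ih =>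
        intro hm
        have ih := ih (by omega)
        have hm' : ((m : ℝ) + 1) ≤ n := by exact_mod_cast hm
        have e1 : (m / n : ℝ) ∈ Set.Icc (0 : ℝ) 1 :=
          ⟨by positivity, by rw [div_le_one hn']; linarith⟩
        have e2 : (((m + 1 : ℕ) : ℝ) / n) ∈ Set.Icc (0 : ℝ) 1 :=
          ⟨by positivity, by rw [div_le_one hn']; push_cast; linarith⟩
        have e3 : (((m + 1 : ℕ) : ℝ) / n) = m / n + 1 / n := by push_cast; ring
        have h1 := hφ _ e1 _ e2 (by rw [e3]; linarith [show (0 : ℝ) < 1 / n by positivity])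
        have h2 := hs _ e2
        rw [e3] at h1 h2 ⊢
        set a : ℝ := m / n
        have hd : (0 : ℝ) < 1 / n := by positivity
        have e4 : |b| / (2 * n) = |b| / 2 * (1 / n) := by field_simp
        rw [e4] at ih ⊢
        set δ : ℝ := 1 / n
        have h3 : φ (a + δ) - φ a ≤ (s₀ + (a + δ) * b + ε) * δ := by
          have : a + δ - a = δ := by ring
          rw [this] at h1
          nlinarith
        nlinarith [le_abs_self b, mul_nonneg hd.le hd.le]
    have h := key n le_rfl
    rw [div_self hn'.ne'] at h
    linarith
  refine le_of_forall_pos_le_add fun η hη => ?_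
  obtain ⟨n, hn⟩ := exists_nat_gt (|b| / η)
  have hn0 : 0 < (n : ℝ) := lt_of_le_of_lt (by positivity) hn
  have h := step n (by exact_mod_cast hn0)
  have : |b| / (2 * n) ≤ η := by
    rw [div_lt_iff₀ hη] at hn
    rw [div_le_iff₀ (by positivity)]
    nlinarith
  linarith

/-- Second order expansion of a convex function from the expansion of its subgradients. -/
theorem second_order_expansion {f : H → ℝ} {p : H → H} (hp : ∀ x, IsSubgradient f x (p x))
    {x : H} {B : H →L[ℝ] H} (hB : HasFDerivAt p B x) (ε : ℝ) (hε : 0 < ε) :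
    ∃ r > 0, ∀ h : H, ‖h‖ < r →
      |f (x + h) - f x - ⟪p x, h⟫ - ⟪B h, h⟫ / 2| ≤ ε * ‖h‖ ^ 2 := by
  have h0 := (hB.isLittleO).def hε
  obtain ⟨r, hr, hball⟩ := Metric.eventually_nhds_iff.1 h0
  refine ⟨r, hr, fun h hh => ?_⟩
  have hs : ∀ t ∈ Set.Icc (0 : ℝ) 1,
      |⟪p (x + t • h), h⟫ - ⟪p x, h⟫ - t * ⟪B h, h⟫| ≤ ε * ‖h‖ ^ 2 := by
    intro t ht
    have hth : ‖t • h‖ ≤ ‖h‖ := by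
      rw [norm_smul, Real.norm_eq_abs, abs_of_nonneg ht.1]
      exact mul_le_of_le_one_left (norm_nonneg _) ht.2
    have h1 := hball (y := x + t • h) (by rw [dist_eq_norm, add_sub_cancel_left]; linarith)
    rw [add_sub_cancel_left] at h1
    have h2 : ⟪p (x + t • h), h⟫ - ⟪p x, h⟫ - t * ⟪B h, h⟫
        = ⟪p (x + t • h) - p x - B (t • h), h⟫ := by
      rw [inner_sub_left, inner_sub_left, map_smul, real_inner_smul_left]
    rw [h2]
    calc _ ≤ ‖p (x + t • h) - p x - B (t • h)‖ * ‖h‖ := abs_real_inner_le_norm _ _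
      _ ≤ (ε * ‖h‖) * ‖h‖ := by gcongr; exact h1.trans (by gcongr)
      _ = _ := by ring
  have hφ : ∀ t t' : ℝ, t ≤ t' →
      f (x + t' • h) - f (x + t • h) ≤ ⟪p (x + t' • h), h⟫ * (t' - t) ∧
      ⟪p (x + t • h), h⟫ * (t' - t) ≤ f (x + t' • h) - f (x + t • h) := by
    intro t t' _
    have h1 := hp (x + t' • h) (x + t • h)
    have h2 := hp (x + t • h) (x + t' • h)
    have e1 : x + t • h - (x + t' • h) = (t - t') • h := by module
    have e2 : x + t' • h - (x + t • h) = (t' - t) • h := by module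
    rw [e1, real_inner_smul_right] at h1
    rw [e2, real_inner_smul_right] at h2
    constructor <;> linarith
  rw [abs_le]
  constructor
  · have := le_of_slope_le (φ := fun t => f (x + (1 - t) • h))
      (s := fun t => -⟪p (x + (1 - t) • h), h⟫) (s₀ := -(⟪p x, h⟫ + ⟪B h, h⟫)) (b := ⟪B h, h⟫)
      (ε := ε * ‖h‖ ^ 2)
      (fun t ht t' ht' htt => by
        have := (hφ (1 - t') (1 - t) (by linarith)).2
        linarith)
      (fun t ht => by
        have := (abs_le.1 (hs (1 - t) ⟨by linarith [ht.2], by linarith [ht.1]⟩)).1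
        linarith)
    simp only [sub_self, zero_smul, add_zero, sub_zero, one_smul] at this
    linarith
  · have := le_of_slope_le (φ := fun t => f (x + t • h))
      (s := fun t => ⟪p (x + t • h), h⟫) (s₀ := ⟪p x, h⟫) (b := ⟪B h, h⟫)
      (ε := ε * ‖h‖ ^ 2)
      (fun t _ t' _ htt => (hφ t t' htt).1)
      (fun t ht => (abs_le.1 (hs t ht)).2)
    simp only [zero_smul, add_zero, one_smul] at this
    linarith

/-- A convex function touched from above by a paraboloid at `x` is twice differentiable at `x`
as soon as its resolvent is differentiable at the corresponding point. -/
theorem twice_differentiable_of_resolvent [FiniteDimensional ℝ H] {f : H → ℝ} {p J : H → H}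
    (hp : ∀ x, IsSubgradient f x (p x)) (hJ : ∀ ξ, IsSubgradient f (J ξ) (ξ - J ξ))
    {x : H} {K : ℝ} (hK : 0 ≤ K)
    (hup : ∀ z, f z ≤ f x + ⟪p x, z - x⟫ + K / 2 * ‖z - x‖ ^ 2)
    (hd : DifferentiableAt ℝ J (x + p x)) :
    ∃ B : H →L[ℝ] H, ∀ ε > 0, ∃ r > 0, ∀ h : H, ‖h‖ < r →
      |f (x + h) - f x - ⟪p x, h⟫ - ⟪B h, h⟫ / 2| ≤ ε * ‖h‖ ^ 2 := by
  obtain ⟨D, hD⟩ := hd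
  have hJp : ∀ y, J (y + p y) = y := fun y => resolvent_eq_of_subgradient hJ (hp y)
  have hanti : ∀ ξ, ‖ξ - (x + p x)‖ ≤ (1 + 2 * K) * ‖J ξ - x‖ := by
    intro ξ
    have h1 := norm_subgradient_sub_le hK (hp x) hup (hJ ξ)
    have h2 : ξ - (x + p x) = (J ξ - x) + (ξ - J ξ - p x) := by abel
    rw [h2]
    refine (norm_add_le _ _).trans ?_
    linarith
  have hinj : Function.Injective (D : H →ₗ[ℝ] H) := by
    rw [injective_iff_map_eq_zero]
    intro v hv
    have hv' : D v = 0 := hv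
    by_contra hv0
    have hvpos : 0 < ‖v‖ := norm_pos_iff.2 hv0
    have h0 := (hD.isLittleO).def (show 0 < 1 / (2 * (1 + 2 * K)) by positivity)
    obtain ⟨r, hr, hball⟩ := Metric.eventually_nhds_iff.1 h0
    set t := r / (2 * ‖v‖)
    have ht : 0 < t := by positivity
    have htv : ‖t • v‖ = r / 2 := by
      rw [norm_smul, Real.norm_eq_abs, abs_of_pos ht]
      simp only [t]; field_simp
    have h1 := hball (y := (x + p x) + t • v)
      (by rw [dist_eq_norm, add_sub_cancel_left, htv]; linarith)
    have h2 := hanti ((x + p x) + t • v)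
    rw [add_sub_cancel_left, map_smul, hv', smul_zero, sub_zero, hJp x, htv] at h1
    rw [add_sub_cancel_left, htv] at h2
    have h3 : (1 + 2 * K) * (1 / (2 * (1 + 2 * K)) * (r / 2)) = r / 4 := by
      field_simp; ring
    nlinarith [mul_le_mul_of_nonneg_left h1 (by linarith : 0 ≤ 1 + 2 * K)]
  let De : H ≃L[ℝ] H := (LinearEquiv.ofInjectiveEndo (D : H →ₗ[ℝ] H) hinj).toContinuousLinearEquiv
  have hDe : (De : H →L[ℝ] H) = D := by ext v; rfl
  have hcont : ContinuousAt (fun y => y + p y) x := by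
    rw [Metric.continuousAt_iff]
    intro ε hε
    refine ⟨ε / (1 + 2 * K), by positivity, fun {y} hy => ?_⟩
    have h1 := hanti (y + p y)
    rw [hJp y] at h1
    rw [dist_eq_norm] at hy ⊢
    rw [lt_div_iff₀ (by positivity)] at hy
    nlinarith
  have hG : HasFDerivAt (fun y => y + p y) (De.symm : H →L[ℝ] H) x :=
    HasFDerivAt.of_local_left_inverse hcont (by rw [hDe]; exact hD)
      (Eventually.of_forall hJp)
  have hpB : HasFDerivAt p ((De.symm : H →L[ℝ] H) - ContinuousLinearMap.id ℝ H) x := by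
    have := hG.sub (hasFDerivAt_id x)
    refine this.congr_of_eventuallyEq (Eventually.of_forall fun y => ?_)
    simp
  exact ⟨_, fun ε hε => second_order_expansion hp hpB ε hε⟩

end ConvexAnalysis

section SupConvolution

variable {H : Type*} [NormedAddCommGroup H]

/-- `S` selects maximizers in the sup-convolution of `W` with parameter `k`. -/
def SelectsSupConv (W : H → ℝ) (k : ℝ) (S : H → H) : Prop :=
  ∀ x z, W z - k / 2 * ‖x - z‖ ^ 2 ≤ W (S x) - k / 2 * ‖x - S x‖ ^ 2

/-- The sup-convolution of `W`, in terms of a selection `S` of maximizers. -/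
def supConv (W : H → ℝ) (k : ℝ) (S : H → H) (x : H) : ℝ := W (S x) - k / 2 * ‖x - S x‖ ^ 2

/-- The convex function obtained by adding a paraboloid to the sup-convolution. -/
def convexSupConv (W : H → ℝ) (k : ℝ) (S : H → H) (x : H) : ℝ :=
  supConv W k S x + k / 2 * ‖x‖ ^ 2

theorem SelectsSupConv.le_supConv {W : H → ℝ} {k : ℝ} {S : H → H} (hS : SelectsSupConv W k S)
    (x : H) : W x ≤ supConv W k S x := by
  have := hS x x
  simpa [supConv] using this

variable [InnerProductSpace ℝ H]

theorem exists_selectsSupConv [FiniteDimensional ℝ H] {W : H → ℝ} (hW : Continuous W) {B k : ℝ}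
    (hB : ∀ x, |W x| ≤ B) (hk : 0 < k) : ∃ S, SelectsSupConv W k S := by
  have := FiniteDimensional.proper_real H
  have key : ∀ x : H, ∃ s, ∀ z, W z - k / 2 * ‖x - z‖ ^ 2 ≤ W s - k / 2 * ‖x - s‖ ^ 2 := by
    intro x
    refine exists_max_of_quadratic_decay (fun z => W z - k / 2 * ‖x - z‖ ^ 2) (by fun_prop) x B
      (k / 2) (by positivity) fun z => ?_
    rw [dist_comm, dist_eq_norm]
    linarith [(abs_le.1 (hB z)).2]
  choose S hS using key
  exact ⟨S, hS⟩

theorem SelectsSupConv.isSubgradient {W : H → ℝ} {k : ℝ} {S : H → H}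
    (hS : SelectsSupConv W k S) (x : H) : IsSubgradient (convexSupConv W k S) x (k • S x) := by
  intro z
  have h := hS z (S x)
  simp only [convexSupConv, supConv, real_inner_smul_left, inner_sub_right]
  rw [@norm_sub_sq_real _ _ _ z (S x)] at h
  have h2 : ‖x - S x‖ ^ 2 = ‖x‖ ^ 2 - 2 * ⟪x, S x⟫ + ‖S x‖ ^ 2 := norm_sub_sq_real _ _
  rw [h2, real_inner_comm z (S x), real_inner_comm x (S x)]
  rw [real_inner_comm] at h
  have h3 : ⟪S x, z⟫ = ⟪z, S x⟫ := real_inner_comm _ _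
  have h4 : ⟪S x, x⟫ = ⟪x, S x⟫ := real_inner_comm _ _
  simp only [h3, h4] at *
  linarith

theorem SelectsSupConv.continuous [FiniteDimensional ℝ H] {W : H → ℝ} {k : ℝ} {S : H → H}
    (hS : SelectsSupConv W k S) : Continuous (supConv W k S) := by
  have h : Continuous (convexSupConv W k S) :=
    continuous_of_subgradients fun x => ⟨_, hS.isSubgradient x⟩
  have h2 : supConv W k S = fun x => convexSupConv W k S x - k / 2 * ‖x‖ ^ 2 := by
    funext x; simp [convexSupConv]
  rw [h2]
  fun_prop

theorem SelectsSupConv.exists_resolvent [FiniteDimensional ℝ H] {W : H → ℝ} {B k : ℝ}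
    {S : H → H} (hS : SelectsSupConv W k S) (hB : ∀ x, |W x| ≤ B) (hk : 0 < k) :
    ∃ J : H → H, ∀ ξ, IsSubgradient (convexSupConv W k S) (J ξ) (ξ - J ξ) := by
  refine HJBQVI.exists_resolvent (fun x => ⟨_, hS.isSubgradient x⟩) (-B) fun x => ?_
  have h1 := hS.le_supConv x
  have h2 := (abs_le.1 (hB x)).1
  have h3 : 0 ≤ k / 2 * ‖x‖ ^ 2 := by positivity
  simp only [convexSupConv]
  linarith

/-- Second order expansion of the sup-convolution at a point where it is touched from above by a
paraboloid and where the resolvent is differentiable. -/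
theorem SelectsSupConv.second_order [FiniteDimensional ℝ H] {W : H → ℝ} {k : ℝ}
    {S J : H → H} (hS : SelectsSupConv W k S) (hk : 0 < k)
    (hJ : ∀ ξ, IsSubgradient (convexSupConv W k S) (J ξ) (ξ - J ξ))
    {x a : H} {c : ℝ} (hc : 0 ≤ c)
    (hup : ∀ z, supConv W k S z ≤ supConv W k S x + ⟪a, z - x⟫ + c / 2 * ‖z - x‖ ^ 2) :
    k • S x = a + k • x ∧ J (x + (a + k • x)) = x ∧
    (DifferentiableAt ℝ J (x + (a + k • x)) →
      ∃ X : H →L[ℝ] H, ∀ ε > 0, ∃ r > 0, ∀ h : H, ‖h‖ < r →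
        |supConv W k S (x + h) - supConv W k S x - ⟪a, h⟫ - ⟪X h, h⟫ / 2| ≤ ε * ‖h‖ ^ 2) := by
  have hup' : ∀ z, convexSupConv W k S z ≤ convexSupConv W k S x + ⟪a + k • x, z - x⟫
      + (k + c) / 2 * ‖z - x‖ ^ 2 := by
    intro z
    have h1 := hup z
    have h2 : ‖z‖ ^ 2 = ‖x‖ ^ 2 + 2 * ⟪x, z - x⟫ + ‖z - x‖ ^ 2 := by
      rw [← norm_add_sq_real, add_sub_cancel]
    simp only [convexSupConv, inner_add_left, real_inner_smul_left, h2]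
    linarith
  have heq := (hS.isSubgradient x).eq_of_touching (by linarith) hup'
  have hJx : J (x + (a + k • x)) = x := by
    rw [← heq]; exact resolvent_eq_of_subgradient hJ (hS.isSubgradient x)
  refine ⟨heq, hJx, fun hd => ?_⟩
  obtain ⟨B, hB⟩ := twice_differentiable_of_resolvent (K := k + c) hS.isSubgradient hJ
    (by linarith) (by rw [heq]; exact hup') (by rw [heq]; exact hd)
  refine ⟨B - k • ContinuousLinearMap.id ℝ H, fun ε hε => ?_⟩
  obtain ⟨r, hr, h⟩ := hB ε hε
  refine ⟨r, hr, fun v hv => ?_⟩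
  have h1 := h v hv
  rw [heq] at h1
  have h2 : ‖x + v‖ ^ 2 = ‖x‖ ^ 2 + 2 * ⟪x, v⟫ + ‖v‖ ^ 2 := norm_add_sq_real _ _
  have h3 : ⟪(B - k • ContinuousLinearMap.id ℝ H) v, v⟫ = ⟪B v, v⟫ - k * ‖v‖ ^ 2 := by
    simp only [_root_.sub_apply, _root_.smul_apply,
      ContinuousLinearMap.id_apply, inner_sub_left, real_inner_smul_left,
      real_inner_self_eq_norm_sq]
  simp only [convexSupConv, inner_add_left, real_inner_smul_left, h2] at h1
  rw [h3]
  convert h1 using 2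
  ring

open MeasureTheory in
/-- Almost every perturbation is attained only at points of differentiability. -/
theorem exists_small_regular_value [FiniteDimensional ℝ H] {ι : Type*} [Finite ι]
    {T : ι → H × H → H × H} (hT : ∀ i, ∃ K, LipschitzWith K (T i)) {J J' : ι → H → H}
    (hJ : ∀ i, LipschitzWith 1 (J i)) (hJ' : ∀ i, LipschitzWith 1 (J' i)) {δ : ℝ} (hδ : 0 < δ) :
    ∃ q : H × H, ‖q.1‖ < δ ∧ ‖q.2‖ < δ ∧ ∀ i ζ, T i ζ = q →
      DifferentiableAt ℝ (J i) ζ.1 ∧ DifferentiableAt ℝ (J' i) ζ.2 := by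
  have := FiniteDimensional.proper_real H
  borelize H
  let bad : ι → Set (H × H) := fun i =>
    {ζ | ¬ (DifferentiableAt ℝ (J i) ζ.1 ∧ DifferentiableAt ℝ (J' i) ζ.2)}
  let n : ℕ := Module.finrank ℝ (H × H)
  let μ : Measure (H × H) := Measure.hausdorffMeasure (n : ℝ)
  have : μ.IsAddHaarMeasure := isAddHaarMeasure_hausdorffMeasure
  have hbad : ∀ i, μ (bad i) = 0 := by
    intro i
    have h1 : ∀ᵐ ζ ∂((volume : Measure H).prod (volume : Measure H)),
        DifferentiableAt ℝ (J i) ζ.1 :=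
      Measure.quasiMeasurePreserving_fst.ae (hJ i).ae_differentiableAt
    have h2 : ∀ᵐ ζ ∂((volume : Measure H).prod (volume : Measure H)),
        DifferentiableAt ℝ (J' i) ζ.2 :=
      Measure.quasiMeasurePreserving_snd.ae (hJ' i).ae_differentiableAt
    have h3 := h1.and h2
    have h4 : ((volume : Measure H).prod (volume : Measure H)) (bad i) = 0 := ae_iff.1 h3
    exact Measure.absolutelyContinuous_isAddHaarMeasure μ _ h4
  have himg : ∀ i, μ (T i '' bad i) = 0 := by
    intro i
    obtain ⟨K, hK⟩ := hT i
    have h := hK.hausdorffMeasure_image_le (Nat.cast_nonneg n) (bad i)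
    refine le_antisymm (h.trans ?_) zero_le
    have h0 : Measure.hausdorffMeasure (n : ℝ) (bad i) = 0 := hbad i
    rw [h0, mul_zero]
  have hU : μ (⋃ i, T i '' bad i) = 0 := by
    have := Fintype.ofFinite ι
    exact measure_iUnion_null himg
  have hpos : 0 < μ (Metric.ball (0 : H × H) δ) := Metric.measure_ball_pos μ _ hδ
  obtain ⟨q, hq, hqU⟩ : ∃ q ∈ Metric.ball (0 : H × H) δ, q ∉ ⋃ i, T i '' bad i := by
    by_contra! hcon
    exact absurd (measure_mono_null hcon hU) hpos.ne'
  rw [mem_ball_zero_iff] at hq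
  refine ⟨q, (norm_fst_le q).trans_lt hq, (norm_snd_le q).trans_lt hq, fun i ζ hζ => ?_⟩
  by_contra hb
  exact hqU (Set.mem_iUnion.2 ⟨i, ζ, hb, hζ⟩)

end SupConvolution

section Maximum

variable {H : Type*} [NormedAddCommGroup H] [InnerProductSpace ℝ H]

/-- `a` and `X` form a second order superjet of `W` at `x`, up to arbitrarily small paraboloids. -/
def HasSuperjet (W : H → ℝ) (x a : H) (X : H →L[ℝ] H) : Prop :=
  ∀ ε > 0, ∃ r > 0, ∀ h : H, ‖h‖ < r → W (x + h) ≤ W x + ⟪a, h⟫ + ⟪X h, h⟫ / 2 + ε * ‖h‖ ^ 2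

/-- A superjet of the sup-convolution at `x` is a superjet of the function at the maximizer. -/
theorem SelectsSupConv.hasSuperjet {W : H → ℝ} {k : ℝ} {S : H → H} (hS : SelectsSupConv W k S)
    {x a : H} {X : H →L[ℝ] H} (h : HasSuperjet (supConv W k S) x a X) :
    HasSuperjet W (S x) a X := by
  intro ε hε
  obtain ⟨r, hr, hh⟩ := h ε hε
  refine ⟨r, hr, fun v hv => ?_⟩
  have h1 := hh v hv
  have h2 := hS (x + v) (S x + v)
  have h3 : x + v - (S x + v) = x - S x := by abel
  rw [h3] at h2
  simp only [supConv] at h1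
  linarith

/-- Comparison of second order expansions at a maximum of a doubled function. -/
theorem quadratic_form_le_of_max {u w : H → ℝ} {k β : ℝ} {x y a b q₁ q₂ : H} {X Y : H →L[ℝ] H}
    (ha : a = k • (x - y) + β • x + q₁) (hb : b = k • (y - x) + β • y + q₂)
    (hX : ∀ ε > 0, ∃ r > 0, ∀ h : H, ‖h‖ < r →
      |u (x + h) - u x - ⟪a, h⟫ - ⟪X h, h⟫ / 2| ≤ ε * ‖h‖ ^ 2)
    (hY : ∀ ε > 0, ∃ r > 0, ∀ h : H, ‖h‖ < r →
      |w (y + h) - w y - ⟪b, h⟫ - ⟪Y h, h⟫ / 2| ≤ ε * ‖h‖ ^ 2)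
    (hmax : ∀ z z', u z + w z' - k / 2 * ‖z - z'‖ ^ 2 - β / 2 * (‖z‖ ^ 2 + ‖z'‖ ^ 2)
        - ⟪q₁, z⟫ - ⟪q₂, z'⟫
      ≤ u x + w y - k / 2 * ‖x - y‖ ^ 2 - β / 2 * (‖x‖ ^ 2 + ‖y‖ ^ 2) - ⟪q₁, x⟫ - ⟪q₂, y⟫)
    (h g : H) :
    ⟪X h, h⟫ + ⟪Y g, g⟫ ≤ k * ‖h - g‖ ^ 2 + β * (‖h‖ ^ 2 + ‖g‖ ^ 2) := by
  have key : ∀ ε > 0, ⟪X h, h⟫ + ⟪Y g, g⟫ ≤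
      k * ‖h - g‖ ^ 2 + β * (‖h‖ ^ 2 + ‖g‖ ^ 2) + ε * (2 * (‖h‖ ^ 2 + ‖g‖ ^ 2)) := by
    intro ε hε
    obtain ⟨r, hr, hX⟩ := hX ε hε
    obtain ⟨r', hr', hY⟩ := hY ε hε
    set m := min r r' with hm
    have hm0 : 0 < m := lt_min hr hr'
    set t := m / (‖h‖ + ‖g‖ + 1) with ht
    have hn : 0 < ‖h‖ + ‖g‖ + 1 := by positivity
    have ht0 : 0 < t := by positivity
    have hsmall : ∀ v : H, ‖v‖ ≤ ‖h‖ + ‖g‖ → ‖t • v‖ < m := by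
      intro v hv
      rw [norm_smul, Real.norm_eq_abs, abs_of_pos ht0, ht, div_mul_eq_mul_div,
        div_lt_iff₀ hn]
      exact mul_lt_mul_of_pos_left (by linarith) hm0
    have h1 := (abs_le.1 (hX (t • h) ((hsmall h (by linarith [norm_nonneg g])).trans_le
      (min_le_left _ _)))).1
    have h2 := (abs_le.1 (hY (t • g) ((hsmall g (by linarith [norm_nonneg h])).trans_le
      (min_le_right _ _)))).1
    have h3 := hmax (x + t • h) (y + t • g)
    have e1 : x + t • h - (y + t • g) = (x - y) + t • (h - g) := by module
    rw [e1, norm_add_sq_real (x - y), norm_add_sq_real x, norm_add_sq_real y] at h3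
    simp only [map_smul, norm_smul, real_inner_smul_left, real_inner_smul_right, inner_add_right,
      inner_sub_right, inner_sub_left, ha, hb, inner_add_left, mul_pow, Real.norm_eq_abs,
      sq_abs] at h1 h2 h3
    have h4 : t ^ 2 * (⟪X h, h⟫ + ⟪Y g, g⟫) ≤ t ^ 2 * (k * ‖h - g‖ ^ 2
        + β * (‖h‖ ^ 2 + ‖g‖ ^ 2) + ε * (2 * (‖h‖ ^ 2 + ‖g‖ ^ 2))) := by
      linarith
    exact le_of_mul_le_mul_left h4 (by positivity)
  refine le_of_forall_pos_le_add fun η hη => ?_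
  have h0 : 0 ≤ 2 * (‖h‖ ^ 2 + ‖g‖ ^ 2) := by positivity
  have h1 := key (η / (2 * (‖h‖ ^ 2 + ‖g‖ ^ 2) + 1)) (by positivity)
  have h2 : η / (2 * (‖h‖ ^ 2 + ‖g‖ ^ 2) + 1) * (2 * (‖h‖ ^ 2 + ‖g‖ ^ 2)) ≤ η := by
    rw [div_mul_eq_mul_div, div_le_iff₀ (by positivity)]
    nlinarith
  linarith

/-- The doubled function attains its maximum over the components and the points. -/
theorem exists_doubled_max [FiniteDimensional ℝ H] {ι : Type*} [Finite ι] [Nonempty ι]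
    {u w : ι → H → ℝ} (hu : ∀ i, Continuous (u i)) (hw : ∀ i, Continuous (w i)) {B k β : ℝ}
    (huB : ∀ i x, u i x ≤ B) (hwB : ∀ i x, w i x ≤ B) (hk : 0 < k) (hβ : 0 < β) (q₁ q₂ : H) :
    ∃ i x y, ∀ j z z', u j z + w j z' - k / 2 * ‖z - z'‖ ^ 2 - β / 2 * (‖z‖ ^ 2 + ‖z'‖ ^ 2)
        - ⟪q₁, z⟫ - ⟪q₂, z'⟫
      ≤ u i x + w i y - k / 2 * ‖x - y‖ ^ 2 - β / 2 * (‖x‖ ^ 2 + ‖y‖ ^ 2) - ⟪q₁, x⟫ - ⟪q₂, y⟫ := by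
  have := FiniteDimensional.proper_real H
  let F : ι → H × H → ℝ := fun i p => u i p.1 + w i p.2 - k / 2 * ‖p.1 - p.2‖ ^ 2
    - β / 2 * (‖p.1‖ ^ 2 + ‖p.2‖ ^ 2) - ⟪q₁, p.1⟫ - ⟪q₂, p.2⟫
  have hlin : ∀ q z : H, -⟪q, z⟫ ≤ β / 4 * ‖z‖ ^ 2 + ‖q‖ ^ 2 / β := by
    intro q z
    have h1 := neg_le_of_abs_le (abs_real_inner_le_norm q z)
    have h2 : 0 ≤ (β / 2 * ‖z‖ - ‖q‖) ^ 2 / β := by positivity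
    have h3 : (β / 2 * ‖z‖ - ‖q‖) ^ 2 / β = β / 4 * ‖z‖ ^ 2 + ‖q‖ ^ 2 / β - ‖q‖ * ‖z‖ := by
      field_simp; ring
    linarith
  have hmax : ∀ i, ∃ p, ∀ p', F i p' ≤ F i p := by
    intro i
    refine exists_max_of_quadratic_decay (F i) ?_ (0 : H × H)
      (2 * B + ‖q₁‖ ^ 2 / β + ‖q₂‖ ^ 2 / β) (β / 4) (by positivity) fun p => ?_
    · have h1 := hu i
      have h2 := hw i
      fun_prop
    · rw [dist_zero_right]
      have h1 := hlin q₁ p.1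
      have h2 := hlin q₂ p.2
      have h3 := huB i p.1
      have h4 := hwB i p.2
      have h5 : 0 ≤ k / 2 * ‖p.1 - p.2‖ ^ 2 := by positivity
      have h6 : ‖p‖ ^ 2 ≤ ‖p.1‖ ^ 2 + ‖p.2‖ ^ 2 := by
        rcases max_cases ‖p.1‖ ‖p.2‖ with h | h <;> rw [Prod.norm_def, h.1] <;>
          nlinarith [sq_nonneg ‖p.1‖, sq_nonneg ‖p.2‖]
      simp only [F]
      nlinarith
  choose P hP using hmax
  obtain ⟨i, hi⟩ := Finite.exists_max fun i => F i (P i)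
  exact ⟨i, (P i).1, (P i).2, fun j z z' => (hP j (z, z')).trans (hi j)⟩

/-- A version of the theorem on sums for weakly coupled systems: the doubled sup-convolutions have
a slightly perturbed maximum at which they are twice differentiable. -/
theorem exists_regular_maximizer [FiniteDimensional ℝ H] {ι : Type*} [Finite ι] [Nonempty ι]
    {U W : ι → H → ℝ} (hU : ∀ i, Continuous (U i)) (hW : ∀ i, Continuous (W i)) {B k β δ : ℝ}
    (hUB : ∀ i x, |U i x| ≤ B) (hWB : ∀ i x, |W i x| ≤ B) (hk : 0 < k) (hβ : 0 < β)
    (hδ : 0 < δ) :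
    ∃ (i : ι) (x y x' y' q₁ q₂ : H) (X Y : H →L[ℝ] H), ‖q₁‖ < δ ∧ ‖q₂‖ < δ ∧
      (∀ j z z', U j z + W j z' - k / 2 * ‖z - z'‖ ^ 2 - β / 2 * (‖z‖ ^ 2 + ‖z'‖ ^ 2)
          - ⟪q₁, z⟫ - ⟪q₂, z'⟫
        ≤ U i x' + W i y' - k / 2 * ‖x - x'‖ ^ 2 - k / 2 * ‖y - y'‖ ^ 2 - k / 2 * ‖x - y‖ ^ 2
          - β / 2 * (‖x‖ ^ 2 + ‖y‖ ^ 2) - ⟪q₁, x⟫ - ⟪q₂, y⟫) ∧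
      (∀ j, U j x' + W j y' ≤ U i x' + W i y') ∧
      HasSuperjet (U i) x' (k • (x - y) + β • x + q₁) X ∧
      HasSuperjet (W i) y' (k • (y - x) + β • y + q₂) Y ∧
      ∀ h g, ⟪X h, h⟫ + ⟪Y g, g⟫ ≤ k * ‖h - g‖ ^ 2 + β * (‖h‖ ^ 2 + ‖g‖ ^ 2) := by
  choose S hS using fun i => exists_selectsSupConv (hU i) (hUB i) hk
  choose S' hS' using fun i => exists_selectsSupConv (hW i) (hWB i) hk
  choose J hJ using fun i => (hS i).exists_resolvent (hUB i) hk
  choose J' hJ' using fun i => (hS' i).exists_resolvent (hWB i) hk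
  let T : ι → H × H → H × H := fun i ζ =>
    (ζ.1 - (1 + 2 * k + β) • J i ζ.1 + k • J' i ζ.2,
      ζ.2 - (1 + 2 * k + β) • J' i ζ.2 + k • J i ζ.1)
  have hJl : ∀ i, LipschitzWith 1 (J i) := fun i => resolvent_lipschitz (hJ i)
  have hJl' : ∀ i, LipschitzWith 1 (J' i) := fun i => resolvent_lipschitz (hJ' i)
  have hT : ∀ i, ∃ K, LipschitzWith K (T i) := by
    intro i
    have h1 := (hJl i).comp (LipschitzWith.prod_fst (α := H) (β := H))
    have h2 := (hJl' i).comp (LipschitzWith.prod_snd (α := H) (β := H))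
    have h3 := fun c : ℝ => (lipschitzWith_smul (β := H) c).comp h1
    have h4 := fun c : ℝ => (lipschitzWith_smul (β := H) c).comp h2
    exact ⟨_, ((LipschitzWith.prod_fst.sub (h3 (1 + 2 * k + β))).add (h4 k)).prodMk
      ((LipschitzWith.prod_snd.sub (h4 (1 + 2 * k + β))).add (h3 k))⟩
  obtain ⟨⟨q₁, q₂⟩, hq₁, hq₂, hq⟩ := exists_small_regular_value hT hJl hJl' hδ
  obtain ⟨i, x, y, hmax⟩ := exists_doubled_max (u := fun i => supConv (U i) k (S i))
    (w := fun i => supConv (W i) k (S' i)) (fun i => (hS i).continuous)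
    (fun i => (hS' i).continuous) (B := B)
    (fun i x => by
      have h1 := (abs_le.1 (hUB i (S i x))).2
      have h2 : 0 ≤ k / 2 * ‖x - S i x‖ ^ 2 := by positivity
      simp only [supConv]; linarith)
    (fun i x => by
      have h1 := (abs_le.1 (hWB i (S' i x))).2
      have h2 : 0 ≤ k / 2 * ‖x - S' i x‖ ^ 2 := by positivity
      simp only [supConv]; linarith) hk hβ q₁ q₂
  have hexp : ∀ v z : H, ‖z‖ ^ 2 = ‖v‖ ^ 2 + 2 * ⟪v, z - v⟫ + ‖z - v‖ ^ 2 := by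
    intro v z
    rw [← norm_add_sq_real, add_sub_cancel]
  obtain ⟨heq, hJx, hreg⟩ := (hS i).second_order hk (hJ i) (x := x)
    (a := k • (x - y) + β • x + q₁) (c := k + β) (by linarith) (fun z => by
      have h1 := hmax i z y
      rw [hexp (x - y) (z - y), hexp x z] at h1
      have e : z - y - (x - y) = z - x := by abel
      rw [e] at h1
      simp only [inner_add_left, real_inner_smul_left]
      rw [inner_sub_right q₁ z x]
      linarith)
  obtain ⟨heq', hJy, hreg'⟩ := (hS' i).second_order hk (hJ' i) (x := y)
    (a := k • (y - x) + β • y + q₂) (c := k + β) (by linarith) (fun z => by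
      have h1 := hmax i x z
      rw [norm_sub_rev x z, norm_sub_rev x y, hexp (y - x) (z - x), hexp y z] at h1
      have e : z - x - (y - x) = z - y := by abel
      rw [e] at h1
      simp only [inner_add_left, real_inner_smul_left]
      rw [inner_sub_right q₂ z y]
      linarith)
  obtain ⟨hd, hd'⟩ := hq i
    (x + ((k • (x - y) + β • x + q₁) + k • x), y + ((k • (y - x) + β • y + q₂) + k • y)) (by
      simp only [T, hJx, hJy, Prod.mk.injEq]
      constructor <;> module)
  obtain ⟨X, hX⟩ := hreg hd
  obtain ⟨Y, hY⟩ := hreg' hd'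
  have hjet : ∀ {w : H → ℝ} {x a : H} {X : H →L[ℝ] H},
      (∀ ε > 0, ∃ r > 0, ∀ h : H, ‖h‖ < r →
        |w (x + h) - w x - ⟪a, h⟫ - ⟪X h, h⟫ / 2| ≤ ε * ‖h‖ ^ 2) → HasSuperjet w x a X := by
    intro w x a X h ε hε
    obtain ⟨r, hr, h⟩ := h ε hε
    exact ⟨r, hr, fun v hv => by linarith [(abs_le.1 (h v hv)).2]⟩
  refine ⟨i, x, y, S i x, S' i y, q₁, q₂, X, Y, hq₁, hq₂, fun j z z' => ?_, fun j => ?_,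
    (hS i).hasSuperjet (hjet hX), (hS' i).hasSuperjet (hjet hY),
    quadratic_form_le_of_max rfl rfl hX hY (hmax i)⟩
  · have h1 := hmax j z z'
    have h2 := (hS j).le_supConv z
    have h3 := (hS' j).le_supConv z'
    simp only [supConv] at h1 h2 h3
    linarith
  · have h1 := hmax j x y
    have h2 := hS j x (S i x)
    have h3 := hS' j y (S' i y)
    simp only [supConv] at h1
    linarith

end Maximum

section Localization

variable {H : Type*} [NormedAddCommGroup H] [InnerProductSpace ℝ H]

theorem sq_sub_sq_le_of_sub_le {m n t R : ℝ} (hm : 0 ≤ m) (hnR : n ≤ R) (ht : 0 ≤ t)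
    (ht2 : t ≤ 2) (h : m - n ≤ t) : m ^ 2 - n ^ 2 ≤ t * (2 * R + 2) := by
  have h1 : m ^ 2 ≤ (n + t) ^ 2 := by gcongr; linarith
  have h2 : t * n ≤ t * R := by gcongr
  have h3 : t * t ≤ t * 2 := by gcongr
  linarith

set_option maxHeartbeats 1000000 in
/-- Doubling of variables for two bounded continuous systems: all penalization terms can be made
arbitrarily small at a regular maximum. -/
theorem exists_localized_maximizer [FiniteDimensional ℝ H] {ι : Type*} [Finite ι]
    {U V : ι → H → ℝ} (hU : ∀ i, Continuous (U i)) (hV : ∀ i, Continuous (V i)) {B : ℝ}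
    (hUB : ∀ i x, |U i x| ≤ B) (hVB : ∀ i x, |V i x| ≤ B) {s θ : ℝ} (hs : 0 ≤ s) (hθ : 0 < θ)
    {i₀ : ι} {x₀ : H} (h₀ : s + 2 * θ ≤ U i₀ x₀ - V i₀ x₀) {η : ℝ} (hη : 0 < η) :
    ∃ (k β : ℝ) (i : ι) (x y x' y' q₁ q₂ : H) (X Y : H →L[ℝ] H), 0 < k ∧ 0 < β ∧ β ≤ η ∧
      ‖q₁‖ ≤ η ∧ ‖q₂‖ ≤ η ∧ β * ‖x‖ ≤ η ∧ β * ‖y‖ ≤ η ∧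
      ‖x' - y'‖ ≤ η ∧ k * ‖x' - y'‖ ^ 2 ≤ η ∧ k * ‖x - y‖ * ‖x' - y'‖ ≤ η ∧
      s + θ ≤ U i x' - V i y' ∧
      (∀ j, U j x' - V j y' ≤ U i x' - V i y') ∧
      HasSuperjet (U i) x' (k • (x - y) + β • x + q₁) X ∧
      HasSuperjet (fun z => -V i z) y' (k • (y - x) + β • y + q₂) Y ∧
      ∀ h g, ⟪X h, h⟫ + ⟪Y g, g⟫ ≤ k * ‖h - g‖ ^ 2 + β * (‖h‖ ^ 2 + ‖g‖ ^ 2) := by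
  have : Nonempty ι := ⟨i₀⟩
  have := Fintype.ofFinite ι
  have := FiniteDimensional.proper_real H
  have hB : 0 ≤ B := (abs_nonneg _).trans (hUB i₀ x₀)
  set A := ‖x₀‖ ^ 2 + 2 * ‖x₀‖ + 2 with hA
  have hApos : 0 < A := by positivity
  obtain ⟨γ, hγ, hγ1, hγη, hγA⟩ : ∃ γ : ℝ, 0 < γ ∧ γ ≤ 1 ∧ γ * (8 * B + 1) ≤ η ∧ γ * A ≤ θ := by
    refine ⟨min 1 (min (η / (8 * B + 1)) (θ / A)), by positivity, min_le_left _ _, ?_, ?_⟩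
    · rw [← le_div_iff₀ (by positivity)]
      exact (min_le_right _ _).trans (min_le_left _ _)
    · rw [← le_div_iff₀ hApos]
      exact (min_le_right _ _).trans (min_le_right _ _)
  set β := γ ^ 2 with hβdef
  have hβ : 0 < β := by positivity
  have hβγ : β ≤ γ := by nlinarith
  have hβη : β ≤ η := by nlinarith
  set R := (8 * B + 1) / γ with hR
  have hRpos : 0 < R := by positivity
  have huc : UniformContinuousOn (fun x i => V i x) (Metric.closedBall (0 : H) (R + 1)) :=
    (isCompact_closedBall _ _).uniformContinuousOn_of_continuous
      (continuous_pi hV).continuousOn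
  obtain ⟨r, hr, hosc⟩ := Metric.uniformContinuousOn_iff.1 huc (η / 36) (by positivity)
  obtain ⟨τ₀, hτ₀, hτ1, hτr, hτη, hτβ⟩ : ∃ τ₀ : ℝ, 0 < τ₀ ∧ τ₀ ≤ 1 ∧ 3 * τ₀ < r ∧ 3 * τ₀ ≤ η ∧
      β * (3 * R + 6) * τ₀ ≤ η / 36 := by
    refine ⟨min (min 1 (r / 4)) (min (η / 3) (η / 36 / (β * (3 * R + 6)))), by positivity,
      (min_le_left _ _).trans (min_le_left _ _), ?_, ?_, ?_⟩
    · have := (min_le_left (min 1 (r / 4)) (min (η / 3) (η / 36 / (β * (3 * R + 6))))).trans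
        (min_le_right _ _)
      linarith
    · have := (min_le_right (min 1 (r / 4)) (min (η / 3) (η / 36 / (β * (3 * R + 6))))).trans
        (min_le_left _ _)
      linarith
    · rw [mul_comm, ← le_div_iff₀ (by positivity)]
      exact (min_le_right _ _).trans (min_le_right _ _)
  set k := (4 * B + 1) / τ₀ ^ 2 with hkdef
  have hk : 0 < k := by positivity
  obtain ⟨i, x, y, x', y', q₁, q₂, X, Y, hq₁, hq₂, hmax, hj, hX, hY, hXY⟩ :=
    exists_regular_maximizer (U := U) (W := fun i z => -V i z) hU (fun i => (hV i).neg) (B := B)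
      hUB (fun i x => by rw [abs_neg]; exact hVB i x) hk hβ hβ
  have hlin : ∀ q z : H, ‖q‖ < β → -⟪q, z⟫ ≤ β * ‖z‖ ∧ ⟪q, z⟫ ≤ β * ‖z‖ := by
    intro q z hq
    have h1 := abs_le.1 (abs_real_inner_le_norm q z)
    have h2 : ‖q‖ * ‖z‖ ≤ β * ‖z‖ := by gcongr
    constructor <;> linarith
  set D := ‖x - x'‖ ^ 2 + ‖y - y'‖ ^ 2 + ‖x - y‖ ^ 2 with hD
  have hD0 : 0 ≤ D := by positivity
  have hm2 : U i x' - V i y' ≤ 2 * B := by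
    linarith [(abs_le.1 (hUB i x')).2, (abs_le.1 (hVB i y')).1]
  have hcoarse : s + θ + k / 2 * D + β / 4 * (‖x‖ ^ 2 + ‖y‖ ^ 2) ≤ U i x' - V i y' := by
    have h1 := hmax i₀ x₀ x₀
    have h2 := (hlin q₁ x₀ hq₁).2
    have h3 := (hlin q₂ x₀ hq₂).2
    have h4 := (hlin q₁ x hq₁).1
    have h5 := (hlin q₂ y hq₂).1
    have h6 : β * ‖x‖ ≤ β / 4 * ‖x‖ ^ 2 + β := by
      linarith [mul_nonneg hβ.le (sq_nonneg (‖x‖ / 2 - 1))]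
    have h7 : β * ‖y‖ ≤ β / 4 * ‖y‖ ^ 2 + β := by
      linarith [mul_nonneg hβ.le (sq_nonneg (‖y‖ / 2 - 1))]
    have h8 : β * A ≤ θ := (mul_le_mul_of_nonneg_right hβγ hApos.le).trans hγA
    rw [sub_self, norm_zero] at h1
    simp only [hA] at h8
    simp only [hD]
    linarith
  have hγbound : ∀ n : ℝ, 0 ≤ n → β / 4 * n ^ 2 ≤ 2 * B → γ * n ≤ 8 * B + 1 := by
    intro n hn h
    have h1 : (γ * n) ^ 2 ≤ 8 * B := by rw [mul_pow]; linarith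
    by_contra! hcon
    have h2 : (8 * B + 1) ^ 2 < (γ * n) ^ 2 := by gcongr
    linarith [sq_nonneg B]
  have hkD : 0 ≤ k / 2 * D := by positivity
  have hxx : 0 ≤ β / 4 * ‖x‖ ^ 2 := by positivity
  have hyy : 0 ≤ β / 4 * ‖y‖ ^ 2 := by positivity
  have hγx := hγbound ‖x‖ (norm_nonneg _) (by linarith)
  have hγy := hγbound ‖y‖ (norm_nonneg _) (by linarith)
  have hxR : ‖x‖ ≤ R := by rw [hR, le_div_iff₀ hγ]; linarith
  have hyR : ‖y‖ ≤ R := by rw [hR, le_div_iff₀ hγ]; linarith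
  set τ := Real.sqrt D with hτ
  have hτ0 : 0 ≤ τ := Real.sqrt_nonneg _
  have hτD : τ ^ 2 = D := Real.sq_sqrt hD0
  have hττ₀ : τ ≤ τ₀ := by
    have h1 : k * D ≤ 4 * B := by linarith
    rw [hkdef, div_mul_eq_mul_div, div_le_iff₀ (by positivity)] at h1
    by_contra! hcon
    have h2 : τ₀ ^ 2 < D := by rw [← hτD]; gcongr
    have h3 : (4 * B + 1) * τ₀ ^ 2 < (4 * B + 1) * D := by gcongr
    linarith [sq_pos_of_pos hτ₀]
  have hxx' : ‖x - x'‖ ≤ τ :=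
    Real.le_sqrt_of_sq_le (by rw [hD]; linarith [sq_nonneg ‖y - y'‖, sq_nonneg ‖x - y‖])
  have hyy' : ‖y - y'‖ ≤ τ :=
    Real.le_sqrt_of_sq_le (by rw [hD]; linarith [sq_nonneg ‖x - x'‖, sq_nonneg ‖x - y‖])
  have hxy : ‖x - y‖ ≤ τ :=
    Real.le_sqrt_of_sq_le (by rw [hD]; linarith [sq_nonneg ‖x - x'‖, sq_nonneg ‖y - y'‖])
  have hx'y : ‖x' - y‖ ≤ 2 * τ := by
    have := norm_sub_le_norm_sub_add_norm_sub x' x y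
    rw [norm_sub_rev x' x] at this
    linarith
  have hx'y' : ‖x' - y'‖ ≤ 3 * τ := by
    have := norm_sub_le_norm_sub_add_norm_sub x' y y'
    linarith
  have hx'1 : ‖x'‖ - ‖x‖ ≤ τ := by
    have := norm_sub_norm_le x' x
    rw [norm_sub_rev] at this
    linarith
  have hx'2 : ‖x'‖ - ‖y‖ ≤ 2 * τ := (norm_sub_norm_le x' y).trans hx'y
  have hy'1 : ‖y'‖ - ‖y‖ ≤ τ := by
    have := norm_sub_norm_le y' y
    rw [norm_sub_rev] at this
    linarith
  have hVosc : V i x' - V i y' ≤ η / 36 := by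
    have h1 := hosc x' (by rw [mem_closedBall_zero_iff]; linarith) y'
      (by rw [mem_closedBall_zero_iff]; linarith) (by rw [dist_eq_norm]; linarith)
    have h2 := (dist_le_pi_dist (fun i => V i x') (fun i => V i y') i).trans h1.le
    rw [Real.dist_eq] at h2
    exact (abs_le.1 h2).2
  have hfine : k * D ≤ η / 9 := by
    have h1 := hmax i x' x'
    rw [sub_self, norm_zero] at h1
    have h2 := (hlin q₁ (x' - x) hq₁).2
    have h3 := (hlin q₂ (x' - y) hq₂).2
    rw [inner_sub_right] at h2 h3
    rw [norm_sub_rev x' x] at h2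
    have h4 : ‖x'‖ ^ 2 - ‖x‖ ^ 2 ≤ τ * (2 * R + 2) :=
      sq_sub_sq_le_of_sub_le (norm_nonneg _) hxR hτ0 (by linarith) hx'1
    have h5 : ‖x'‖ ^ 2 - ‖y‖ ^ 2 ≤ 2 * τ * (2 * R + 2) :=
      sq_sub_sq_le_of_sub_le (norm_nonneg _) hyR (by linarith) (by linarith) hx'2
    have h6 : β * (3 * R + 6) * τ ≤ η / 36 :=
      (mul_le_mul_of_nonneg_left hττ₀ (by positivity)).trans hτβ
    have h7 : β / 2 * (‖x'‖ ^ 2 - ‖x‖ ^ 2) ≤ β / 2 * (τ * (2 * R + 2)) := by gcongr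
    have h8 : β / 2 * (‖x'‖ ^ 2 - ‖y‖ ^ 2) ≤ β / 2 * (2 * τ * (2 * R + 2)) := by gcongr
    have h9 : β * ‖x - x'‖ ≤ β * τ := by gcongr
    have h10 : β * ‖x' - y‖ ≤ β * (2 * τ) := by gcongr
    have h11 : 0 ≤ β * τ := by positivity
    have h12 : k * D = 2 * (k / 2 * ‖x - x'‖ ^ 2 + k / 2 * ‖y - y'‖ ^ 2 + k / 2 * ‖x - y‖ ^ 2) := by
      rw [hD]; ring
    rw [h12]
    linarith
  refine ⟨k, β, i, x, y, x', y', q₁, q₂, X, Y, hk, hβ, hβη, by linarith, by linarith, ?_, ?_,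
    by linarith, ?_, ?_, by linarith, fun j => by linarith [hj j], hX, hY, hXY⟩
  · calc β * ‖x‖ = γ * (γ * ‖x‖) := by rw [hβdef]; ring
      _ ≤ γ * (8 * B + 1) := by gcongr
      _ ≤ η := hγη
  · calc β * ‖y‖ = γ * (γ * ‖y‖) := by rw [hβdef]; ring
      _ ≤ γ * (8 * B + 1) := by gcongr
      _ ≤ η := hγη
  · calc k * ‖x' - y'‖ ^ 2 ≤ k * (3 * τ) ^ 2 := by gcongr
      _ = 9 * (k * D) := by rw [← hτD]; ring
      _ ≤ η := by linarith
  · calc k * ‖x - y‖ * ‖x' - y'‖ ≤ k * τ * (3 * τ) := by gcongr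
      _ = 3 * (k * D) := by rw [← hτD]; ring
      _ ≤ η := by linarith

end Localization

/-- The symmetric matrix of the quadratic form of `X`. -/
def symHess (X : E d →L[ℝ] E d) : Matrix (Fin d) (Fin d) ℝ :=
  Matrix.of fun i j =>
    (⟪X (EuclideanSpace.single i 1), EuclideanSpace.single j 1⟫
      + ⟪X (EuclideanSpace.single j 1), EuclideanSpace.single i 1⟫) / 2

/-- The quadratic polynomial at `x` with gradient `a` and Hessian `X`. -/
def quadPoly (x a : E d) (X : E d →L[ℝ] E d) (w : E d) : ℝ :=
  ⟪a, w - x⟫ + ⟪X (w - x), w - x⟫ / 2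

theorem contDiff_quadPoly (x a : E d) (X : E d →L[ℝ] E d) : ContDiff ℝ 2 (quadPoly x a X) := by
  unfold quadPoly
  have h : ContDiff ℝ 2 fun w : E d => w - x := contDiff_id.sub contDiff_const
  exact (contDiff_const.inner ℝ h).add (((X.contDiff.comp h).inner ℝ h).div_const _)

theorem hasFDerivAt_quadPoly (x a : E d) (X : E d →L[ℝ] E d) (w : E d) :
    HasFDerivAt (quadPoly x a X)
      (innerSL ℝ (a + (1 / 2 : ℝ) • (X (w - x) + ContinuousLinearMap.adjoint X (w - x)))) w := by
  have h : HasFDerivAt (fun w : E d => w - x) (ContinuousLinearMap.id ℝ (E d)) w :=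
    (hasFDerivAt_id w).sub_const x
  have h1 := ((hasFDerivAt_const a w).inner ℝ h).add
    (((X.hasFDerivAt.comp w h).inner ℝ h).mul_const (1 / 2 : ℝ))
  refine (h1.congr_fderiv ?_).congr_of_eventuallyEq (Eventually.of_forall fun z => ?_)
  · ext v
    simp [ContinuousLinearMap.adjoint_inner_left, real_inner_comm]
    rw [inner_sub_right, inner_sub_left]
    ring
  · simp [quadPoly, div_eq_mul_inv]

theorem gradient_quadPoly (x a : E d) (X : E d →L[ℝ] E d) : gradient (quadPoly x a X) x = a := by
  apply HasGradientAt.gradient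
  rw [hasGradientAt_iff_hasFDerivAt]
  refine (hasFDerivAt_quadPoly x a X x).congr_fderiv ?_
  ext v
  simp

theorem hess_quadPoly (x a : E d) (X : E d →L[ℝ] E d) : hess (quadPoly x a X) x = symHess X := by
  have h1 : fderiv ℝ (quadPoly x a X) = fun w =>
      innerSL ℝ (a + (1 / 2 : ℝ) • (X (w - x) + ContinuousLinearMap.adjoint X (w - x))) := by
    funext w
    exact (hasFDerivAt_quadPoly x a X w).fderiv
  have h2 : HasFDerivAt (fun w => innerSL ℝ
      (a + (1 / 2 : ℝ) • (X (w - x) + ContinuousLinearMap.adjoint X (w - x))))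
      ((innerSL ℝ : E d →L[ℝ] E d →L[ℝ] ℝ).comp
        ((1 / 2 : ℝ) • (X + ContinuousLinearMap.adjoint X))) x := by
    have h : HasFDerivAt (fun w : E d => w - x) (ContinuousLinearMap.id ℝ (E d)) x :=
      (hasFDerivAt_id x).sub_const x
    have h3 := (((X.hasFDerivAt.comp x h).add
      ((ContinuousLinearMap.adjoint X).hasFDerivAt.comp x h)).const_smul (1 / 2 : ℝ)).const_add a
    exact (innerSL ℝ : E d →L[ℝ] E d →L[ℝ] ℝ).hasFDerivAt.comp x h3
  ext i j
  simp only [hess, symHess, Matrix.of_apply, iteratedFDeriv_two_apply, h1, h2.fderiv]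
  simp [ContinuousLinearMap.adjoint_inner_left]
  rw [real_inner_comm (X (EuclideanSpace.single j 1))]
  ring

/-- A column of a matrix as a Euclidean vector. -/
def euclideanCol (A : Matrix (Fin d) (Fin d') ℝ) (l : Fin d') : E d := WithLp.toLp 2 fun k => A k l

theorem sum_norm_sq_euclideanCol (A : Matrix (Fin d) (Fin d') ℝ) :
    ∑ l, ‖euclideanCol A l‖ ^ 2 = frobNorm A ^ 2 := by
  rw [frobNorm, Real.sq_sqrt (by positivity), Finset.sum_comm]
  simp [euclideanCol, EuclideanSpace.norm_sq_eq]

theorem trace_mul_symHess (A : Matrix (Fin d) (Fin d') ℝ) (X : E d →L[ℝ] E d) :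
    Matrix.trace (((1 : ℝ) / 2) • (A * Aᵀ) * symHess X)
      = (∑ l, ⟪X (euclideanCol A l), euclideanCol A l⟫) / 2 := by
  have hcol : ∀ l, euclideanCol A l = ∑ k, A k l • EuclideanSpace.single k (1 : ℝ) := by
    intro l
    ext k
    simp [euclideanCol, Finset.sum_apply, Pi.single_apply]
  have hquad : ∀ l, ⟪X (euclideanCol A l), euclideanCol A l⟫ = ∑ k, ∑ m, A k l * A m l *
      ⟪X (EuclideanSpace.single k 1), EuclideanSpace.single m 1⟫ := by
    intro l
    rw [hcol l, map_sum, sum_inner]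
    refine Finset.sum_congr rfl fun k _ => ?_
    rw [inner_sum]
    refine Finset.sum_congr rfl fun m _ => ?_
    rw [map_smul, real_inner_smul_left, real_inner_smul_right]
    ring
  have hquad' : ∀ l, ⟪X (euclideanCol A l), euclideanCol A l⟫ = ∑ k, ∑ m, A k l * A m l *
      ⟪X (EuclideanSpace.single m 1), EuclideanSpace.single k 1⟫ := by
    intro l
    rw [hquad l, Finset.sum_comm]
    refine Finset.sum_congr rfl fun k _ => Finset.sum_congr rfl fun m _ => ?_
    ring
  have hsym : ∀ l, ⟪X (euclideanCol A l), euclideanCol A l⟫ = ∑ k, ∑ m, A k l * A m l *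
      symHess X m k := by
    intro l
    have h : ⟪X (euclideanCol A l), euclideanCol A l⟫
        = (⟪X (euclideanCol A l), euclideanCol A l⟫
          + ⟪X (euclideanCol A l), euclideanCol A l⟫) / 2 := by ring
    rw [h]
    nth_rewrite 1 [hquad l]
    rw [hquad' l, ← Finset.sum_add_distrib, Finset.sum_div]
    refine Finset.sum_congr rfl fun k _ => ?_
    rw [← Finset.sum_add_distrib, Finset.sum_div]
    refine Finset.sum_congr rfl fun m _ => ?_
    simp only [symHess, Matrix.of_apply]
    ring
  simp only [hsym]
  rw [Finset.sum_comm, Matrix.smul_mul, Matrix.trace_smul]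
  simp only [Matrix.trace, Matrix.diag_apply, Matrix.mul_apply, Matrix.transpose_apply,
    Finset.sum_mul, smul_eq_mul]
  rw [one_div, inv_mul_eq_div]
  congr 1
  exact Finset.sum_congr rfl fun k _ => Finset.sum_comm

/-- Testing a subsolution with a superjet. -/
theorem IsSubsolution.of_superjet {F : Op d M} {u : Fin M → E d → ℝ} (hu : IsSubsolution F u)
    {i : Fin M} {x a : E d} {X : E d →L[ℝ] E d} (hX : HasSuperjet (u i) x a X) {ε : ℝ}
    (hε : 0 < ε) :
    F i x u a (symHess (X + (2 * ε) • ContinuousLinearMap.id ℝ (E d))) ≤ 0 := by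
  obtain ⟨r, hr, h⟩ := hX ε hε
  have := hu.2 i _ (contDiff_quadPoly x a (X + (2 * ε) • ContinuousLinearMap.id ℝ (E d))) x ?_
  · rwa [gradient_quadPoly, hess_quadPoly] at this
  · filter_upwards [Metric.ball_mem_nhds x hr] with w hw
    rw [mem_ball_iff_norm] at hw
    have h1 := h (w - x) hw
    rw [add_sub_cancel] at h1
    simp only [quadPoly, sub_self, inner_zero_right, zero_div, _root_.add_apply,
      _root_.smul_apply, ContinuousLinearMap.id_apply, inner_add_left,
      real_inner_smul_left, real_inner_self_eq_norm_sq]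
    linarith

/-- Testing a supersolution with a superjet of its negative. -/
theorem IsSupersolution.of_superjet {F : Op d M} {v : Fin M → E d → ℝ} (hv : IsSupersolution F v)
    {i : Fin M} {y b : E d} {Y : E d →L[ℝ] E d} (hY : HasSuperjet (fun z => -v i z) y b Y) {ε : ℝ}
    (hε : 0 < ε) :
    0 ≤ F i y v (-b) (symHess (-(Y + (2 * ε) • ContinuousLinearMap.id ℝ (E d)))) := by
  obtain ⟨r, hr, h⟩ := hY ε hε
  have := hv.2 i _
    (contDiff_quadPoly y (-b) (-(Y + (2 * ε) • ContinuousLinearMap.id ℝ (E d)))) y ?_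
  · rwa [gradient_quadPoly, hess_quadPoly] at this
  · filter_upwards [Metric.ball_mem_nhds y hr] with w hw
    rw [mem_ball_iff_norm] at hw
    have h1 := h (w - y) hw
    rw [add_sub_cancel] at h1
    simp only [quadPoly, sub_self, inner_zero_right, zero_div, _root_.add_apply,
      _root_.smul_apply, _root_.neg_apply, ContinuousLinearMap.id_apply, inner_add_left,
      inner_neg_left, real_inner_smul_left, real_inner_self_eq_norm_sq]
    linarith

/-- The intervention operator commutes with constants up to monotonicity. -/
theorem ImpulseData.Mop_le_add (Q : ImpulseData d M 𝒵) {u v : Fin M → E d → ℝ}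
    (hu : ∀ i, InC01 (u i)) (hv : ∀ i, InC01 (v i)) {s : ℝ} (hs : 0 ≤ s)
    (huv : ∀ i x, u i x - v i x ≤ s) (i : Fin M) (x : E d) :
    Q.Mop i u x ≤ Q.Mop i v x + s := by
  unfold ImpulseData.Mop
  rcases (Q.Z i x).eq_empty_or_nonempty with hZ | hZ
  · simpa [hZ] using hs
  obtain ⟨B, hB⟩ := (hu i).2.1
  obtain ⟨B', hB'⟩ := (hv i).2.1
  have hbdd : ∀ f g : E d → ℝ, (∀ x, |f x| ≤ B ∨ |f x| ≤ B') → (∀ x, |g x| ≤ B ∨ |g x| ≤ B') →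
      BddBelow ((fun z => f (Q.Γ i x z) + Q.K i x z) '' Q.Z i x) →
      BddBelow ((fun z => g (Q.Γ i x z) + Q.K i x z) '' Q.Z i x) := by
    rintro f g hf hg ⟨m, hm⟩
    refine ⟨m - 2 * max B B', ?_⟩
    rintro _ ⟨z, hz, rfl⟩
    have h1 := hm ⟨z, hz, rfl⟩
    have h2 : |f (Q.Γ i x z)| ≤ max B B' := (hf _).elim le_max_of_le_left le_max_of_le_right
    have h3 : |g (Q.Γ i x z)| ≤ max B B' := (hg _).elim le_max_of_le_left le_max_of_le_right
    dsimp only at h1 ⊢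
    linarith [(abs_le.1 h2).2, (abs_le.1 h3).1]
  by_cases hb : BddBelow ((fun z => u i (Q.Γ i x z) + Q.K i x z) '' Q.Z i x)
  · rw [← sub_le_iff_le_add]
    refine le_csInf (hZ.image _) ?_
    rintro _ ⟨z, hz, rfl⟩
    have h1 := csInf_le hb ⟨z, hz, rfl⟩
    dsimp only at h1 ⊢
    linarith [huv i (Q.Γ i x z)]
  · have hb' : ¬ BddBelow ((fun z => v i (Q.Γ i x z) + Q.K i x z) '' Q.Z i x) :=
      fun h => hb (hbdd _ _ (fun x => .inr (hB' x)) (fun x => .inl (hB x)) h)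
    rw [Real.sInf_of_not_bddBelow hb, Real.sInf_of_not_bddBelow hb']
    linarith

theorem H1.nonneg {P : HJBData d d' M 𝒜} {C lam0 : ℝ} (h1 : H1 P C lam0) (i : Fin M) : 0 ≤ C := by
  obtain ⟨α, hα⟩ := (h1.2.1 i).1
  obtain ⟨-, -, -, -, -, -, -, -, -, hc, -⟩ := h1.2.2 i α hα
  exact (abs_nonneg _).trans (hc 0)

theorem H1.bddAbove_L {P : HJBData d d' M 𝒜} {C lam0 : ℝ} (h1 : H1 P C lam0) (i : Fin M) (x : E d)
    (s : Fin M → ℝ) (p : E d) (X : E d →L[ℝ] E d) :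
    BddAbove ((fun α => P.L i α x s p (symHess X)) '' P.A i) := by
  refine ⟨‖X‖ * C ^ 2 / 2 + C * ‖p‖ + C * |s i| + C + ∑ j ∈ Finset.univ.erase i, C * |s j|, ?_⟩
  rintro _ ⟨α, hα, rfl⟩
  obtain ⟨-, -, -, -, -, hσ, -, hb, -, hc, -, hl, -, hd, -, -⟩ := h1.2.2 i α hα
  have htr : -(∑ l, ⟪X (euclideanCol (P.σm i α x) l), euclideanCol (P.σm i α x) l⟫)
      ≤ ‖X‖ * C ^ 2 := by
    calc -(∑ l, ⟪X (euclideanCol (P.σm i α x) l), euclideanCol (P.σm i α x) l⟫)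
        ≤ ∑ l, ‖X‖ * ‖euclideanCol (P.σm i α x) l‖ ^ 2 := by
          rw [← Finset.sum_neg_distrib]
          refine Finset.sum_le_sum fun l _ => ?_
          refine (neg_le_abs _).trans ((abs_real_inner_le_norm _ _).trans ?_)
          rw [pow_two, ← mul_assoc]
          gcongr
          exact X.le_opNorm _
      _ = ‖X‖ * frobNorm (P.σm i α x) ^ 2 := by rw [← Finset.mul_sum, sum_norm_sq_euclideanCol]
      _ ≤ ‖X‖ * C ^ 2 := by
          gcongr
          · exact Real.sqrt_nonneg _
          · exact hσ x
  have hdrift : -⟪P.bv i α x, p⟫ ≤ C * ‖p‖ :=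
    (neg_le_abs _).trans ((abs_real_inner_le_norm _ _).trans (by gcongr; exact hb x))
  have hzero : P.cz i α x * s i ≤ C * |s i| := by
    refine (le_abs_self _).trans ?_
    rw [abs_mul]
    gcongr
    exact hc x
  have hcoupl : -(∑ j ∈ Finset.univ.erase i, P.dcp i j α x * s j)
      ≤ ∑ j ∈ Finset.univ.erase i, C * |s j| := by
    rw [← Finset.sum_neg_distrib]
    refine Finset.sum_le_sum fun j _ => (neg_le_abs _).trans ?_
    rw [abs_mul]
    gcongr
    exact (hd j).1 x
  have hrun := (abs_le.1 (hl x)).1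
  dsimp only [HJBData.L]
  rw [trace_mul_symHess]
  linarith

/-- The structure condition for the linear operators under a doubling inequality on the Hessians. -/
theorem H1.structure_estimate {P : HJBData d d' M 𝒜} {C lam0 : ℝ} (h1 : H1 P C lam0) {i : Fin M}
    {α : 𝒜} (hα : α ∈ P.A i) {x y a b : E d} {X Y : E d →L[ℝ] E d} {k β : ℝ} (hk : 0 ≤ k)
    (hβ : 0 ≤ β) (hXY : ∀ h g, ⟪X h, h⟫ + ⟪Y g, g⟫ ≤ k * ‖h - g‖ ^ 2 + β * (‖h‖ ^ 2 + ‖g‖ ^ 2))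
    {r t : Fin M → ℝ} (hj : ∀ j, r j - t j ≤ r i - t i) (hm : 0 ≤ r i - t i) {B : ℝ}
    (hB : ∀ j, |t j| ≤ B) :
    lam0 * (r i - t i) ≤ P.L i α x r a (symHess X) - P.L i α y t (-b) (symHess (-Y))
      + C ^ 2 * (k / 2 * ‖x - y‖ ^ 2 + β) + (⟪P.bv i α x, a⟫ + ⟪P.bv i α y, b⟫)
      + C * ‖x - y‖ * (1 + (1 + M) * B) := by
  have hC := h1.nonneg i
  have hB0 : 0 ≤ B := (abs_nonneg _).trans (hB i)
  obtain ⟨-, -, -, -, -, hσ, hσL, -, -, -, hcL, -, hlL, hd, hd0, hlam⟩ := h1.2.2 i α hα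
  have htr : ∑ l, ⟪X (euclideanCol (P.σm i α x) l), euclideanCol (P.σm i α x) l⟫
      + ∑ l, ⟪Y (euclideanCol (P.σm i α y) l), euclideanCol (P.σm i α y) l⟫
      ≤ C ^ 2 * (k * ‖x - y‖ ^ 2 + 2 * β) := by
    have hsub : ∀ l, euclideanCol (P.σm i α x) l - euclideanCol (P.σm i α y) l
        = euclideanCol (P.σm i α x - P.σm i α y) l := fun l => rfl
    calc _ ≤ ∑ l, (k * ‖euclideanCol (P.σm i α x - P.σm i α y) l‖ ^ 2
          + β * (‖euclideanCol (P.σm i α x) l‖ ^ 2 + ‖euclideanCol (P.σm i α y) l‖ ^ 2)) := by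
          rw [← Finset.sum_add_distrib]
          refine Finset.sum_le_sum fun l _ => ?_
          rw [← hsub]
          exact hXY _ _
      _ = k * frobNorm (P.σm i α x - P.σm i α y) ^ 2
          + β * (frobNorm (P.σm i α x) ^ 2 + frobNorm (P.σm i α y) ^ 2) := by
          rw [Finset.sum_add_distrib, ← Finset.mul_sum, ← Finset.mul_sum, Finset.sum_add_distrib]
          simp only [sum_norm_sq_euclideanCol]
      _ ≤ k * (C * ‖x - y‖) ^ 2 + β * (C ^ 2 + C ^ 2) := by
          gcongr <;> first | exact Real.sqrt_nonneg _ | exact hσL x y | exact hσ _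
      _ = C ^ 2 * (k * ‖x - y‖ ^ 2 + 2 * β) := by ring
  have hzero : -(C * ‖x - y‖ * B) ≤ (P.cz i α x - P.cz i α y) * t i := by
    refine neg_le_of_abs_le ?_
    rw [abs_mul]
    gcongr
    · exact hcL x y
    · exact hB i
  have hcoupl : ∑ j ∈ Finset.univ.erase i, (P.dcp i j α x - P.dcp i j α y) * t j
      ≤ M * (C * ‖x - y‖ * B) := by
    have hterm : ∀ j ∈ Finset.univ.erase i,
        (P.dcp i j α x - P.dcp i j α y) * t j ≤ C * ‖x - y‖ * B := by
      intro j _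
      refine (le_abs_self _).trans ?_
      rw [abs_mul]
      gcongr
      · exact (hd j).2 x y
      · exact hB j
    refine (Finset.sum_le_card_nsmul _ _ _ hterm).trans ?_
    rw [nsmul_eq_mul]
    gcongr
    exact_mod_cast (Finset.card_le_univ _).trans_eq (Fintype.card_fin M)
  have hmono : ∑ j ∈ Finset.univ.erase i, P.dcp i j α x * (r j - t j)
      ≤ (∑ j ∈ Finset.univ.erase i, P.dcp i j α x) * (r i - t i) := by
    rw [Finset.sum_mul]
    exact Finset.sum_le_sum fun j hmem => mul_le_mul_of_nonneg_left (hj j) (hd0 j hmem x)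
  have hlam' := mul_le_mul_of_nonneg_right (hlam x) hm
  have hrun := (abs_le.1 (hlL x y)).2
  dsimp only [HJBData.L]
  rw [trace_mul_symHess, trace_mul_symHess]
  simp only [_root_.neg_apply, inner_neg_left, inner_neg_right, Finset.sum_neg_distrib]
  simp only [mul_sub, sub_mul, Finset.sum_sub_distrib] at hmono hcoupl hlam' hzero ⊢
  linarith

/-- Cancellation of the first-order terms under doubling of variables. -/
theorem H1.drift_estimate {P : HJBData d d' M 𝒜} {C lam0 : ℝ} (h1 : H1 P C lam0) {i : Fin M}
    {α : 𝒜} (hα : α ∈ P.A i) {k β : ℝ} (hk : 0 ≤ k) (hβ : 0 ≤ β) (x y x' y' q₁ q₂ : E d) :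
    ⟪P.bv i α x', k • (x - y) + β • x + q₁⟫ + ⟪P.bv i α y', k • (y - x) + β • y + q₂⟫
      ≤ C * (k * ‖x - y‖ * ‖x' - y'‖) + C * (β * ‖x‖ + ‖q₁‖) + C * (β * ‖y‖ + ‖q₂‖) := by
  obtain ⟨-, -, -, -, -, -, -, hb, hbL, -⟩ := h1.2.2 i α hα
  have hsplit : ⟪P.bv i α x', k • (x - y) + β • x + q₁⟫ + ⟪P.bv i α y', k • (y - x) + β • y + q₂⟫
      = k * ⟪P.bv i α x' - P.bv i α y', x - y⟫ + ⟪P.bv i α x', β • x + q₁⟫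
        + ⟪P.bv i α y', β • y + q₂⟫ := by
    simp only [inner_add_right, inner_sub_right, inner_sub_left, real_inner_smul_right]
    ring
  have hres : ∀ w z q : E d, ⟪P.bv i α w, β • z + q⟫ ≤ C * (β * ‖z‖ + ‖q‖) := by
    intro w z q
    refine (real_inner_le_norm _ _).trans ?_
    have hz : ‖β • z + q‖ ≤ β * ‖z‖ + ‖q‖ := by
      simpa [norm_smul, abs_of_nonneg hβ] using norm_add_le (β • z) q
    have := h1.nonneg i
    gcongr
    exact hb w
  have hmain : k * ⟪P.bv i α x' - P.bv i α y', x - y⟫ ≤ C * (k * ‖x - y‖ * ‖x' - y'‖) := by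
    calc k * ⟪P.bv i α x' - P.bv i α y', x - y⟫ ≤ k * (C * ‖x' - y'‖ * ‖x - y‖) := by
          refine mul_le_mul_of_nonneg_left ((real_inner_le_norm _ _).trans ?_) hk
          gcongr
          exact hbL x' y'
      _ = C * (k * ‖x - y‖ * ‖x' - y'‖) := by ring
  rw [hsplit]
  linarith [hres x' x q₁, hres y' y q₂]

/-- A uniform Lipschitz constant for the intervention operator. -/
theorem H4.exists_lipschitz {Q : ImpulseData d M 𝒵} {C4 : ℝ} (h4 : H4 Q C4)
    {u : Fin M → E d → ℝ} (hu : ∀ i, InC01 (u i)) :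
    ∃ L, 0 ≤ L ∧ ∀ i x y, |Q.Mop i u x - Q.Mop i u y| ≤ L * ‖x - y‖ := by
  choose L hL using fun i => (hu i).2.2
  have hsum : 0 ≤ ∑ i, |L i| := by positivity
  refine ⟨∑ i, |L i| + C4, by linarith [h4.1], h4.2 u hu _ hsum fun i x y => ?_⟩
  refine (hL i x y).trans ?_
  gcongr
  exact (le_abs_self _).trans
    (Finset.single_le_sum (f := fun i => |L i|) (fun _ _ => abs_nonneg _) (Finset.mem_univ i))

/-- Comparison for penalized obstacle problems with bounded continuous solutions. -/
theorem FobPen_comparison {P : HJBData d d' M 𝒜} {C lam0 : ℝ} (h1 : H1 P C lam0) {ρ : ℝ}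
    (hρ : 0 ≤ ρ) {Ψ Χ U V : Fin M → E d → ℝ} {L : ℝ} (hL : 0 ≤ L)
    (hΨ : ∀ i x y, |Ψ i x - Ψ i y| ≤ L * ‖x - y‖) {s : ℝ} (hs : 0 ≤ s)
    (hΨΧ : ∀ i x, Ψ i x ≤ Χ i x + s)
    (hU : Bdd U ∧ IsSolution (FobPen P Ψ ρ) U) (hV : Bdd V ∧ IsSolution (FobPen P Χ ρ) V)
    (i₀ : Fin M) (x₀ : E d) : U i₀ x₀ - V i₀ x₀ ≤ s := by
  by_contra! hcon
  obtain ⟨⟨B₁, hB₁⟩, hUc, hUsub, -⟩ := hU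
  obtain ⟨⟨B₂, hB₂⟩, hVc, -, hVsup⟩ := hV
  set B := max B₁ B₂
  have hB : 0 ≤ B := (abs_nonneg _).trans ((hB₁ i₀ x₀).trans (le_max_left _ _))
  have hC := h1.nonneg i₀
  have hlam := h1.1
  obtain ⟨θ, hθ, h₀⟩ : ∃ θ > 0, s + 2 * θ ≤ U i₀ x₀ - V i₀ x₀ :=
    ⟨(U i₀ x₀ - V i₀ x₀ - s) / 2, by linarith, by linarith⟩
  set K := 4 * C ^ 2 + 6 * C + C * (1 + M) * B + 1 with hK
  have hKpos : 0 < K := by positivity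
  obtain ⟨η, hη, hηK, hηL⟩ : ∃ η > 0, K * η < lam0 * θ ∧ L * η ≤ θ := by
    refine ⟨min (lam0 * θ / (2 * K)) (θ / (L + 1)), by positivity, ?_, ?_⟩
    · calc K * min (lam0 * θ / (2 * K)) (θ / (L + 1)) ≤ K * (lam0 * θ / (2 * K)) := by
            gcongr
            exact min_le_left _ _
        _ = lam0 * θ / 2 := by field_simp
        _ < lam0 * θ := half_lt_self (by positivity)
    · calc L * min (lam0 * θ / (2 * K)) (θ / (L + 1)) ≤ (L + 1) * (θ / (L + 1)) := by
            gcongr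
            · linarith
            · exact min_le_right _ _
        _ = θ := by field_simp
  obtain ⟨k, β, i, x, y, x', y', q₁, q₂, X, Y, hk, hβ, hβη, hq₁, hq₂, hβx, hβy, hxy', hkxy', hkxy,
    hm, hj, hX, hY, hXY⟩ := exists_localized_maximizer hUc hVc
      (fun i x => (hB₁ i x).trans (le_max_left _ _)) (fun i x => (hB₂ i x).trans (le_max_right _ _))
      hs hθ h₀ hη
  have hsub := hUsub.of_superjet hX hη
  have hsup := hVsup.of_superjet hY hη
  set X' := X + (2 * η) • ContinuousLinearMap.id ℝ (E d) with hX'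
  set Y' := Y + (2 * η) • ContinuousLinearMap.id ℝ (E d) with hY'
  have hXY' : ∀ h g, ⟪X' h, h⟫ + ⟪Y' g, g⟫
      ≤ k * ‖h - g‖ ^ 2 + (β + 2 * η) * (‖h‖ ^ 2 + ‖g‖ ^ 2) := by
    intro h g
    have := hXY h g
    simp only [hX', hY', _root_.add_apply, _root_.smul_apply, ContinuousLinearMap.id_apply,
      inner_add_left, real_inner_smul_left, real_inner_self_eq_norm_sq]
    linarith
  have hpen : ρ * max (V i y' - Χ i y') 0 ≤ ρ * max (U i x' - Ψ i x') 0 := by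
    refine mul_le_mul_of_nonneg_left (max_le_max ?_ le_rfl) hρ
    have h2 := (abs_le.1 (hΨ i x' y')).2
    have h3 : L * ‖x' - y'‖ ≤ L * η := by gcongr
    linarith [hΨΧ i y']
  set a := k • (x - y) + β • x + q₁
  set b := k • (y - x) + β • y + q₂
  have hham : P.Ham i x' (fun j => U j x') a (symHess X')
      ≤ P.Ham i y' (fun j => V j y') (-b) (symHess (-Y')) := by
    simp only [FobPen] at hsub hsup
    linarith
  obtain ⟨_, ⟨α, hα, rfl⟩, hlt⟩ := exists_lt_of_lt_csSup ((h1.2.1 i).1.image _)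
    (sub_lt_self (P.Ham i y' (fun j => V j y') (-b) (symHess (-Y'))) hη)
  have hle : P.L i α x' (fun j => U j x') a (symHess X')
      ≤ P.Ham i x' (fun j => U j x') a (symHess X') :=
    le_csSup (h1.bddAbove_L i x' _ a X') ⟨α, hα, rfl⟩
  have hest := h1.structure_estimate hα (x := x') (y := y') (a := a) (b := b) hk.le
    (by positivity) hXY' (r := fun j => U j x') (t := fun j => V j y') hj (by linarith)
    (B := B) (fun j => (hB₂ j y').trans (le_max_right _ _))
  have hdrift := h1.drift_estimate hα hk.le hβ.le x y x' y' q₁ q₂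
  have e1 : lam0 * θ ≤ lam0 * (U i x' - V i y') := by gcongr; linarith
  have e2 : C ^ 2 * (k / 2 * ‖x' - y'‖ ^ 2 + (β + 2 * η)) ≤ C ^ 2 * (4 * η) := by
    gcongr
    linarith
  have e3 : C * ‖x' - y'‖ * (1 + (1 + M) * B) ≤ C * η * (1 + (1 + M) * B) := by gcongr
  have e4 : C * (k * ‖x - y‖ * ‖x' - y'‖) ≤ C * η := by gcongr
  have e5 : C * (β * ‖x‖ + ‖q₁‖) ≤ C * (2 * η) := by gcongr; linarith
  have e6 : C * (β * ‖y‖ + ‖q₂‖) ≤ C * (2 * η) := by gcongr; linarith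
  have e7 : K * η = C ^ 2 * (4 * η) + C * η * (1 + (1 + M) * B) + C * η + C * (2 * η)
      + C * (2 * η) + η := by rw [hK]; ring
  dsimp only at hest hlt
  linarith

/-- Nonexpansiveness of the penalized solution operator `Q^ρ`:
`sup_i |((Q^ρu)_i − (Q^ρv)_i)⁺|₀ ≤ sup_i |(u_i − v_i)⁺|₀`; in particular `Q^ρ` is monotone. -/
theorem Qrho_nonexpansive
    {d d' M : ℕ} {𝒜 𝒵 : Type} [MetricSpace 𝒜] [MetricSpace 𝒵]
    (P : HJBData d d' M 𝒜) (Q : ImpulseData d M 𝒵) (C lam0 C4 : ℝ)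
    (h1 : H1 P C lam0) (h4 : H4 Q C4) (ρ : ℝ) (hρ : 0 ≤ ρ)
    (u v Qu Qv : Fin M → E d → ℝ)
    (hu : ∀ i, InC01 (u i)) (hv : ∀ i, InC01 (v i))
    (hQu : Bdd Qu ∧ IsSolution (FobPen P (fun i x => Q.Mop i u x) ρ) Qu)
    (hQv : Bdd Qv ∧ IsSolution (FobPen P (fun i x => Q.Mop i v x) ρ) Qv) :
    (∀ s : ℝ, 0 ≤ s → (∀ i x, u i x - v i x ≤ s) → ∀ i x, Qu i x - Qv i x ≤ s) ∧
    ((∀ i x, u i x ≤ v i x) → ∀ i x, Qu i x ≤ Qv i x) := by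
  have key : ∀ s : ℝ, 0 ≤ s → (∀ i x, u i x - v i x ≤ s) → ∀ i x, Qu i x - Qv i x ≤ s := by
    intro s hs huv i x
    obtain ⟨L, hL, hLip⟩ := h4.exists_lipschitz hu
    exact FobPen_comparison h1 hρ hL hLip hs (fun i x => Q.Mop_le_add hu hv hs huv i x) hQu hQv i x
  exact ⟨key, fun h i x => sub_nonpos.1 (key 0 le_rfl (fun i x => sub_nonpos.2 (h i x)) i x)⟩

end HJBQVI
end
end

section
/- Monotonicity and boundedness of the auxiliary penalized iterates: assume (H.1), (H.2), (H.3) and (H.4), and let ρ > 0 be fixed. Then the iterates (u^{ρ,n})_{n≥0} defined by u^{ρ,0} = u⁰ and u^{ρ,n} = Q^ρ u^{ρ,n−1} satisfy u^{ρ,n−1} ≥ u^{ρ,n} ≥ u^ρ componentwise for all n ≥ 1, where u^ρ is the bounded viscosity solution of the penalized system with parameter ρ; in particular, the iterates are uniformly bounded in n. -/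
noncomputable section
open scoped BigOperators RealInnerProductSpace
open Filter Topology Matrix

namespace HJBQVI

variable {d d' M : ℕ}

variable {𝒜 𝒵 : Type} [MetricSpace 𝒜] [MetricSpace 𝒵]

section Analysis
open MeasureTheory

section SecondOrder
variable {V : Type*} [NormedAddCommGroup V] [NormedSpace ℝ V] [FiniteDimensional ℝ V]
  [MeasurableSpace V] [BorelSpace V]

/-- Lipschitz maps between subsets of a finite-dimensional space send null sets to null sets. -/
lemma measure_image_null_of_lipschitzOnWith (μ : Measure V) [μ.IsAddHaarMeasure]
    {f : V → V} {s : Set V} {K : NNReal} (hf : LipschitzOnWith K f s) (hs : μ s = 0) :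
    μ (f '' s) = 0 := by
  set ν : Measure V := Measure.hausdorffMeasure (Module.finrank ℝ V : ℝ) with hν
  have hμν : μ ≪ ν := Measure.absolutelyContinuous_isAddHaarMeasure μ ν
  have hνμ : ν ≪ μ := Measure.absolutelyContinuous_isAddHaarMeasure ν μ
  refine hμν ?_
  have h := hf.hausdorffMeasure_image_le (d := (Module.finrank ℝ V : ℝ)) (by positivity)
  rw [← hν, hνμ hs, mul_zero] at h
  exact le_antisymm h bot_le

/-- If a relation `R z a` is Lipschitz in the sense that related pairs satisfy
`‖a₁ - a₂‖ ≤ L ‖z₁ - z₂‖`, then the set of points related to a null set is null. -/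
lemma measure_related_null (μ : Measure V) [μ.IsAddHaarMeasure] (R : V → V → Prop) (L : ℝ)
    (hR : ∀ z₁ z₂ a₁ a₂, R z₁ a₁ → R z₂ a₂ → ‖a₁ - a₂‖ ≤ L * ‖z₁ - z₂‖)
    {N : Set V} (hN : μ N = 0) : μ {a | ∃ z ∈ N, R z a} = 0 := by
  classical
  let A : V → V := fun z => if h : ∃ a, R z a then h.choose else 0
  have hA : ∀ z a, R z a → A z = a := by
    intro z a h
    have h' : ∃ a, R z a := ⟨a, h⟩
    have h1 : R z (A z) := by simp only [A, dif_pos h']; exact h'.choose_spec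
    have := hR z z _ _ h1 h
    rw [sub_self, norm_zero, mul_zero] at this
    exact sub_eq_zero.1 (norm_le_zero_iff.1 this)
  set S : Set V := {z | z ∈ N ∧ ∃ a, R z a}
  have hS : μ S = 0 := measure_mono_null (fun z hz => hz.1) hN
  have hlip : LipschitzOnWith L.toNNReal A S := by
    refine LipschitzOnWith.of_dist_le_mul ?_
    rintro z ⟨-, a, ha⟩ w ⟨-, b, hb⟩
    rw [hA z a ha, hA w b hb, dist_eq_norm, dist_eq_norm]
    exact (hR z w a b ha hb).trans
      (mul_le_mul_of_nonneg_right (Real.le_coe_toNNReal L) (norm_nonneg _))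
  refine measure_mono_null ?_ (measure_image_null_of_lipschitzOnWith μ hlip hS)
  rintro a ⟨z, hz, ha⟩
  exact ⟨z, ⟨hz, a, ha⟩, hA z a ha⟩
end SecondOrder

section Convex
variable {V : Type*} [NormedAddCommGroup V] [InnerProductSpace ℝ V]

lemma subgradient_monotone {f : V → ℝ} {s : V → V}
    (hs : ∀ x y, f x + inner ℝ (s x) (y - x) ≤ f y) (x y : V) :
    0 ≤ inner ℝ (s x - s y) (x - y) := by
  have h1 := hs x y
  have h2 := hs y x
  rw [← neg_sub x y, inner_neg_right] at h1
  rw [inner_sub_left]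
  linarith

/-- A subgradient selection of linear growth makes `f` differentiable almost everywhere, with the
subgradient as the gradient. -/
lemma ae_first_order [FiniteDimensional ℝ V] [MeasurableSpace V] [BorelSpace V]
    (μ : Measure V) [μ.IsAddHaarMeasure] {f : V → ℝ} {s : V → V}
    (hs : ∀ x y, f x + inner ℝ (s x) (y - x) ≤ f y) {S : ℝ} (hS0 : 0 ≤ S)
    (hS : ∀ x, ‖s x‖ ≤ S * (1 + ‖x‖)) :
    ∀ᵐ x ∂μ, HasFDerivAt f (innerSL ℝ (s x)) x := by
  have hball : ∀ n : ℕ, ∀ᵐ x ∂μ, x ∈ Metric.ball (0 : V) n → DifferentiableAt ℝ f x := by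
    intro n
    have hlip : LipschitzOnWith (Real.toNNReal (S * (1 + n))) f (Metric.ball (0 : V) n) := by
      refine LipschitzOnWith.of_le_add_mul _ ?_
      intro x hx y hy
      have h1 := hs x y
      have h2 : -inner ℝ (s x) (y - x) ≤ ‖s x‖ * ‖y - x‖ := by
        rw [← inner_neg_left, ← norm_neg (s x)]; exact real_inner_le_norm _ _
      have h3 : ‖s x‖ ≤ S * (1 + n) := (hS x).trans (by
        have : ‖x‖ < n := by simpa using hx
        gcongr)
      rw [Real.coe_toNNReal _ (by positivity), dist_comm, dist_eq_norm]
      nlinarith [mul_le_mul_of_nonneg_right h3 (norm_nonneg (y - x))]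
    have := hlip.ae_differentiableWithinAt (μ := μ) Metric.isOpen_ball.measurableSet
    rw [ae_restrict_iff' Metric.isOpen_ball.measurableSet] at this
    filter_upwards [this] with x hx hxb
    exact (hx hxb).differentiableAt (Metric.isOpen_ball.mem_nhds hxb)
  filter_upwards [ae_all_iff.2 hball] with x hx
  obtain ⟨n, hn⟩ := exists_nat_gt ‖x‖
  have hd := hx n (by simpa using hn)
  have hmin : IsLocalMin (fun y => f y - inner ℝ (s x) y) x := by
    refine Filter.Eventually.of_forall fun y => ?_
    have := hs x y
    rw [inner_sub_right] at this
    simp only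
    linarith
  have h0 : HasFDerivAt (fun y => f y - inner ℝ (s x) y) (fderiv ℝ f x - innerSL ℝ (s x)) x :=
    hd.hasFDerivAt.sub (innerSL ℝ (s x)).hasFDerivAt
  have := hmin.hasFDerivAt_eq_zero h0
  rw [← sub_eq_zero.1 this]
  exact hd.hasFDerivAt

/-- A subgradient selection is continuous at points of differentiability. -/
lemma continuousAt_subgradient {f : V → ℝ} {s : V → V}
    (hs : ∀ x y, f x + inner ℝ (s x) (y - x) ≤ f y) {x : V}
    (hd : HasFDerivAt f (innerSL ℝ (s x)) x) : ContinuousAt s x := by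
  rw [Metric.continuousAt_iff]
  intro ε hε
  have h1 := hd.isLittleO.def (c := ε / 4) (by positivity)
  rw [Metric.eventually_nhds_iff] at h1
  obtain ⟨δ, hδ, h1⟩ := h1
  refine ⟨δ / 2, by positivity, fun {y} hy => ?_⟩
  rw [dist_eq_norm] at hy ⊢
  by_cases hyx : y = x
  · simp [hyx, hε]
  have hpos : 0 < ‖y - x‖ := norm_pos_iff.2 (sub_ne_zero.2 hyx)
  by_contra hcon
  push Not at hcon
  set g := s y - s x with hg
  have hgpos : 0 < ‖g‖ := by linarith
  set e : V := (‖y - x‖ / ‖g‖) • g with he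
  have hne : ‖e‖ = ‖y - x‖ := by
    rw [he, norm_smul, Real.norm_of_nonneg (by positivity)]; field_simp
  have hge : inner ℝ g e = ‖g‖ * ‖y - x‖ := by
    rw [he, inner_smul_right, real_inner_self_eq_norm_sq]; field_simp
  have h2 := hs y (y + e)
  have h3 := hs x y
  have hlt : ‖(y + e) - x‖ ≤ 2 * ‖y - x‖ := by
    calc ‖(y + e) - x‖ = ‖(y - x) + e‖ := by congr 1; abel
      _ ≤ _ := (norm_add_le _ _).trans (by rw [hne]; linarith)
  have h4 := h1 (y := y + e) (by rw [dist_eq_norm]; linarith)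
  simp only [innerSL_apply_apply, Real.norm_eq_abs] at h4
  have h5 := (abs_le.1 h4).2
  have h6 : inner ℝ (s x) (y + e - x) = inner ℝ (s x) (y - x) + inner ℝ (s x) e := by
    rw [← inner_add_right]; congr 1; abel
  have h7 : inner ℝ (s y) (y + e - y) = inner ℝ g e + inner ℝ (s x) e := by
    rw [hg, inner_sub_left, add_sub_cancel_left]; ring
  have h8 : ε / 4 * ‖y + e - x‖ ≤ ε / 4 * (2 * ‖y - x‖) := by gcongr
  nlinarith

/-- If the subgradient has a first-order expansion at `x` with derivative `X`, then `f` has the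
corresponding second-order expansion. -/
lemma second_order_of_subgradient {f : V → ℝ} {s : V → V}
    (hs : ∀ x y, f x + inner ℝ (s x) (y - x) ≤ f y) {x : V} {X : V →L[ℝ] V} {η : ℝ} {h : V}
    (hX : ∀ t : ℝ, 0 ≤ t → t ≤ 1 → ‖s (x + t • h) - s x - t • X h‖ ≤ η * ‖h‖) :
    |f (x + h) - f x - inner ℝ (s x) h - 1 / 2 * inner ℝ (X h) h| ≤ η * ‖h‖ ^ 2 := by
  set q : ℝ := inner ℝ (X h) h with hq
  let F : ℝ → ℝ := fun t => f (x + t • h) - t * inner ℝ (s x) h - t ^ 2 / 2 * q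
  have hstep : ∀ a b : ℝ, f (x + b • h) - f (x + a • h) ≤ (b - a) * inner ℝ (s (x + b • h)) h := by
    intro a b
    have := hs (x + b • h) (x + a • h)
    have e : x + a • h - (x + b • h) = (a - b) • h := by rw [sub_smul]; abel
    rw [e, inner_smul_right] at this
    linarith
  have hin : ∀ t : ℝ, 0 ≤ t → t ≤ 1 →
      |inner ℝ (s (x + t • h)) h - inner ℝ (s x) h - t * q| ≤ η * ‖h‖ ^ 2 := by
    intro t h0 h1
    have e : inner ℝ (s (x + t • h)) h - inner ℝ (s x) h - t * q
        = inner ℝ (s (x + t • h) - s x - t • X h) h := by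
      rw [inner_sub_left, inner_sub_left, inner_smul_left]; simp [hq]
    rw [e]
    calc _ ≤ ‖s (x + t • h) - s x - t • X h‖ * ‖h‖ := abs_real_inner_le_norm _ _
      _ ≤ η * ‖h‖ * ‖h‖ := by gcongr; exact hX t h0 h1
      _ = _ := by ring
  have hF : ∀ a b : ℝ, 0 ≤ a → a ≤ b → b ≤ 1 →
      |F b - F a| ≤ (b - a) * (η * ‖h‖ ^ 2 + (b - a) / 2 * |q|) := by
    intro a b ha hab hb
    have h1 := hstep a b
    have h2 := hstep b a
    have h3 := abs_le.1 (hin a ha (hab.trans hb))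
    have h4 := abs_le.1 (hin b (ha.trans hab) hb)
    have hba : 0 ≤ b - a := by linarith
    have h5 := mul_le_mul_of_nonneg_left h3.1 hba
    have h6 := mul_le_mul_of_nonneg_left h4.2 hba
    have h7 := mul_le_mul_of_nonneg_left (le_abs_self q) (mul_nonneg hba hba)
    have h8 := mul_le_mul_of_nonneg_left (neg_abs_le q) (mul_nonneg hba hba)
    rw [abs_le]
    constructor <;> simp only [F] <;> nlinarith
  have hn : ∀ n : ℕ, |F 1 - F 0| ≤ η * ‖h‖ ^ 2 + 1 / ((n : ℝ) + 1) * (|q| / 2) := by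
    intro n
    have hpos : (0 : ℝ) < (n : ℝ) + 1 := by positivity
    let G : ℕ → ℝ := fun m => F (m / ((n : ℝ) + 1))
    have hsum : F 1 - F 0 = ∑ m ∈ Finset.range (n + 1), (G (m + 1) - G m) := by
      rw [Finset.sum_range_sub]
      simp only [G]
      congr 2
      · push_cast; field_simp
      · simp
    rw [hsum]
    calc _ ≤ ∑ m ∈ Finset.range (n + 1), |G (m + 1) - G m| := Finset.abs_sum_le_sum_abs _ _
      _ ≤ ∑ m ∈ Finset.range (n + 1),
          (1 / ((n : ℝ) + 1)) * (η * ‖h‖ ^ 2 + 1 / ((n : ℝ) + 1) / 2 * |q|) := by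
        refine Finset.sum_le_sum fun m hm => ?_
        have hm' : (m : ℝ) + 1 ≤ n + 1 := by
          have := Finset.mem_range.1 hm
          exact_mod_cast this
        have e : ((m + 1 : ℕ) : ℝ) / ((n : ℝ) + 1) - m / ((n : ℝ) + 1) = 1 / ((n : ℝ) + 1) := by
          push_cast; field_simp; ring
        have := hF (m / ((n : ℝ) + 1)) (((m + 1 : ℕ) : ℝ) / ((n : ℝ) + 1)) (by positivity)
          (by gcongr; exact Nat.le_succ m) (by push_cast; rw [div_le_one hpos]; exact hm')
        rwa [e] at this
      _ = _ := by
        rw [Finset.sum_const, Finset.card_range, nsmul_eq_mul]; push_cast; field_simp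
  have hlim : Tendsto (fun n : ℕ => η * ‖h‖ ^ 2 + 1 / ((n : ℝ) + 1) * (|q| / 2)) atTop
      (𝓝 (η * ‖h‖ ^ 2 + 0 * (|q| / 2))) :=
    (tendsto_one_div_add_atTop_nhds_zero_nat.mul_const _).const_add _
  have := ge_of_tendsto' hlim hn
  simp only [F, one_smul, zero_smul, add_zero, zero_mul] at this
  convert this using 1
  congr 1
  ring

/-- **Alexandrov's theorem** for a convex function given together with a subgradient selection of
linear growth: second-order expansions hold almost everywhere. -/
lemma ae_second_order [FiniteDimensional ℝ V] [MeasurableSpace V] [BorelSpace V]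
    (μ : Measure V) [μ.IsAddHaarMeasure] {f : V → ℝ} {s : V → V}
    (hs : ∀ x y, f x + inner ℝ (s x) (y - x) ≤ f y) {S : ℝ} (hS0 : 0 ≤ S)
    (hS : ∀ x, ‖s x‖ ≤ S * (1 + ‖x‖)) :
    ∀ᵐ x ∂μ, ∃ X : V →L[ℝ] V, ∀ η > 0, ∀ᶠ h in 𝓝 (0 : V),
      |f (x + h) - f x - inner ℝ (s x) h - 1 / 2 * inner ℝ (X h) h| ≤ η * ‖h‖ ^ 2 := by
  classical
  let T : V → V := fun x => x + s x
  have hTexp : ∀ x y, ‖x - y‖ ≤ ‖T x - T y‖ := by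
    intro x y
    have h1 := subgradient_monotone hs x y
    have h2 : inner ℝ (T x - T y) (x - y) = ‖x - y‖ ^ 2 + inner ℝ (s x - s y) (x - y) := by
      rw [← real_inner_self_eq_norm_sq, ← inner_add_left]; congr 1; simp only [T]; abel
    have h3 := real_inner_le_norm (T x - T y) (x - y)
    by_contra hcon
    push Not at hcon
    have : 0 < ‖x - y‖ := (norm_nonneg _).trans_lt hcon
    nlinarith
  have hTinj : Function.Injective T := by
    intro x y hxy
    have := hTexp x y
    rw [hxy, sub_self, norm_zero] at this
    exact sub_eq_zero.1 (norm_le_zero_iff.1 this)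
  have hlip : LipschitzOnWith 1 (Function.invFun T) (Set.range T) := by
    refine LipschitzOnWith.of_dist_le_mul ?_
    rintro _ ⟨x, rfl⟩ _ ⟨y, rfl⟩
    rw [Function.leftInverse_invFun hTinj, Function.leftInverse_invFun hTinj, dist_eq_norm,
      dist_eq_norm, NNReal.coe_one, one_mul]
    exact hTexp x y
  obtain ⟨P, hPlip, hPeq⟩ := hlip.extend_finite_dimension
  have hPT : ∀ x, P (T x) = x := fun x => by
    rw [← hPeq ⟨x, rfl⟩, Function.leftInverse_invFun hTinj]
  have hnull1 : μ (P '' {w | ¬ DifferentiableAt ℝ P w}) = 0 :=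
    measure_image_null_of_lipschitzOnWith μ hPlip.lipschitzOnWith
      (ae_iff.1 (hPlip.ae_differentiableAt (μ := μ)))
  have hnull2 : μ (P '' {w | DifferentiableAt ℝ P w ∧ (fderiv ℝ P w).det = 0}) = 0 :=
    addHaar_image_eq_zero_of_det_fderivWithin_eq_zero μ
      (fun w hw => hw.1.hasFDerivAt.hasFDerivWithinAt) (fun w hw => hw.2)
  filter_upwards [ae_first_order μ hs hS0 hS, measure_eq_zero_iff_ae_notMem.1 hnull1,
    measure_eq_zero_iff_ae_notMem.1 hnull2] with x hx1 hx2 hx3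
  have hscont := continuousAt_subgradient hs hx1
  have hTcont : ContinuousAt T x := continuousAt_id.add hscont
  have hd : DifferentiableAt ℝ P (T x) := by
    by_contra hcon
    exact hx2 ⟨T x, hcon, hPT x⟩
  have hdet : (fderiv ℝ P (T x)).det ≠ 0 := fun hcon => hx3 ⟨T x, ⟨hd, hcon⟩, hPT x⟩
  let Ae := ContinuousLinearMap.toContinuousLinearEquivOfDetNeZero (fderiv ℝ P (T x)) hdet
  have hAe : HasFDerivAt P (Ae : V →L[ℝ] V) (T x) := hd.hasFDerivAt
  have hTd : HasFDerivAt T (Ae.symm : V →L[ℝ] V) x :=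
    HasFDerivAt.of_local_left_inverse hTcont (by simpa [hPT x] using hAe)
      (Filter.Eventually.of_forall hPT)
  refine ⟨(Ae.symm : V →L[ℝ] V) - ContinuousLinearMap.id ℝ V, fun η hη => ?_⟩
  have h1 := hTd.isLittleO.def hη
  rw [Metric.eventually_nhds_iff] at h1 ⊢
  obtain ⟨δ, hδ, h1⟩ := h1
  refine ⟨δ, hδ, fun h hh => second_order_of_subgradient hs fun t ht0 ht1 => ?_⟩
  rw [dist_zero_right] at hh
  have hth : ‖t • h‖ ≤ ‖h‖ := by
    rw [norm_smul, Real.norm_of_nonneg ht0]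
    exact mul_le_of_le_one_left (norm_nonneg _) ht1
  have h2 := h1 (y := x + t • h) (by rw [dist_eq_norm, add_sub_cancel_left]; linarith)
  rw [add_sub_cancel_left] at h2
  refine le_trans (le_of_eq ?_) (h2.trans (mul_le_mul_of_nonneg_left hth hη.le))
  congr 1
  simp only [T, map_smul, _root_.sub_apply, ContinuousLinearMap.id_apply, smul_sub]
  abel
end Convex

section Doubling
variable {V : Type*} [NormedAddCommGroup V] [InnerProductSpace ℝ V]

lemma norm_sub_sq_expand (x x' y : V) :
    ‖x' - y‖ ^ 2 = ‖x - y‖ ^ 2 + 2 * inner ℝ (x - y) (x' - x) + ‖x' - x‖ ^ 2 := by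
  rw [← norm_add_sq_real]; congr 2; abel

lemma eq_zero_of_inner_le_sq {g : V} {c : ℝ} (h : ∀ v : V, inner ℝ g v ≤ c * ‖v‖ ^ 2) : g = 0 := by
  by_contra hg
  have hpos : 0 < ‖g‖ ^ 2 := by positivity
  have h1 := h ((1 / (2 * (|c| + 1))) • g)
  have hc : 0 < |c| + 1 := by positivity
  rw [inner_smul_right, real_inner_self_eq_norm_sq, norm_smul, mul_pow, Real.norm_of_nonneg
    (by positivity)] at h1
  have h2 : c * ((1 / (2 * (|c| + 1))) ^ 2 * ‖g‖ ^ 2)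
      ≤ (|c| + 1) * ((1 / (2 * (|c| + 1))) ^ 2 * ‖g‖ ^ 2) := by
    gcongr; linarith [le_abs_self c]
  have h3 : (|c| + 1) * ((1 / (2 * (|c| + 1))) ^ 2 * ‖g‖ ^ 2)
      = 1 / 2 * (1 / (2 * (|c| + 1)) * ‖g‖ ^ 2) := by field_simp
  have h4 : 0 < 1 / (2 * (|c| + 1)) * ‖g‖ ^ 2 := by positivity
  linarith

/-- Functions squeezed between an affine function and a paraboloid at two points have gradients at
these points that differ by at most a multiple of the distance. -/
lemma gradient_lipschitz_of_touching {f : V → ℝ} {Λ : ℝ} (hΛ : 0 ≤ Λ) {x₁ x₂ p₁ p₂ : V}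
    (l₁ : ∀ x, f x₁ + inner ℝ p₁ (x - x₁) ≤ f x)
    (u₁ : ∀ x, f x ≤ f x₁ + inner ℝ p₁ (x - x₁) + Λ / 2 * ‖x - x₁‖ ^ 2)
    (u₂ : ∀ x, f x ≤ f x₂ + inner ℝ p₂ (x - x₂) + Λ / 2 * ‖x - x₂‖ ^ 2) :
    ‖p₁ - p₂‖ ≤ Λ * ‖x₁ - x₂‖ := by
  have key : ∀ v : V, inner ℝ (p₁ - p₂) v ≤ Λ / 2 * ‖v‖ ^ 2 + Λ / 2 * ‖x₁ - x₂‖ ^ 2 := by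
    intro v
    have h1 := l₁ (x₂ + v)
    have h2 := u₂ (x₂ + v)
    have h3 := u₁ x₂
    rw [add_sub_cancel_left] at h2
    have e : inner ℝ p₁ (x₂ + v - x₁) = inner ℝ p₁ (x₂ - x₁) + inner ℝ p₁ v := by
      rw [← inner_add_right]; congr 1; abel
    rw [norm_sub_rev x₂ x₁] at h3
    rw [inner_sub_left]
    linarith
  by_cases hx : x₁ = x₂
  · have : p₁ - p₂ = 0 := eq_zero_of_inner_le_sq (c := Λ / 2) fun v => by simpa [hx] using key v
    simp [this, hx]
  by_contra hcon
  push Not at hcon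
  set g := p₁ - p₂
  have hd : 0 < ‖x₁ - x₂‖ := norm_pos_iff.2 (sub_ne_zero.2 hx)
  have hg : 0 < ‖g‖ := lt_of_le_of_lt (by positivity) hcon
  have h1 := key ((‖x₁ - x₂‖ / ‖g‖) • g)
  rw [inner_smul_right, real_inner_self_eq_norm_sq, norm_smul, Real.norm_of_nonneg (by positivity),
    div_mul_cancel₀ _ hg.ne'] at h1
  have e : ‖x₁ - x₂‖ / ‖g‖ * ‖g‖ ^ 2 = ‖x₁ - x₂‖ * ‖g‖ := by field_simp
  rw [e] at h1
  nlinarith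

/-- `U` is the sup-convolution of `g` with parameter `k`, with maximizers selected by `ξ`. -/
structure IsSupConv (k : ℝ) (g U : V → ℝ) (ξ : V → V) : Prop where
  eq : ∀ x, U x = g (ξ x) - k / 2 * ‖x - ξ x‖ ^ 2
  le : ∀ x y, g y - k / 2 * ‖x - y‖ ^ 2 ≤ U x

lemma exists_isSupConv [FiniteDimensional ℝ V] {k : ℝ} (hk : 0 < k) {g : V → ℝ}
    (hg : Continuous g) {B : ℝ} (hB : ∀ x, |g x| ≤ B) : ∃ U ξ, IsSupConv k g U ξ := by
  have hmax : ∀ x, ∃ z, ∀ y, g y - k / 2 * ‖x - y‖ ^ 2 ≤ g z - k / 2 * ‖x - z‖ ^ 2 := by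
    intro x
    have hc : Continuous fun y => g y - k / 2 * ‖x - y‖ ^ 2 := by fun_prop
    refine hc.exists_forall_ge' x ?_
    have hB0 : 0 ≤ B := (abs_nonneg _).trans (hB x)
    have : ∀ᶠ y in cocompact V, y ∉ Metric.closedBall x (1 + 4 * B / k) :=
      (isCompact_closedBall _ _).compl_mem_cocompact
    filter_upwards [this] with y hy
    rw [Metric.mem_closedBall, not_le, dist_comm, dist_eq_norm] at hy
    have h1 := (abs_le.1 (hB y)).2
    have h2 := (abs_le.1 (hB x)).1
    have h3 : 4 * B / k * k = 4 * B := by field_simp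
    have h4 : 0 ≤ 4 * B / k := by positivity
    have h5 : 4 * B / k ≤ ‖x - y‖ ^ 2 := by nlinarith
    have h6 : 4 * B ≤ k * ‖x - y‖ ^ 2 := by nlinarith
    simp only [sub_self, norm_zero]
    nlinarith
  choose ξ hξ using hmax
  exact ⟨_, ξ, fun x => rfl, hξ⟩

namespace IsSupConv
variable {k : ℝ} {g U : V → ℝ} {ξ : V → V}

lemma subgradient (h : IsSupConv k g U ξ) (x y : V) :
    U x + k / 2 * ‖x‖ ^ 2 + inner ℝ (k • ξ x) (y - x) ≤ U y + k / 2 * ‖y‖ ^ 2 := by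
  have h1 := h.le y (ξ x)
  have h2 := h.eq x
  have e1 := norm_sub_sq_real x (ξ x)
  have e2 := norm_sub_sq_real y (ξ x)
  rw [e1] at h2
  rw [e2] at h1
  rw [inner_smul_left, inner_sub_right, real_inner_comm x (ξ x), real_inner_comm y (ξ x)]
  simp only [conj_trivial]
  nlinarith

lemma semiconvex (h : IsSupConv k g U ξ) (x y : V) :
    U x + inner ℝ (k • (ξ x - x)) (y - x) - k / 2 * ‖y - x‖ ^ 2 ≤ U y := by
  have h1 := h.subgradient x y
  have e := norm_sub_sq_expand x y 0
  simp only [sub_zero] at e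
  rw [smul_sub, inner_sub_left, inner_smul_left x _ k]
  simp only [conj_trivial]
  rw [e] at h1
  nlinarith

lemma growth (h : IsSupConv k g U ξ) (hk : 0 < k) {B : ℝ} (hB : ∀ x, |g x| ≤ B) (x : V) :
    ‖k • ξ x‖ ≤ (k + 4 * B) * (1 + ‖x‖) := by
  have hB0 : 0 ≤ B := (abs_nonneg _).trans (hB x)
  have h1 := h.le x x
  rw [h.eq x, sub_self, norm_zero] at h1
  have h2 := (abs_le.1 (hB x)).1
  have h3 := (abs_le.1 (hB (ξ x))).2
  have h4 : k * ‖x - ξ x‖ ^ 2 ≤ 4 * B := by nlinarith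
  have h5 : k * ‖x - ξ x‖ ≤ k + 4 * B := by
    nlinarith [norm_nonneg (x - ξ x), sq_nonneg (‖x - ξ x‖ - 1), mul_nonneg hk.le (sq_nonneg (‖x - ξ x‖ - 1))]
  have h6 : ‖ξ x‖ ≤ ‖x‖ + ‖x - ξ x‖ := by
    rw [norm_sub_rev]
    calc ‖ξ x‖ = ‖x + (ξ x - x)‖ := by congr 1; abel
      _ ≤ _ := norm_add_le _ _
  rw [norm_smul, Real.norm_of_nonneg hk.le]
  nlinarith [norm_nonneg x, mul_nonneg hB0 (norm_nonneg x), mul_le_mul_of_nonneg_left h6 hk.le]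

/-- Almost everywhere second-order differentiability of a sup-convolution. -/
lemma ae_second_order [FiniteDimensional ℝ V] [MeasurableSpace V] [BorelSpace V]
    (μ : Measure V) [μ.IsAddHaarMeasure] (h : IsSupConv k g U ξ) (hk : 0 < k) {B : ℝ}
    (hB : ∀ x, |g x| ≤ B) :
    ∀ᵐ x ∂μ, ∃ X : V →L[ℝ] V, ∀ η > 0, ∀ᶠ v in 𝓝 (0 : V),
      |U (x + v) - U x - inner ℝ (k • (ξ x - x)) v - 1 / 2 * inner ℝ (X v) v| ≤ η * ‖v‖ ^ 2 := by
  have hB0 : 0 ≤ B := (abs_nonneg _).trans (hB 0)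
  have := HJBQVI.ae_second_order μ (f := fun x => U x + k / 2 * ‖x‖ ^ 2) (s := fun x => k • ξ x)
    h.subgradient (S := k + 4 * B) (by positivity) (h.growth hk hB)
  filter_upwards [this] with x hx
  obtain ⟨X, hX⟩ := hx
  refine ⟨X - k • ContinuousLinearMap.id ℝ V, fun η hη => ?_⟩
  filter_upwards [hX η hη] with v hv
  convert hv using 2
  have e := norm_add_sq_real x v
  simp only [_root_.sub_apply, _root_.smul_apply,
    ContinuousLinearMap.id_apply, smul_sub, inner_sub_left, inner_smul_left, conj_trivial,
    real_inner_self_eq_norm_sq]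
  rw [e]
  ring
end IsSupConv

end Doubling

section DoubledMax
variable {V : Type*} [NormedAddCommGroup V]

/-- `z` maximizes the doubled functional with quadratic localization centred at `a`. -/
def IsDoubledMax (k η : ℝ) (U W : V → ℝ) (z a : V × V) : Prop :=
  ∀ x' y', U x' + W y' - k / 2 * ‖x' - y'‖ ^ 2 - η / 2 * (‖x' - a.1‖ ^ 2 + ‖y' - a.2‖ ^ 2)
    ≤ U z.1 + W z.2 - k / 2 * ‖z.1 - z.2‖ ^ 2 - η / 2 * (‖z.1 - a.1‖ ^ 2 + ‖z.2 - a.2‖ ^ 2)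

namespace IsDoubledMax
variable {k η : ℝ} {U W : V → ℝ} {z a : V × V}

lemma fst (h : IsDoubledMax k η U W z a) (x' : V) :
    U x' - k / 2 * ‖x' - z.2‖ ^ 2 - η / 2 * ‖x' - a.1‖ ^ 2
      ≤ U z.1 - k / 2 * ‖z.1 - z.2‖ ^ 2 - η / 2 * ‖z.1 - a.1‖ ^ 2 := by
  have := h x' z.2
  linarith

lemma snd (h : IsDoubledMax k η U W z a) (y' : V) :
    W y' - k / 2 * ‖y' - z.1‖ ^ 2 - η / 2 * ‖y' - a.2‖ ^ 2
      ≤ W z.2 - k / 2 * ‖z.2 - z.1‖ ^ 2 - η / 2 * ‖z.2 - a.2‖ ^ 2 := by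
  have := h z.1 y'
  rw [norm_sub_rev y' z.1, norm_sub_rev z.2 z.1]
  linarith

end IsDoubledMax
end DoubledMax

section Contact
variable {V : Type*} [NormedAddCommGroup V] [InnerProductSpace ℝ V]

lemma IsSupConv.gradient_eq_of_max {k η : ℝ} {g U : V → ℝ} {ξ : V → V}
    (h : IsSupConv k g U ξ) {x y a : V}
    (hc : ∀ x', U x' - k / 2 * ‖x' - y‖ ^ 2 - η / 2 * ‖x' - a‖ ^ 2
      ≤ U x - k / 2 * ‖x - y‖ ^ 2 - η / 2 * ‖x - a‖ ^ 2) :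
    k • (ξ x - x) = k • (x - y) + η • (x - a) := by
  rw [← sub_eq_zero]
  refine eq_zero_of_inner_le_sq (c := (2 * k + η) / 2) fun v => ?_
  have h1 := h.semiconvex x (x + v)
  have h2 := hc (x + v)
  have e1 := norm_sub_sq_expand x (x + v) y
  have e2 := norm_sub_sq_expand x (x + v) a
  rw [add_sub_cancel_left] at h1 e1 e2
  rw [e1, e2] at h2
  rw [inner_sub_left, inner_add_left, inner_smul_left (x - y), inner_smul_left (x - a)]
  simp only [conj_trivial]
  nlinarith

lemma IsSupConv.upper_of_max {k η : ℝ} {g U : V → ℝ} {ξ : V → V}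
    (h : IsSupConv k g U ξ) {x y a : V}
    (hc : ∀ x', U x' - k / 2 * ‖x' - y‖ ^ 2 - η / 2 * ‖x' - a‖ ^ 2
      ≤ U x - k / 2 * ‖x - y‖ ^ 2 - η / 2 * ‖x - a‖ ^ 2) (x' : V) :
    U x' + k / 2 * ‖x'‖ ^ 2 ≤ U x + k / 2 * ‖x‖ ^ 2 + inner ℝ (k • ξ x) (x' - x)
      + (2 * k + η) / 2 * ‖x' - x‖ ^ 2 := by
  have e : k • ξ x = k • (x - y) + η • (x - a) + k • x := by
    rw [← h.gradient_eq_of_max hc, smul_sub]; abel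
  have h2 := hc x'
  have e1 := norm_sub_sq_expand x x' y
  have e2 := norm_sub_sq_expand x x' a
  have e3 := norm_sub_sq_expand x x' 0
  rw [sub_zero, sub_zero] at e3
  rw [e1, e2] at h2
  rw [e, e3, inner_add_left, inner_add_left, inner_smul_left (x - y), inner_smul_left (x - a),
    inner_smul_left x]
  simp only [conj_trivial]
  nlinarith

lemma IsSupConv.center_lipschitz {k η : ℝ} (hk : 0 < k) (hη : 0 < η) {g U : V → ℝ} {ξ : V → V}
    (h : IsSupConv k g U ξ) {x₁ y₁ a₁ x₂ y₂ a₂ : V}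
    (hc₁ : ∀ x', U x' - k / 2 * ‖x' - y₁‖ ^ 2 - η / 2 * ‖x' - a₁‖ ^ 2
      ≤ U x₁ - k / 2 * ‖x₁ - y₁‖ ^ 2 - η / 2 * ‖x₁ - a₁‖ ^ 2)
    (hc₂ : ∀ x', U x' - k / 2 * ‖x' - y₂‖ ^ 2 - η / 2 * ‖x' - a₂‖ ^ 2
      ≤ U x₂ - k / 2 * ‖x₂ - y₂‖ ^ 2 - η / 2 * ‖x₂ - a₂‖ ^ 2) :
    η * ‖a₁ - a₂‖ ≤ (4 * k + 2 * η) * ‖x₁ - x₂‖ + k * ‖y₁ - y₂‖ := by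
  have g₁ := h.gradient_eq_of_max hc₁
  have g₂ := h.gradient_eq_of_max hc₂
  have hl := gradient_lipschitz_of_touching (f := fun x => U x + k / 2 * ‖x‖ ^ 2)
    (Λ := 2 * k + η) (by positivity) (h.subgradient x₁)
    (h.upper_of_max hc₁) (h.upper_of_max hc₂)
  have e : η • (a₁ - a₂) = (2 * k + η) • (x₁ - x₂) - k • (y₁ - y₂) - (k • ξ x₁ - k • ξ x₂) := by
    have e₁ : k • ξ x₁ = k • (x₁ - y₁) + η • (x₁ - a₁) + k • x₁ := by rw [← g₁, smul_sub]; abel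
    have e₂ : k • ξ x₂ = k • (x₂ - y₂) + η • (x₂ - a₂) + k • x₂ := by rw [← g₂, smul_sub]; abel
    rw [e₁, e₂]
    module
  calc η * ‖a₁ - a₂‖ = ‖η • (a₁ - a₂)‖ := by rw [norm_smul, Real.norm_of_nonneg hη.le]
    _ ≤ ‖(2 * k + η) • (x₁ - x₂)‖ + ‖k • (y₁ - y₂)‖ + ‖k • ξ x₁ - k • ξ x₂‖ := by
      rw [e]; exact (norm_sub_le _ _).trans (add_le_add_left (norm_sub_le _ _) _)
    _ ≤ _ := by
      rw [norm_smul, norm_smul, Real.norm_of_nonneg hk.le, Real.norm_of_nonneg (by positivity)]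
      linarith

lemma IsDoubledMax.center_lipschitz {k η : ℝ} (hk : 0 < k) (hη : 0 < η) {g w U W : V → ℝ} {ξ ζ : V → V}
    (hU : IsSupConv k g U ξ) (hW : IsSupConv k w W ζ) {z₁ z₂ a₁ a₂ : V × V}
    (h₁ : IsDoubledMax k η U W z₁ a₁) (h₂ : IsDoubledMax k η U W z₂ a₂) :
    ‖a₁ - a₂‖ ≤ (5 * k + 2 * η) / η * ‖z₁ - z₂‖ := by
  have n1 : ‖z₁.1 - z₂.1‖ ≤ ‖z₁ - z₂‖ := norm_fst_le (z₁ - z₂)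
  have n2 : ‖z₁.2 - z₂.2‖ ≤ ‖z₁ - z₂‖ := norm_snd_le (z₁ - z₂)
  have c1 := hU.center_lipschitz hk hη h₁.fst h₂.fst
  have c2 := hW.center_lipschitz hk hη h₁.snd h₂.snd
  rw [div_mul_eq_mul_div, Prod.norm_def, Prod.fst_sub, Prod.snd_sub, sup_le_iff, le_div_iff₀ hη,
    le_div_iff₀ hη]
  constructor <;> nlinarith

/-- For almost every centre, every maximizer of the doubled functional avoids prescribed null
sets in both variables. -/
lemma ae_center_avoids [FiniteDimensional ℝ V] [MeasurableSpace V] [BorelSpace V]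
    (μ : Measure V) [μ.IsAddHaarMeasure] {k η : ℝ} (hk : 0 < k) (hη : 0 < η)
    {g w U W : V → ℝ} {ξ ζ : V → V} (hU : IsSupConv k g U ξ) (hW : IsSupConv k w W ζ)
    {p q : V → Prop} (hp : ∀ᵐ x ∂μ, p x) (hq : ∀ᵐ x ∂μ, q x) :
    ∀ᵐ a ∂(μ.prod μ), ∀ z, IsDoubledMax k η U W z a → p z.1 ∧ q z.2 := by
  have hN : (μ.prod μ) {z : V × V | ¬ (p z.1 ∧ q z.2)} = 0 := by
    have h1 : (μ.prod μ) ({x | ¬ p x} ×ˢ Set.univ) = 0 := by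
      rw [Measure.prod_prod, ae_iff.1 hp, zero_mul]
    have h2 : (μ.prod μ) (Set.univ ×ˢ {x | ¬ q x}) = 0 := by
      rw [Measure.prod_prod, ae_iff.1 hq, mul_zero]
    refine measure_mono_null (fun z hz => ?_) (measure_union_null h1 h2)
    simp only [Set.mem_ofPred_eq, not_and_or] at hz
    rcases hz with hz | hz
    · exact Or.inl ⟨hz, trivial⟩
    · exact Or.inr ⟨trivial, hz⟩
  have := measure_related_null (μ.prod μ) (IsDoubledMax k η U W) ((5 * k + 2 * η) / η)
    (fun z₁ z₂ a₁ a₂ h₁ h₂ => IsDoubledMax.center_lipschitz hk hη hU hW h₁ h₂) hN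
  rw [ae_iff]
  refine measure_mono_null (fun a ha => ?_) this
  simp only [Set.mem_ofPred_eq, not_forall] at ha
  obtain ⟨z, hz, hn⟩ := ha
  exact ⟨z, hn, hz⟩

/-- The functional of the fourfold doubling of variables. -/
def dbl (k η : ℝ) (a b : V) (u w : V → ℝ) (x y ξ ζ : V) : ℝ :=
  u ξ + w ζ - k / 2 * (‖x - ξ‖ ^ 2 + ‖y - ζ‖ ^ 2 + ‖x - y‖ ^ 2)
    - η / 2 * (‖x - a‖ ^ 2 + ‖y - b‖ ^ 2)

lemma exists_dbl_max [FiniteDimensional ℝ V] {k η : ℝ} (hk : 0 < k) (hη : 0 < η) (a b : V)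
    {u w : V → ℝ} (hu : Continuous u) (hw : Continuous w) {B : ℝ} (hBu : ∀ x, |u x| ≤ B)
    (hBw : ∀ x, |w x| ≤ B) :
    ∃ x y ξ ζ, ∀ x' y' ξ' ζ', dbl k η a b u w x' y' ξ' ζ' ≤ dbl k η a b u w x y ξ ζ := by
  have hB0 : 0 ≤ B := (abs_nonneg _).trans (hBu 0)
  let F : V × V × V × V → ℝ := fun z => dbl k η a b u w z.1 z.2.1 z.2.2.1 z.2.2.2
  have hF : Continuous F := by simp only [F, dbl]; fun_prop
  set c := F (a, a, a, a) with hc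
  have hbd : ∀ z, c ≤ F z →
      k * (‖z.1 - z.2.2.1‖ ^ 2 + ‖z.2.1 - z.2.2.2‖ ^ 2) + η * (‖z.1 - a‖ ^ 2 + ‖z.2.1 - b‖ ^ 2)
        ≤ 2 * (2 * B - c) := by
    intro z hz
    have h1 := (abs_le.1 (hBu z.2.2.1)).2
    have h2 := (abs_le.1 (hBw z.2.2.2)).2
    have h3 := mul_nonneg hk.le (sq_nonneg ‖z.1 - z.2.1‖)
    simp only [F, dbl] at hz
    nlinarith
  set T := 2 * (2 * B - c)
  have hsq : ∀ κ : ℝ, 0 < κ → ∀ t : ℝ, κ * t ^ 2 ≤ T → t ≤ 1 + T / κ := by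
    intro κ hκ t ht
    have : t ^ 2 ≤ T / κ := by rw [le_div_iff₀ hκ]; linarith
    nlinarith [sq_nonneg (t - 1)]
  set R := ‖a‖ + ‖b‖ + (1 + T / η) + (1 + T / k) with hR
  obtain ⟨z, hz⟩ := hF.exists_forall_ge' (a, a, a, a) (by
    have : ∀ᶠ z in cocompact (V × V × V × V), z ∉ Metric.closedBall 0 R :=
      (isCompact_closedBall _ _).compl_mem_cocompact
    filter_upwards [this] with z hz
    by_contra hcon
    push Not at hcon
    apply hz
    have hb := hbd z hcon.le
    have p1 := mul_nonneg hk.le (sq_nonneg ‖z.1 - z.2.2.1‖)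
    have p2 := mul_nonneg hk.le (sq_nonneg ‖z.2.1 - z.2.2.2‖)
    have p3 := mul_nonneg hη.le (sq_nonneg ‖z.1 - a‖)
    have p4 := mul_nonneg hη.le (sq_nonneg ‖z.2.1 - b‖)
    have q1 := hsq k hk ‖z.1 - z.2.2.1‖ (by linarith)
    have q2 := hsq k hk ‖z.2.1 - z.2.2.2‖ (by linarith)
    have q3 := hsq η hη ‖z.1 - a‖ (by linarith)
    have q4 := hsq η hη ‖z.2.1 - b‖ (by linarith)
    have tri : ∀ v v' : V, ‖v‖ ≤ ‖v'‖ + ‖v - v'‖ := fun v v' => by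
      calc ‖v‖ = ‖v' + (v - v')‖ := by congr 1; abel
        _ ≤ _ := norm_add_le _ _
    have r1 := tri z.1 a
    have r2 := tri z.2.1 b
    have r3 := tri z.2.2.1 z.1
    have r4 := tri z.2.2.2 z.2.1
    rw [norm_sub_rev] at r3 r4
    have s1 := norm_nonneg a
    have s2 := norm_nonneg b
    have s3 := norm_nonneg (z.1 - z.2.2.1)
    have s4 := norm_nonneg (z.2.1 - z.2.2.2)
    have s5 := norm_nonneg (z.1 - a)
    have s6 := norm_nonneg (z.2.1 - b)
    simp only [Metric.mem_closedBall, dist_zero_right, Prod.norm_def, sup_le_iff]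
    refine ⟨?_, ?_, ?_, ?_⟩ <;> linarith)
  exact ⟨z.1, z.2.1, z.2.2.1, z.2.2.2, fun x' y' ξ' ζ' => hz (x', y', ξ', ζ')⟩

end Contact

section Jets
variable {V : Type*} [NormedAddCommGroup V] [InnerProductSpace ℝ V]

/-- Second-order optimality at a maximizer of the doubled functional. -/
lemma IsDoubledMax.second_order {k η : ℝ} {g w U W : V → ℝ} {ξ ζ : V → V}
    (hU : IsSupConv k g U ξ) (hW : IsSupConv k w W ζ) {z a : V × V}
    (h : IsDoubledMax k η U W z a) {X Y : V →L[ℝ] V}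
    (hX : ∀ ε > 0, ∀ᶠ v in 𝓝 (0 : V), |U (z.1 + v) - U z.1 - inner ℝ (k • (ξ z.1 - z.1)) v
      - 1 / 2 * inner ℝ (X v) v| ≤ ε * ‖v‖ ^ 2)
    (hY : ∀ ε > 0, ∀ᶠ v in 𝓝 (0 : V), |W (z.2 + v) - W z.2 - inner ℝ (k • (ζ z.2 - z.2)) v
      - 1 / 2 * inner ℝ (Y v) v| ≤ ε * ‖v‖ ^ 2) (v₁ v₂ : V) :
    inner ℝ (X v₁) v₁ + inner ℝ (Y v₂) v₂
      ≤ k * ‖v₁ - v₂‖ ^ 2 + η * (‖v₁‖ ^ 2 + ‖v₂‖ ^ 2) := by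
  have g₁ := hU.gradient_eq_of_max h.fst
  have g₂ := hW.gradient_eq_of_max h.snd
  refine le_of_forall_pos_le_add fun δ hδ => ?_
  set ε := δ / (2 * (‖v₁‖ ^ 2 + ‖v₂‖ ^ 2 + 1)) with hε
  have hεpos : 0 < ε := by positivity
  have hεδ : 2 * ε * (‖v₁‖ ^ 2 + ‖v₂‖ ^ 2) ≤ δ := by
    have : 2 * ε * (‖v₁‖ ^ 2 + ‖v₂‖ ^ 2 + 1) = δ := by rw [hε]; field_simp
    nlinarith
  have ht : ∀ v : V, Tendsto (fun t : ℝ => t • v) (𝓝[>] 0) (𝓝 0) := fun v => by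
    have : Tendsto (fun t : ℝ => t • v) (𝓝 0) (𝓝 ((0 : ℝ) • v)) :=
      (continuous_id.smul continuous_const).tendsto 0
    rw [zero_smul] at this
    exact this.mono_left nhdsWithin_le_nhds
  obtain ⟨t, ⟨h1, h2⟩, ht0⟩ := ((((ht v₁).eventually (hX ε hεpos)).and
    ((ht v₂).eventually (hY ε hεpos))).and self_mem_nhdsWithin).exists
  have ht0 : 0 < t := ht0
  have h3 := h (z.1 + t • v₁) (z.2 + t • v₂)
  have e0 : z.1 + t • v₁ - (z.2 + t • v₂) = z.1 - z.2 + t • (v₁ - v₂) := by module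
  have e1 : z.1 + t • v₁ - a.1 = z.1 - a.1 + t • v₁ := by abel
  have e2 : z.2 + t • v₂ - a.2 = z.2 - a.2 + t • v₂ := by abel
  rw [e0, e1, e2, norm_add_sq_real, norm_add_sq_real, norm_add_sq_real] at h3
  rw [g₁] at h1
  rw [g₂] at h2
  have h4 := (abs_le.1 h1).1
  have h5 := (abs_le.1 h2).1
  rw [← neg_sub z.1 z.2] at h5
  simp only [inner_smul_right, inner_smul_left, inner_add_left, inner_sub_right, norm_smul, mul_pow,
    map_smul, conj_trivial, Real.norm_eq_abs, sq_abs, inner_neg_left, smul_neg] at h3 h4 h5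
  have key : t ^ 2 * (inner ℝ (X v₁) v₁ + inner ℝ (Y v₂) v₂) ≤
      t ^ 2 * (k * ‖v₁ - v₂‖ ^ 2 + η * (‖v₁‖ ^ 2 + ‖v₂‖ ^ 2) + 2 * ε * (‖v₁‖ ^ 2 + ‖v₂‖ ^ 2)) := by
    nlinarith
  have := le_of_mul_le_mul_left key (by positivity)
  linarith

/-- A quadratic expansion of a sup-convolution bounds the original function from above at the
maximizer. -/
lemma IsSupConv.upper_jet {k : ℝ} {g U : V → ℝ} {ξ : V → V} (hU : IsSupConv k g U ξ) {x : V}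
    {X : V →L[ℝ] V}
    (hX : ∀ ε > 0, ∀ᶠ v in 𝓝 (0 : V), |U (x + v) - U x - inner ℝ (k • (ξ x - x)) v
      - 1 / 2 * inner ℝ (X v) v| ≤ ε * ‖v‖ ^ 2) (ε : ℝ) (hε : 0 < ε) :
    ∀ᶠ v in 𝓝 (0 : V), g (ξ x + v) ≤ g (ξ x) + inner ℝ (k • (ξ x - x)) v
      + 1 / 2 * inner ℝ (X v) v + ε * ‖v‖ ^ 2 := by
  filter_upwards [hX ε hε] with v hv
  have h1 := (abs_le.1 hv).2
  have h2 := hU.le (x + v) (ξ x + v)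
  have h3 := hU.eq x
  rw [add_sub_add_right_eq_sub] at h2
  linarith

/-- The maximum principle for semicontinuous functions in the doubled form used for comparison:
for centres arbitrarily close to a prescribed point, the doubled functional of a finite family has a
maximizer at which both functions possess second-order superjets that satisfy the matrix
inequality. -/
lemma exists_doubling {V : Type*} [NormedAddCommGroup V] [InnerProductSpace ℝ V]
    [FiniteDimensional ℝ V] {ι : Type*} [Finite ι] [Nonempty ι] {k η : ℝ} (hk : 0 < k) (hη : 0 < η)
    {u w : ι → V → ℝ} (hu : ∀ i, Continuous (u i)) (hw : ∀ i, Continuous (w i)) {B : ℝ}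
    (hBu : ∀ i x, |u i x| ≤ B) (hBw : ∀ i x, |w i x| ≤ B) (x₀ : V) {κ : ℝ} (hκ : 0 < κ) :
    ∃ (a b : V) (i : ι) (x y ξ ζ : V) (X Y : V →L[ℝ] V),
      ‖a - x₀‖ < κ ∧ ‖b - x₀‖ < κ ∧
      (∀ j x' y' ξ' ζ',
        dbl k η a b (u j) (w j) x' y' ξ' ζ' ≤ dbl k η a b (u i) (w i) x y ξ ζ) ∧
      k • (ξ - x) = k • (x - y) + η • (x - a) ∧
      k • (ζ - y) = k • (y - x) + η • (y - b) ∧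
      (∀ ε > 0, ∀ᶠ v in 𝓝 (0 : V), u i (ξ + v) ≤ u i ξ + inner ℝ (k • (ξ - x)) v
        + 1 / 2 * inner ℝ (X v) v + ε * ‖v‖ ^ 2) ∧
      (∀ ε > 0, ∀ᶠ v in 𝓝 (0 : V), w i (ζ + v) ≤ w i ζ + inner ℝ (k • (ζ - y)) v
        + 1 / 2 * inner ℝ (Y v) v + ε * ‖v‖ ^ 2) ∧
      ∀ v₁ v₂, inner ℝ (X v₁) v₁ + inner ℝ (Y v₂) v₂
        ≤ k * ‖v₁ - v₂‖ ^ 2 + η * (‖v₁‖ ^ 2 + ‖v₂‖ ^ 2) := by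
  borelize V
  let μ : Measure V := Measure.hausdorffMeasure (Module.finrank ℝ V : ℝ)
  choose U ξ hU using fun i => exists_isSupConv hk (hu i) (hBu i)
  choose W ζ hW using fun i => exists_isSupConv hk (hw i) (hBw i)
  have hae : ∀ᵐ a ∂(μ.prod μ), ∀ i, ∀ z, IsDoubledMax k η (U i) (W i) z a → _ ∧ _ :=
    ae_all_iff.2 fun i => ae_center_avoids μ hk hη (hU i) (hW i)
      ((hU i).ae_second_order μ hk (hBu i)) ((hW i).ae_second_order μ hk (hBw i))
  obtain ⟨⟨a, b⟩, hgood, hab⟩ := (Measure.dense_of_ae hae).exists_mem_open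
    (Metric.isOpen_ball (x := (x₀, x₀)) (ε := κ)) ⟨(x₀, x₀), Metric.mem_ball_self hκ⟩
  rw [Metric.mem_ball, dist_eq_norm, Prod.norm_def, sup_lt_iff] at hab
  choose x y ξ' ζ' hmax using fun i => exists_dbl_max hk hη a b (hu i) (hw i) (hBu i) (hBw i)
  obtain ⟨i, hi⟩ := Finite.exists_max
    fun i => dbl k η a b (u i) (w i) (x i) (y i) (ξ' i) (ζ' i)
  have hval : ∀ x' y', dbl k η a b (u i) (w i) x' y' (ξ i x') (ζ i y')
      = U i x' + W i y' - k / 2 * ‖x' - y'‖ ^ 2 - η / 2 * (‖x' - a‖ ^ 2 + ‖y' - b‖ ^ 2) := by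
    intro x' y'
    rw [(hU i).eq, (hW i).eq, dbl]
    ring
  have hle : dbl k η a b (u i) (w i) (x i) (y i) (ξ' i) (ζ' i)
      ≤ dbl k η a b (u i) (w i) (x i) (y i) (ξ i (x i)) (ζ i (y i)) := by
    have h1 := (hU i).le (x i) (ξ' i)
    have h2 := (hW i).le (y i) (ζ' i)
    rw [hval, dbl]
    linarith
  have hz : IsDoubledMax k η (U i) (W i) (x i, y i) (a, b) := by
    intro x' y'
    have := (hmax i x' y' (ξ i x') (ζ i y')).trans hle
    rwa [hval, hval] at this
  obtain ⟨⟨X, hX⟩, Y, hY⟩ := hgood i _ hz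
  exact ⟨a, b, i, x i, y i, ξ i (x i), ζ i (y i), X, Y, hab.1, hab.2,
    fun j x' y' p q => (hmax j x' y' p q).trans ((hi j).trans hle),
    (hU i).gradient_eq_of_max hz.fst, (hW i).gradient_eq_of_max hz.snd,
    (hU i).upper_jet hX, (hW i).upper_jet hY, hz.second_order (hU i) (hW i) hX hY⟩
end Jets

end Analysis

section TestFunctions

variable {d d' : ℕ}

/-- The quadratic function with first order part `p` and second order part `B` at `ξ`. -/
def quadTest (ξ p : E d) (B : E d →L[ℝ] E d) (y : E d) : ℝ :=
  ⟪p, y - ξ⟫ + 1 / 2 * ⟪B (y - ξ), y - ξ⟫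

lemma contDiff_quadTest (ξ p : E d) (B : E d →L[ℝ] E d) : ContDiff ℝ 2 (quadTest ξ p B) := by
  have h : ContDiff ℝ 2 fun y : E d => y - ξ := contDiff_id.sub contDiff_const
  exact (contDiff_const.inner ℝ h).add (contDiff_const.mul ((B.contDiff.comp h).inner ℝ h))

/-- The column of a matrix as a Euclidean vector. -/
def colVec (A : Matrix (Fin d) (Fin d') ℝ) (l : Fin d') : E d :=
  WithLp.toLp 2 fun k => A k l

lemma colVec_sub (A A' : Matrix (Fin d) (Fin d') ℝ) (l : Fin d') :
    colVec (A - A') l = colVec A l - colVec A' l := rfl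

lemma sum_norm_colVec_sq (A : Matrix (Fin d) (Fin d') ℝ) :
    ∑ l, ‖colVec A l‖ ^ 2 = frobNorm A ^ 2 := by
  rw [frobNorm, Real.sq_sqrt (by positivity), Finset.sum_comm]
  simp [EuclideanSpace.norm_sq_eq, colVec]

lemma fderiv_quadTest (ξ p : E d) (B : E d →L[ℝ] E d) (y : E d) :
    fderiv ℝ (quadTest ξ p B) y = innerSL ℝ p +
      (1 / 2 : ℝ) • (innerSL ℝ (B (y - ξ)) + (innerSL ℝ (y - ξ)).comp B) := by
  have h1 : HasFDerivAt (fun z : E d => z - ξ) (ContinuousLinearMap.id ℝ (E d)) y :=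
    (hasFDerivAt_id y).sub_const ξ
  have h2 : HasFDerivAt (fun z : E d => B (z - ξ)) B y := by
    have h := HasFDerivAt.comp (f := fun z : E d => z - ξ) y B.hasFDerivAt h1
    rwa [ContinuousLinearMap.comp_id] at h
  have h3 := ((hasFDerivAt_const p y).inner ℝ h1).add ((h2.inner ℝ h1).const_mul (1 / 2))
  have h4 : HasFDerivAt (quadTest ξ p B) _ y := h3
  rw [h4.fderiv]
  ext v
  simp [real_inner_comm, inner_sub_left, inner_sub_right]
  ring

lemma gradient_quadTest (ξ p : E d) (B : E d →L[ℝ] E d) :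
    gradient (quadTest ξ p B) ξ = p := by
  rw [gradient, fderiv_quadTest]
  apply ext_inner_right ℝ
  intro v
  simp

lemma hess_quadTest (ξ p : E d) (B : E d →L[ℝ] E d) (i j : Fin d) :
    hess (quadTest ξ p B) ξ i j =
      1 / 2 * (⟪B (EuclideanSpace.single i 1), EuclideanSpace.single j 1⟫ +
        ⟪B (EuclideanSpace.single j 1), EuclideanSpace.single i 1⟫) := by
  have h : fderiv ℝ (quadTest ξ p B) = fun y => innerSL ℝ p +
      (1 / 2 : ℝ) • (innerSL ℝ (B (y - ξ)) + (innerSL ℝ (y - ξ)).comp B) :=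
    funext (fderiv_quadTest ξ p B)
  have h1 : HasFDerivAt (fun y : E d => innerSL ℝ p +
      (1 / 2 : ℝ) • (innerSL ℝ (B (y - ξ)) + (innerSL ℝ (y - ξ)).comp B))
      ((1 / 2 : ℝ) • ((innerSL ℝ).comp B +
        ((ContinuousLinearMap.compL ℝ (E d) (E d) ℝ).flip B).comp (innerSL ℝ))) ξ := by
    have hs : HasFDerivAt (fun z : E d => z - ξ) (ContinuousLinearMap.id ℝ (E d)) ξ :=
      (hasFDerivAt_id ξ).sub_const ξ
    have ha := HasFDerivAt.comp (f := fun z : E d => z - ξ) ξ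
      ((innerSL ℝ : E d →L[ℝ] _).comp B).hasFDerivAt hs
    have hb := HasFDerivAt.comp (f := fun z : E d => z - ξ) ξ
      (((ContinuousLinearMap.compL ℝ (E d) (E d) ℝ).flip B).comp (innerSL ℝ)).hasFDerivAt hs
    rw [ContinuousLinearMap.comp_id] at ha hb
    exact ((ha.add hb).const_smul (1 / 2 : ℝ)).const_add (innerSL ℝ p)
  simp only [hess, Matrix.of_apply, iteratedFDeriv_two_apply]
  rw [h, h1.fderiv]
  simp [real_inner_comm, mul_add]

lemma trace_mul_hess_quadTest (A : Matrix (Fin d) (Fin d') ℝ) (ξ p : E d)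
    (B : E d →L[ℝ] E d) :
    Matrix.trace (((1 : ℝ) / 2) • (A * Aᵀ) * hess (quadTest ξ p B) ξ) =
      1 / 2 * ∑ l, ⟪B (colVec A l), colVec A l⟫ := by
  have hcol : ∀ l, colVec A l = ∑ k, A k l • (EuclideanSpace.single k 1 : E d) := by
    intro l
    ext k
    simp [colVec, Finset.sum_apply, Pi.single_apply]
  have hB : ∀ l, ⟪B (colVec A l), colVec A l⟫ = ∑ i, ∑ j, A i l * A j l *
      ⟪B (EuclideanSpace.single i 1), (EuclideanSpace.single j 1 : E d)⟫ := by
    intro l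
    rw [hcol l, map_sum, sum_inner]
    refine Finset.sum_congr rfl fun i _ => ?_
    rw [inner_sum]
    refine Finset.sum_congr rfl fun j _ => ?_
    rw [map_smul, inner_smul_left, inner_smul_right]
    simp [mul_assoc]
  rw [Matrix.smul_mul, Matrix.trace_smul, smul_eq_mul]
  congr 1
  set β : Fin d → Fin d → ℝ := fun i j =>
    ⟪B (EuclideanSpace.single i 1), (EuclideanSpace.single j 1 : E d)⟫ with hβ
  have hh : ∀ i j, hess (quadTest ξ p B) ξ i j = 1 / 2 * (β i j + β j i) :=
    hess_quadTest ξ p B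
  simp only [hB, Matrix.trace, Matrix.diag_apply, Matrix.mul_apply, Matrix.transpose_apply, hh]
  have e1 : ∀ f : Fin d → Fin d → ℝ, ∑ i, ∑ j, (∑ l, A i l * A j l) * f i j =
      ∑ l, ∑ i, ∑ j, A i l * A j l * f i j := by
    intro f
    simp only [Finset.sum_mul]
    rw [Finset.sum_comm' (t' := Finset.univ) (s' := fun _ => Finset.univ) (by simp)]
    rw [Finset.sum_congr rfl fun i _ => Finset.sum_comm, Finset.sum_comm]
    refine Finset.sum_congr rfl fun l _ => Finset.sum_comm
  rw [← e1]
  have e2 : ∑ i, ∑ j, (∑ l, A i l * A j l) * β j i = ∑ i, ∑ j, (∑ l, A i l * A j l) * β i j := by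
    rw [Finset.sum_comm]
    simp only [mul_comm]
  calc _ = 1 / 2 * (∑ i, ∑ j, (∑ l, A i l * A j l) * β i j) +
      1 / 2 * (∑ i, ∑ j, (∑ l, A i l * A j l) * β j i) := by
        simp only [Finset.mul_sum, ← Finset.sum_add_distrib]
        refine Finset.sum_congr rfl fun i _ => Finset.sum_congr rfl fun j _ => ?_
        simp only [Finset.sum_mul, Finset.mul_sum, ← Finset.sum_add_distrib]
        refine Finset.sum_congr rfl fun l _ => ?_
        ring
    _ = _ := by rw [e2]; ring

end TestFunctions

section Comparison

variable {d d' M : ℕ} {𝒜 : Type} [MetricSpace 𝒜]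

lemma L_hess_quadTest (P : HJBData d d' M 𝒜) (i : Fin M) (α : 𝒜) (ξ p q : E d)
    (B : E d →L[ℝ] E d) (s : Fin M → ℝ) :
    P.L i α ξ s p (hess (quadTest ξ q B) ξ) =
      - (1 / 2 * ∑ l, ⟪B (colVec (P.σm i α ξ) l), colVec (P.σm i α ξ) l⟫)
        - ⟪P.bv i α ξ, p⟫ + P.cz i α ξ * s i - P.runCost i α ξ
        - ∑ j ∈ Finset.univ.erase i, P.dcp i j α ξ * s j := by
  rw [HJBData.L, trace_mul_hess_quadTest]

lemma bddAbove_L_image {P : HJBData d d' M 𝒜} {C lam0 : ℝ} (h1 : H1 P C lam0) (i : Fin M)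
    (ξ p q : E d) (B : E d →L[ℝ] E d) (s : Fin M → ℝ) :
    BddAbove ((fun α => P.L i α ξ s p (hess (quadTest ξ q B) ξ)) '' P.A i) := by
  refine ⟨1 / 2 * (‖B‖ * C ^ 2) + C * ‖p‖ + C * |s i| + C
    + ∑ j ∈ Finset.univ.erase i, C * |s j|, ?_⟩
  rintro _ ⟨α, hα, rfl⟩
  obtain ⟨-, -, -, -, -, hσ, -, hb, -, hc, -, hl, -, hd, -, -⟩ := h1.2.2 i α hα
  simp only [L_hess_quadTest]
  have t1 : -(∑ l, ⟪B (colVec (P.σm i α ξ) l), colVec (P.σm i α ξ) l⟫) ≤ ‖B‖ * C ^ 2 := by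
    have h0 : 0 ≤ frobNorm (P.σm i α ξ) := Real.sqrt_nonneg _
    calc _ ≤ ∑ l, ‖B‖ * ‖colVec (P.σm i α ξ) l‖ ^ 2 := by
          rw [← Finset.sum_neg_distrib]
          refine Finset.sum_le_sum fun l _ => ?_
          set v := colVec (P.σm i α ξ) l
          have := neg_le_of_abs_le (abs_real_inner_le_norm (B v) v)
          have := mul_le_mul_of_nonneg_right (B.le_opNorm v) (norm_nonneg v)
          nlinarith
      _ = ‖B‖ * frobNorm (P.σm i α ξ) ^ 2 := by rw [← Finset.mul_sum, sum_norm_colVec_sq]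
      _ ≤ _ := by gcongr; exact hσ ξ
  have t2 : -⟪P.bv i α ξ, p⟫ ≤ C * ‖p‖ := by
    have := neg_le_of_abs_le (abs_real_inner_le_norm (P.bv i α ξ) p)
    have := mul_le_mul_of_nonneg_right (hb ξ) (norm_nonneg p)
    linarith
  have t3 : P.cz i α ξ * s i ≤ C * |s i| := by
    refine (le_abs_self _).trans ?_
    rw [abs_mul]
    gcongr
    exact hc ξ
  have t4 : - P.runCost i α ξ ≤ C := neg_le_of_abs_le (hl ξ) |> fun h => by linarith
  have t5 : -(∑ j ∈ Finset.univ.erase i, P.dcp i j α ξ * s j) ≤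
      ∑ j ∈ Finset.univ.erase i, C * |s j| := by
    rw [← Finset.sum_neg_distrib]
    refine Finset.sum_le_sum fun j _ => (neg_le_abs _).trans ?_
    rw [abs_mul]
    gcongr
    exact (hd j).1 ξ
  linarith

lemma IsSubsolution.le_zero_of_expansion {F : Op d M} {u : Fin M → E d → ℝ}
    (hu : IsSubsolution F u) {i : Fin M} {ξ p : E d} {X : E d →L[ℝ] E d}
    (h : ∀ ε > 0, ∀ᶠ v in 𝓝 (0 : E d),
      u i (ξ + v) ≤ u i ξ + ⟪p, v⟫ + 1 / 2 * ⟪X v, v⟫ + ε * ‖v‖ ^ 2) {ε : ℝ} (hε : 0 < ε) :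
    F i ξ u p (hess (quadTest ξ p (X + (2 * ε) • ContinuousLinearMap.id ℝ (E d))) ξ) ≤ 0 := by
  have := hu.2 i _ (contDiff_quadTest ξ p (X + (2 * ε) • ContinuousLinearMap.id ℝ (E d))) ξ ?_
  · rwa [gradient_quadTest] at this
  · have ht : Tendsto (fun y : E d => y - ξ) (𝓝 ξ) (𝓝 0) :=
      (continuous_id.sub continuous_const).tendsto' ξ (0 : E d) (by simp)
    filter_upwards [ht.eventually (h ε hε)] with y hy
    simp only [add_sub_cancel] at hy
    simp [quadTest, inner_add_left, inner_smul_left, -map_sub]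
    nlinarith

lemma IsSupersolution.zero_le_of_expansion {F : Op d M} {v : Fin M → E d → ℝ}
    (hv : IsSupersolution F v) {i : Fin M} {ζ q : E d} {Y : E d →L[ℝ] E d}
    (h : ∀ ε > 0, ∀ᶠ w in 𝓝 (0 : E d),
      -v i (ζ + w) ≤ -v i ζ + ⟪-q, w⟫ + 1 / 2 * ⟪Y w, w⟫ + ε * ‖w‖ ^ 2) {ε : ℝ} (hε : 0 < ε) :
    0 ≤ F i ζ v q
      (hess (quadTest ζ q (-(Y + (2 * ε) • ContinuousLinearMap.id ℝ (E d)))) ζ) := by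
  have := hv.2 i _
    (contDiff_quadTest ζ q (-(Y + (2 * ε) • ContinuousLinearMap.id ℝ (E d)))) ζ ?_
  · rwa [gradient_quadTest] at this
  · have ht : Tendsto (fun y : E d => y - ζ) (𝓝 ζ) (𝓝 0) :=
      (continuous_id.sub continuous_const).tendsto' ζ (0 : E d) (by simp)
    filter_upwards [ht.eventually (h ε hε)] with y hy
    simp only [add_sub_cancel, inner_neg_left] at hy
    simp [quadTest, inner_add_left, inner_smul_left, -map_sub,
      -neg_add_rev, inner_neg_left]
    nlinarith

/-- The structural inequality obtained by subtracting the equations at a doubled maximum. -/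
lemma structural_estimate {P : HJBData d d' M 𝒜} {C lam0 : ℝ} (h1 : H1 P C lam0) {i : Fin M}
    {α : 𝒜} (hα : α ∈ P.A i) {ξ ζ p q p' q' : E d} {B₁ B₂ : E d →L[ℝ] E d} {k η : ℝ}
    (hk : 0 ≤ k) (hη : 0 ≤ η)
    (hB : ∀ v w, ⟪B₁ v, v⟫ + ⟪B₂ w, w⟫ ≤ k * ‖v - w‖ ^ 2 + η * (‖v‖ ^ 2 + ‖w‖ ^ 2))
    {r s : Fin M → ℝ} {N : ℝ} (hs : ∀ j, |s j| ≤ N) (hrs : ∀ j, r j - s j ≤ r i - s i)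
    (hpos : 0 ≤ r i - s i) :
    lam0 * (r i - s i) ≤ P.L i α ξ r p (hess (quadTest ξ p' B₁) ξ)
      - P.L i α ζ s q (hess (quadTest ζ q' (-B₂)) ζ)
      + (1 / 2 * (C ^ 2 * (k * ‖ξ - ζ‖ ^ 2)) + η * C ^ 2 + C * (‖ξ - ζ‖ * ‖p‖) + C * ‖p - q‖
      + C * ‖ξ - ζ‖ * (N + M * N + 1)) := by
  obtain ⟨-, -, -, -, -, hσ, hσ', hb, hb', hc, hc', hl, hl', hd, hd0, hlam⟩ := h1.2.2 i α hα
  have hC : 0 ≤ C := (norm_nonneg _).trans (hb ξ)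
  have hN : 0 ≤ N := (abs_nonneg _).trans (hs i)
  rw [L_hess_quadTest, L_hess_quadTest]
  set σ := P.σm i α ξ
  set σ' := P.σm i α ζ
  set δ := ‖ξ - ζ‖
  have hδ : 0 ≤ δ := norm_nonneg _
  have t1 : ∑ l, ⟪B₁ (colVec σ l), colVec σ l⟫ + ∑ l, ⟪B₂ (colVec σ' l), colVec σ' l⟫ ≤
      C ^ 2 * (k * δ ^ 2) + 2 * (η * C ^ 2) := by
    have hf : ∀ A : Matrix (Fin d) (Fin d') ℝ, 0 ≤ frobNorm A := fun A => Real.sqrt_nonneg _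
    calc _ ≤ ∑ l, (k * ‖colVec (σ - σ') l‖ ^ 2 + η * (‖colVec σ l‖ ^ 2 + ‖colVec σ' l‖ ^ 2)) := by
          rw [← Finset.sum_add_distrib]
          exact Finset.sum_le_sum fun l _ => by rw [colVec_sub]; exact hB _ _
      _ = k * frobNorm (σ - σ') ^ 2 + η * (frobNorm σ ^ 2 + frobNorm σ' ^ 2) := by
          rw [Finset.sum_add_distrib, ← Finset.mul_sum, ← Finset.mul_sum, Finset.sum_add_distrib,
            sum_norm_colVec_sq, sum_norm_colVec_sq, sum_norm_colVec_sq]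
      _ ≤ k * (C * δ) ^ 2 + η * (C ^ 2 + C ^ 2) := by
          gcongr
          · exact hf _
          · exact hσ' ξ ζ
          · exact hf _
          · exact hσ ξ
          · exact hf _
          · exact hσ ζ
      _ = _ := by ring
  have t2 : ⟪P.bv i α ξ, p⟫ - ⟪P.bv i α ζ, q⟫ ≤ C * (δ * ‖p‖) + C * ‖p - q‖ := by
    have e : ⟪P.bv i α ξ, p⟫ - ⟪P.bv i α ζ, q⟫ =
        ⟪P.bv i α ξ - P.bv i α ζ, p⟫ + ⟪P.bv i α ζ, p - q⟫ := by
      rw [inner_sub_left, inner_sub_right]; ring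
    rw [e]
    refine add_le_add ((real_inner_le_norm _ _).trans ?_) ((real_inner_le_norm _ _).trans ?_)
    · rw [← mul_assoc]
      gcongr
      exact hb' ξ ζ
    · gcongr
      exact hb ζ
  have t3 : P.cz i α ξ * (r i - s i) - C * δ * N ≤ P.cz i α ξ * r i - P.cz i α ζ * s i := by
    have : |(P.cz i α ξ - P.cz i α ζ) * s i| ≤ C * δ * N := by
      rw [abs_mul]
      exact mul_le_mul (hc' ξ ζ) (hs i) (abs_nonneg _) (by positivity)
    have := neg_le_of_abs_le this
    nlinarith
  have t4 : P.runCost i α ξ - P.runCost i α ζ ≤ C * δ := (le_abs_self _).trans (hl' ξ ζ)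
  have t5 : ∑ j ∈ Finset.univ.erase i, P.dcp i j α ξ * r j
      - ∑ j ∈ Finset.univ.erase i, P.dcp i j α ζ * s j ≤
      (∑ j ∈ Finset.univ.erase i, P.dcp i j α ξ) * (r i - s i) + M * (C * δ * N) := by
    calc _ ≤ ∑ j ∈ Finset.univ.erase i, (P.dcp i j α ξ * (r i - s i) + C * δ * N) := by
          rw [← Finset.sum_sub_distrib]
          refine Finset.sum_le_sum fun j hj => ?_
          have : |(P.dcp i j α ξ - P.dcp i j α ζ) * s j| ≤ C * δ * N := by
            rw [abs_mul]
            exact mul_le_mul ((hd j).2 ξ ζ) (hs j) (abs_nonneg _) (by positivity)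
          have := le_of_abs_le this
          have := mul_le_mul_of_nonneg_left (hrs j) (hd0 j hj ξ)
          nlinarith
      _ ≤ _ := by
          rw [Finset.sum_add_distrib, ← Finset.sum_mul, Finset.sum_const, nsmul_eq_mul]
          gcongr
          exact (Finset.card_le_univ _).trans_eq (Fintype.card_fin M)
  have t6 := mul_le_mul_of_nonneg_right (hlam ξ) hpos
  simp only [_root_.neg_apply, inner_neg_left, Finset.sum_neg_distrib]
  nlinarith

/-- At a doubled maximum the viscosity inequalities bound the gap `u - v` by quantities that
vanish in the limit of the doubling parameters. -/
lemma penalized_estimate {P : HJBData d d' M 𝒜} {C lam0 : ℝ} (h1 : H1 P C lam0) {ρ : ℝ}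
    (hρ : 0 ≤ ρ) {Ψ u v : Fin M → E d → ℝ} (hu : IsSubsolution (FobPen P Ψ ρ) u)
    (hv : IsSupersolution (FobPen P Ψ ρ) v) {i : Fin M} {ξ ζ p q : E d} {X Y : E d →L[ℝ] E d}
    {k η N : ℝ} (hk : 0 ≤ k) (hη : 0 < η)
    (hX : ∀ ε > 0, ∀ᶠ w in 𝓝 (0 : E d),
      u i (ξ + w) ≤ u i ξ + ⟪p, w⟫ + 1 / 2 * ⟪X w, w⟫ + ε * ‖w‖ ^ 2)
    (hY : ∀ ε > 0, ∀ᶠ w in 𝓝 (0 : E d),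
      -v i (ζ + w) ≤ -v i ζ + ⟪-q, w⟫ + 1 / 2 * ⟪Y w, w⟫ + ε * ‖w‖ ^ 2)
    (hXY : ∀ v w, ⟪X v, v⟫ + ⟪Y w, w⟫ ≤ k * ‖v - w‖ ^ 2 + η * (‖v‖ ^ 2 + ‖w‖ ^ 2))
    (hN : ∀ j x, |v j x| ≤ N) (hmax : ∀ j, u j ξ - v j ζ ≤ u i ξ - v i ζ)
    (hpos : 0 ≤ u i ξ - v i ζ) :
    lam0 * (u i ξ - v i ζ) ≤ 1 / 2 * (C ^ 2 * (k * ‖ξ - ζ‖ ^ 2)) + 3 * η * C ^ 2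
      + C * (‖ξ - ζ‖ * ‖p‖) + C * ‖p - q‖ + C * ‖ξ - ζ‖ * (N + M * N + 1)
      + ρ * |Ψ i ξ - Ψ i ζ| + η := by
  have hsub := hu.le_zero_of_expansion hX hη
  have hsup := hv.zero_le_of_expansion hY hη
  set B₁ := X + (2 * η) • ContinuousLinearMap.id ℝ (E d) with hB₁
  set B₂ := Y + (2 * η) • ContinuousLinearMap.id ℝ (E d) with hB₂
  have hB : ∀ v w, ⟪B₁ v, v⟫ + ⟪B₂ w, w⟫ ≤
      k * ‖v - w‖ ^ 2 + (3 * η) * (‖v‖ ^ 2 + ‖w‖ ^ 2) := by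
    intro v w
    have := hXY v w
    simp [hB₁, hB₂, inner_add_left, inner_smul_left]
    nlinarith
  simp only [FobPen, HJBData.Ham] at hsub hsup
  obtain ⟨_, ⟨α, hα, rfl⟩, hlt⟩ := exists_lt_of_lt_csSup
    ((h1.2.1 i).1.image fun α => P.L i α ζ (fun j => v j ζ) q (hess (quadTest ζ q (-B₂)) ζ))
    (sub_lt_self _ hη)
  have hle := le_csSup (bddAbove_L_image h1 i ξ p p B₁ fun j => u j ξ) ⟨α, hα, rfl⟩
  have key := structural_estimate h1 hα (ξ := ξ) (ζ := ζ) (p := p) (q := q) (p' := p) (q' := q) hk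
    (by positivity : 0 ≤ 3 * η) hB
    (r := fun j => u j ξ) (s := fun j => v j ζ) (fun j => hN j ζ) hmax hpos
  have hpen : ρ * max (v i ζ - Ψ i ζ) 0 - ρ * max (u i ξ - Ψ i ξ) 0 ≤ ρ * |Ψ i ξ - Ψ i ζ| := by
    rw [← mul_sub]
    gcongr
    have h2 := le_max_left (u i ξ - Ψ i ξ) 0
    have h3 := le_max_right (u i ξ - Ψ i ξ) 0
    have h4 := le_abs_self (Ψ i ξ - Ψ i ζ)
    rcases max_cases (v i ζ - Ψ i ζ) 0 with ⟨h, -⟩ | ⟨h, -⟩ <;> rw [h]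
    · linarith
    · linarith [abs_nonneg (Ψ i ξ - Ψ i ζ)]
  simp only at hlt hle key
  linarith

lemma doubling_penalty_bounds {V : Type*} [NormedAddCommGroup V] {k η D : ℝ} (hk : 0 ≤ k)
    (hη : 0 ≤ η) {x y ξ ζ a b : V}
    (hD : D = k / 2 * (‖x - ξ‖ ^ 2 + ‖y - ζ‖ ^ 2 + ‖x - y‖ ^ 2)
      + η / 2 * (‖x - a‖ ^ 2 + ‖y - b‖ ^ 2)) :
    0 ≤ D ∧ k * ‖x - ξ‖ ^ 2 ≤ 2 * D ∧ k * ‖y - ζ‖ ^ 2 ≤ 2 * D ∧ η * ‖x - a‖ ^ 2 ≤ 2 * D ∧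
      η * ‖y - b‖ ^ 2 ≤ 2 * D ∧ k * ‖ξ - ζ‖ ^ 2 ≤ 6 * D := by
  have p₁ : 0 ≤ k * ‖x - ξ‖ ^ 2 := by positivity
  have p₂ : 0 ≤ k * ‖y - ζ‖ ^ 2 := by positivity
  have p₃ : 0 ≤ k * ‖x - y‖ ^ 2 := by positivity
  have p₄ : 0 ≤ η * ‖x - a‖ ^ 2 := by positivity
  have p₅ : 0 ≤ η * ‖y - b‖ ^ 2 := by positivity
  have h : ‖ξ - ζ‖ ≤ ‖x - ξ‖ + ‖x - y‖ + ‖y - ζ‖ := by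
    calc ‖ξ - ζ‖ = ‖(ξ - x) + (x - y) + (y - ζ)‖ := by congr 1; abel
      _ ≤ _ := (norm_add₃_le).trans_eq (by rw [norm_sub_rev ξ x])
  have h2 : ‖ξ - ζ‖ ^ 2 ≤ 3 * (‖x - ξ‖ ^ 2 + ‖y - ζ‖ ^ 2 + ‖x - y‖ ^ 2) := by
    have := pow_le_pow_left₀ (norm_nonneg _) h 2
    nlinarith [sq_nonneg (‖x - ξ‖ - ‖x - y‖), sq_nonneg (‖x - ξ‖ - ‖y - ζ‖),
      sq_nonneg (‖x - y‖ - ‖y - ζ‖)]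
  have h3 := mul_le_mul_of_nonneg_left h2 hk
  refine ⟨?_, ?_, ?_, ?_, ?_, ?_⟩ <;> linarith

lemma le_of_mul_sq_le {c e t R T : ℝ} (he : 0 < e) (hc : e ≤ c) (hR : 1 ≤ R) (hRT : T ≤ e * R)
    (h : c * t ^ 2 ≤ T) : t ≤ R := by
  by_contra! ht
  have h₁ : e * t ^ 2 ≤ c * t ^ 2 := by gcongr
  have h₂ : e * R < e * t := by gcongr
  have h₃ : e * t * 1 ≤ e * t * t := by
    have : 1 ≤ t := by linarith
    gcongr
  nlinarith

lemma norm_smul_le_of_mul_sq_le {V : Type*} [NormedAddCommGroup V] [NormedSpace ℝ V] {e : ℝ}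
    (he : 0 < e) {z : V} (h : e * ‖z‖ ^ 2 ≤ 6 * e) : ‖e • z‖ ≤ 3 * e := by
  rw [norm_smul, Real.norm_of_nonneg he.le, mul_comm]
  gcongr
  by_contra! hz
  have : e * 3 ^ 2 < e * ‖z‖ ^ 2 := by gcongr
  linarith

/-- Doubling of variables at an almost maximum of `u - v`, with all the error terms controlled
by the parameter `e`. -/
lemma exists_close_doubling {Ψ u v : Fin M → E d → ℝ} (hΨ : ∀ i, Continuous (Ψ i))
    (huc : ∀ i, Continuous (u i)) (hvc : ∀ i, Continuous (v i)) {N : ℝ} (hN : 0 ≤ N)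
    (hNu : ∀ j y, |u j y| ≤ N) (hNv : ∀ j y, |v j y| ≤ N) {m e : ℝ} (hm : 0 < m) (he : 0 < e)
    (he1 : e ≤ 1) (hm_le : ∀ j y, u j y - v j y ≤ m) {i₀ : Fin M} {x₀ : E d}
    (hx₀ : m - e < u i₀ x₀ - v i₀ x₀) :
    ∃ (i : Fin M) (ξ ζ p q : E d) (X Y : E d →L[ℝ] E d) (k : ℝ), 0 ≤ k ∧
      (∀ ε > 0, ∀ᶠ w in 𝓝 (0 : E d),
        u i (ξ + w) ≤ u i ξ + ⟪p, w⟫ + 1 / 2 * ⟪X w, w⟫ + ε * ‖w‖ ^ 2) ∧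
      (∀ ε > 0, ∀ᶠ w in 𝓝 (0 : E d),
        -v i (ζ + w) ≤ -v i ζ + ⟪-q, w⟫ + 1 / 2 * ⟪Y w, w⟫ + ε * ‖w‖ ^ 2) ∧
      (∀ v w, ⟪X v, v⟫ + ⟪Y w, w⟫ ≤ k * ‖v - w‖ ^ 2 + e * (‖v‖ ^ 2 + ‖w‖ ^ 2)) ∧
      (∀ j, u j ξ - v j ζ ≤ u i ξ - v i ζ) ∧ m - 2 * e ≤ u i ξ - v i ζ ∧
      k * ‖ξ - ζ‖ ^ 2 ≤ 18 * e ∧ ‖ξ - ζ‖ * ‖p‖ ≤ 12 * e ∧ ‖p - q‖ ≤ 6 * e ∧ ‖ξ - ζ‖ ≤ e ∧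
      |Ψ i ξ - Ψ i ζ| ≤ e := by
  have : Nonempty (Fin M) := ⟨i₀⟩
  set T := 2 * N + 2 with hT
  set R := 1 + 2 * T / e with hR
  have hT0 : 0 < T := by positivity
  have hR1 : 1 ≤ R := by rw [hR]; linarith [show 0 ≤ 2 * T / e by positivity]
  have hRe : 2 * T ≤ e * R := by
    have : e * R = e + 2 * T := by rw [hR]; field_simp
    linarith
  have hunif := (isCompact_closedBall x₀ (2 * R + 1)).uniformContinuousOn_of_continuous
    (f := fun (y : E d) (j : Fin M) => (v j y, Ψ j y))
    (continuous_pi fun j => (hvc j).prodMk (hΨ j)).continuousOn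
  obtain ⟨δ, hδ, hunif⟩ := Metric.uniformContinuousOn_iff.1 hunif e he
  set δ' := min δ e with hδ'
  have hδ'0 : 0 < δ' := lt_min hδ he
  set k := 1 + 6 * T / δ' ^ 2 with hk_def
  have hk1 : 1 ≤ k := by rw [hk_def]; linarith [show 0 ≤ 6 * T / δ' ^ 2 by positivity]
  have hk0 : 0 < k := by linarith
  have hkδ : 6 * T < k * δ' ^ 2 := by
    rw [hk_def, add_mul, div_mul_cancel₀ _ (by positivity)]
    have : 0 < δ' ^ 2 := by positivity
    linarith
  obtain ⟨a, b, i, x, y, ξ, ζ, X, Y, ha, hb, hmax, hp, hq, hX, hY, hXY⟩ :=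
    exists_doubling (w := fun j y => -v j y) hk0 he huc (fun j => (hvc j).neg)
      hNu (fun j y => (abs_neg _).trans_le (hNv j y)) x₀ one_pos
  have hcomp := hmax i₀ x₀ x₀ x₀ x₀
  simp only [dbl, sub_self, norm_zero] at hcomp
  have ha2 : ‖x₀ - a‖ ^ 2 ≤ 1 := by
    rw [norm_sub_rev]; exact pow_le_one₀ (norm_nonneg _) ha.le
  have hb2 : ‖x₀ - b‖ ^ 2 ≤ 1 := by
    rw [norm_sub_rev]; exact pow_le_one₀ (norm_nonneg _) hb.le
  obtain ⟨D, hD⟩ : ∃ D, D = k / 2 * (‖x - ξ‖ ^ 2 + ‖y - ζ‖ ^ 2 + ‖x - y‖ ^ 2)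
    + e / 2 * (‖x - a‖ ^ 2 + ‖y - b‖ ^ 2) := ⟨_, rfl⟩
  obtain ⟨hD0, hx1, hy1, hxa, hyb, hξζ⟩ := doubling_penalty_bounds hk0.le he.le hD
  have hD1 : m - 2 * e ≤ u i ξ - v i ζ - D := by
    have : e / 2 * (‖x₀ - a‖ ^ 2 + ‖x₀ - b‖ ^ 2) ≤ e / 2 * (1 + 1) := by gcongr
    linarith
  have hDT : D ≤ T := by
    have := le_of_abs_le (hNu i ξ)
    have := neg_le_of_abs_le (hNv i ζ)
    linarith
  have hRD : 2 * D ≤ e * R := by linarith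
  have hball : ∀ z c s, ‖c - x₀‖ < 1 → ‖z - c‖ ≤ R → ‖z - s‖ ≤ R →
      s ∈ Metric.closedBall x₀ (2 * R + 1) := by
    intro z c s h₁ h₂ h₃
    rw [mem_closedBall_iff_norm]
    calc ‖s - x₀‖ = ‖(s - z) + (z - c) + (c - x₀)‖ := by congr 1; abel
      _ ≤ ‖s - z‖ + ‖z - c‖ + ‖c - x₀‖ := norm_add₃_le
      _ ≤ 2 * R + 1 := by rw [norm_sub_rev s z]; linarith
  have hξ_mem := hball x a ξ ha (le_of_mul_sq_le he le_rfl hR1 hRD hxa)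
    (le_of_mul_sq_le he (he1.trans hk1) hR1 hRD hx1)
  have hζ_mem := hball y b ζ hb (le_of_mul_sq_le he le_rfl hR1 hRD hyb)
    (le_of_mul_sq_le he (he1.trans hk1) hR1 hRD hy1)
  have hδξ : ‖ξ - ζ‖ < δ' := by
    by_contra! h
    have : k * δ' ^ 2 ≤ k * ‖ξ - ζ‖ ^ 2 := by gcongr
    linarith
  have hclose := hunif ξ hξ_mem ζ hζ_mem
    (by rw [dist_eq_norm]; exact hδξ.trans_le (min_le_left _ _))
  have hclose' := (dist_le_pi_dist _ _ i).trans hclose.le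
  rw [Prod.dist_eq, Real.dist_eq, Real.dist_eq] at hclose'
  have hv_close : |v i ξ - v i ζ| ≤ e := (le_max_left _ _).trans hclose'
  have hΨ_close : |Ψ i ξ - Ψ i ζ| ≤ e := (le_max_right _ _).trans hclose'
  have hδe : ‖ξ - ζ‖ ≤ e := hδξ.le.trans (min_le_right _ _)
  have hD3 : D ≤ 3 * e := by
    have := hm_le i ξ
    have := le_of_abs_le hv_close
    linarith
  have hgap : m - 2 * e ≤ u i ξ - v i ζ := by linarith
  have hjmax : ∀ j, u j ξ - v j ζ ≤ u i ξ - v i ζ := by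
    intro j
    have := hmax j x y ξ ζ
    simp only [dbl] at this
    linarith
  have hq' : k • (ζ - y) = -(k • (y - ζ)) := by rw [← smul_neg, neg_sub]
  have hnorm_p : ‖k • (ξ - x)‖ = k * ‖x - ξ‖ := by
    rw [norm_smul, Real.norm_of_nonneg hk0.le, norm_sub_rev]
  have hpq : ‖k • (ξ - x) - k • (y - ζ)‖ ≤ 6 * e := by
    have h : k • (ξ - x) - k • (y - ζ) = e • (x - a) + e • (y - b) := by
      rw [sub_eq_add_neg, ← hq', hp, hq, ← neg_sub x y, smul_neg]
      abel
    rw [h]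
    have h₁ := norm_smul_le_of_mul_sq_le he (hxa.trans (by linarith))
    have h₂ := norm_smul_le_of_mul_sq_le he (hyb.trans (by linarith))
    exact (norm_add_le _ _).trans (by linarith)
  have hfirst : ‖ξ - ζ‖ * ‖k • (ξ - x)‖ ≤ 12 * e := by
    rw [hnorm_p]
    have h := mul_nonneg hk0.le (sq_nonneg (‖ξ - ζ‖ - ‖x - ξ‖))
    have h' : k * (‖ξ - ζ‖ - ‖x - ξ‖) ^ 2 = k * ‖ξ - ζ‖ ^ 2 + k * ‖x - ξ‖ ^ 2
      - 2 * (‖ξ - ζ‖ * (k * ‖x - ξ‖)) := by ring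
    linarith
  have hsecond : k * ‖ξ - ζ‖ ^ 2 ≤ 18 * e := by linarith
  exact ⟨i, ξ, ζ, k • (ξ - x), k • (y - ζ), X, Y, k, hk0.le, hX,
    by simpa only [hq'] using hY, hXY, hjmax, hgap, hsecond, hfirst, hpq, hδe, hΨ_close⟩

/-- Comparison principle for the penalized obstacle problem. -/
theorem comparison {P : HJBData d d' M 𝒜} {C lam0 : ℝ} (h1 : H1 P C lam0) {ρ : ℝ}
    (hρ : 0 ≤ ρ) {Ψ u v : Fin M → E d → ℝ} (hΨ : ∀ i, Continuous (Ψ i))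
    (huc : ∀ i, Continuous (u i)) (hvc : ∀ i, Continuous (v i)) (hub : Bdd u) (hvb : Bdd v)
    (hu : IsSubsolution (FobPen P Ψ ρ) u) (hv : IsSupersolution (FobPen P Ψ ρ) v)
    (i : Fin M) (x : E d) : u i x ≤ v i x := by
  by_contra! hlt
  have : Nonempty (Fin M) := ⟨i⟩
  obtain ⟨Bu, hBu⟩ := hub
  obtain ⟨Bv, hBv⟩ := hvb
  set N := max Bu Bv
  have hNu : ∀ j y, |u j y| ≤ N := fun j y => (hBu j y).trans (le_max_left _ _)
  have hNv : ∀ j y, |v j y| ≤ N := fun j y => (hBv j y).trans (le_max_right _ _)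
  have hN : 0 ≤ N := (abs_nonneg _).trans (hNu i x)
  have hC : 0 ≤ C := by
    obtain ⟨α, hα⟩ := (h1.2.1 i).1
    obtain ⟨-, -, -, -, -, -, -, hb, -⟩ := h1.2.2 i α hα
    exact (norm_nonneg _).trans (hb x)
  have hbdd : BddAbove (Set.range fun z : Fin M × E d => u z.1 z.2 - v z.1 z.2) := by
    refine ⟨2 * N, ?_⟩
    rintro _ ⟨z, rfl⟩
    have := le_of_abs_le (hNu z.1 z.2)
    have := neg_le_of_abs_le (hNv z.1 z.2)
    dsimp only
    linarith
  set m := ⨆ z : Fin M × E d, (u z.1 z.2 - v z.1 z.2) with hm_def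
  have hm_le : ∀ j y, u j y - v j y ≤ m := fun j y => le_ciSup hbdd (j, y)
  have hm : 0 < m := (sub_pos.2 hlt).trans_le (hm_le i x)
  set K := 9 * C ^ 2 + 3 * C ^ 2 + 12 * C + 6 * C + C * (N + M * N + 1) + ρ + 1 with hK
  have hK0 : 0 < K := by positivity
  have hlam := h1.1
  obtain ⟨e, he, he1, hem, hsmall⟩ : ∃ e : ℝ, 0 < e ∧ e ≤ 1 ∧ 2 * e ≤ m ∧
      e * (K + 2 * lam0) < lam0 * m := by
    refine ⟨min (min 1 (m / 2)) (lam0 * m / (2 * (K + 2 * lam0))), by positivity,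
      (min_le_left _ _).trans (min_le_left _ _), ?_, ?_⟩
    · have := (min_le_left (min 1 (m / 2)) (lam0 * m / (2 * (K + 2 * lam0)))).trans
        (min_le_right _ _)
      linarith
    · calc _ ≤ lam0 * m / (2 * (K + 2 * lam0)) * (K + 2 * lam0) := by
            gcongr
            exact min_le_right _ _
        _ = lam0 * m / 2 := by field_simp
        _ < lam0 * m := half_lt_self (by positivity)
  obtain ⟨⟨i₀, x₀⟩, hx₀⟩ := exists_lt_of_lt_ciSup (sub_lt_self m he)
  simp only at hx₀
  obtain ⟨i, ξ, ζ, p, q, X, Y, k, hk, hX, hY, hXY, hmax, hgap, hsecond, hfirst, hpq, hδ, hΨe⟩ :=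
    exists_close_doubling hΨ huc hvc hN hNu hNv hm he he1 hm_le hx₀
  have hfin := penalized_estimate h1 hρ hu hv hk he hX hY hXY hNv hmax (by linarith)
  have : lam0 * (m - 2 * e) ≤ K * e := by
    calc lam0 * (m - 2 * e) ≤ lam0 * (u i ξ - v i ζ) := by gcongr
      _ ≤ _ := hfin
      _ ≤ 1 / 2 * (C ^ 2 * (18 * e)) + 3 * e * C ^ 2 + C * (12 * e) + C * (6 * e)
          + C * e * (N + M * N + 1) + ρ * e + e := by gcongr
      _ = K * e := by rw [hK]; ring
  linarith

end Comparison

section Intervention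

variable {d M : ℕ} {𝒵 : Type} [MetricSpace 𝒵]

lemma bddBelow_intervention {Q : ImpulseData d M 𝒵} {κ₀ : ℝ} (h2 : H2 Q κ₀)
    {u : Fin M → E d → ℝ} (hu : Bdd u) (i : Fin M) (x : E d) :
    BddBelow ((fun z => u i (Q.Γ i x z) + Q.K i x z) '' Q.Z i x) := by
  obtain ⟨B, hB⟩ := hu
  refine ⟨-B, ?_⟩
  rintro _ ⟨z, hz, rfl⟩
  have := neg_le_of_abs_le (hB i (Q.Γ i x z))
  have := h2.2.2.2.2.2 i x z hz
  have := h2.1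
  dsimp only
  linarith

lemma Mop_mono {Q : ImpulseData d M 𝒵} {κ₀ : ℝ} (h2 : H2 Q κ₀) {u v : Fin M → E d → ℝ}
    (hu : Bdd u) (huv : ∀ i x, u i x ≤ v i x) (i : Fin M) (x : E d) :
    Q.Mop i u x ≤ Q.Mop i v x := by
  refine le_csInf ((h2.2.1 i x).1.image _) ?_
  rintro _ ⟨z, hz, rfl⟩
  exact (csInf_le (bddBelow_intervention h2 hu i x) ⟨z, hz, rfl⟩).trans
    (add_le_add (huv i _) le_rfl)

lemma continuous_Mop {Q : ImpulseData d M 𝒵} {κ₀ : ℝ} (h2 : H2 Q κ₀) {u : Fin M → E d → ℝ}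
    (hu : Bdd u) (huc : ∀ i, Continuous (u i)) (i : Fin M) :
    Continuous fun x => Q.Mop i u x := by
  obtain ⟨-, hZ, hΓ, hK, hH, -⟩ := id h2
  set G : E d × 𝒵 → ℝ := fun p => u i (Q.Γ i p.1 p.2) + Q.K i p.1 p.2 with hG_def
  have hG : Continuous G := ((huc i).comp (hΓ i)).add (hK i)
  rw [Metric.continuous_iff]
  intro x ε hε
  have hcpt : IsCompact (({x} : Set (E d)) ×ˢ Q.Z i x) := isCompact_singleton.prod (hZ i x).2
  have hunif := hcpt.uniformContinuousAt_of_continuousAt G (fun p _ => hG.continuousAt)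
    (Metric.dist_mem_uniformity (half_pos hε))
  obtain ⟨δ, hδ, hδG⟩ := Metric.mem_uniformity_dist.1 hunif
  have hδG' : ∀ (y : E d) (z w : 𝒵), z ∈ Q.Z i x → dist y x < δ → dist z w < δ →
      |G (x, z) - G (y, w)| < ε / 2 := by
    intro y z w hz hy hw
    have := hδG (a := (x, z)) (b := (y, w))
      (by rw [Prod.dist_eq]; exact max_lt (by rwa [dist_comm]) hw) ⟨rfl, hz⟩
    simpa [Real.dist_eq] using this
  obtain ⟨δ₂, hδ₂, hH⟩ := hH i x δ hδ
  refine ⟨min δ δ₂, lt_min hδ hδ₂, fun y hy => ?_⟩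
  have hyδ := hy.trans_le (min_le_left _ _)
  have hd := hH y (hy.trans_le (min_le_right _ _))
  have hfin : Metric.hausdorffEDist (Q.Z i x) (Q.Z i y) ≠ ⊤ :=
    Metric.hausdorffEDist_ne_top_of_nonempty_of_bounded (hZ i x).1 (hZ i y).1
      (hZ i x).2.isBounded (hZ i y).2.isBounded
  have h₁ : Q.Mop i u x ≤ Q.Mop i u y + ε / 2 := by
    rw [← sub_le_iff_le_add]
    refine le_csInf ((hZ i y).1.image _) ?_
    rintro _ ⟨w, hw, rfl⟩
    obtain ⟨z, hz, hzw⟩ := Metric.exists_dist_lt_of_hausdorffDist_lt' hw hd hfin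
    have hle : Q.Mop i u x ≤ G (x, z) :=
      csInf_le (bddBelow_intervention h2 hu i x) ⟨z, hz, rfl⟩
    have := lt_of_abs_lt (hδG' y z w hz hyδ hzw)
    change _ ≤ G (y, w)
    linarith
  have h₂ : Q.Mop i u y ≤ Q.Mop i u x + ε / 2 := by
    rw [← sub_le_iff_le_add]
    refine le_csInf ((hZ i x).1.image _) ?_
    rintro _ ⟨z, hz, rfl⟩
    obtain ⟨w, hw, hzw⟩ := Metric.exists_dist_lt_of_hausdorffDist_lt hz hd hfin
    have hle : Q.Mop i u y ≤ G (y, w) :=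
      csInf_le (bddBelow_intervention h2 hu i y) ⟨w, hw, rfl⟩
    have := neg_lt_of_abs_lt (hδG' y z w hz hyδ hzw)
    change _ ≤ G (x, z)
    linarith
  rw [Real.dist_eq, abs_lt]
  constructor <;> linarith

end Intervention

section Iterates

variable {d d' M : ℕ} {𝒜 : Type} [MetricSpace 𝒜]

lemma IsSubsolution.mono_op {F G : Op d M} {u : Fin M → E d → ℝ} (hu : IsSubsolution F u)
    (h : ∀ i x p X, G i x u p X ≤ F i x u p X) : IsSubsolution G u :=
  ⟨hu.1, fun i φ hφ x hx => (h i x _ _).trans (hu.2 i φ hφ x hx)⟩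

lemma IsSupersolution.mono_op {F G : Op d M} {u : Fin M → E d → ℝ} (hu : IsSupersolution F u)
    (h : ∀ i x p X, F i x u p X ≤ G i x u p X) : IsSupersolution G u :=
  ⟨hu.1, fun i φ hφ x hx => (hu.2 i φ hφ x hx).trans (h i x _ _)⟩

lemma IsSubsolution.fobPen_anti {P : HJBData d d' M 𝒜} {Ψ Ψ' u : Fin M → E d → ℝ} {ρ : ℝ}
    (hρ : 0 ≤ ρ) (hu : IsSubsolution (FobPen P Ψ ρ) u) (h : ∀ i x, Ψ i x ≤ Ψ' i x) :
    IsSubsolution (FobPen P Ψ' ρ) u :=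
  hu.mono_op fun i x _ _ => by
    have := h i x
    unfold FobPen
    gcongr

lemma IsSubsolution.fobPen_zero {P : HJBData d d' M 𝒜} {Ψ u : Fin M → E d → ℝ} {ρ : ℝ}
    (hρ : 0 ≤ ρ) (hu : IsSubsolution (FobPen P Ψ ρ) u) : IsSubsolution (FobPen P 0 0) u :=
  hu.mono_op fun i x _ _ => by
    simp only [FobPen, zero_mul, add_zero, le_add_iff_nonneg_right]
    positivity

/-- A bounded subsolution of a penalized problem lies below the unconstrained solution. -/
lemma le_of_isSubsolution_fobPen {P : HJBData d d' M 𝒜} {C lam0 : ℝ} (h1 : H1 P C lam0)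
    {Ψ u v : Fin M → E d → ℝ} {ρ : ℝ} (hρ : 0 ≤ ρ) (huc : ∀ i, Continuous (u i)) (hub : Bdd u)
    (hu : IsSubsolution (FobPen P Ψ ρ) u) (hvb : Bdd v) (hv : IsSolution (Fhjb P) v)
    (i : Fin M) (x : E d) : u i x ≤ v i x :=
  comparison h1 le_rfl (fun _ => continuous_const) huc hv.1 hub hvb (hu.fobPen_zero hρ)
    (hv.2.2.mono_op fun i x p X => by simp [FobPen, Fhjb]) i x

end Iterates

/-- Monotonicity and boundedness of the auxiliary penalized iterates
`u^{ρ,n}`: they decrease in `n`, dominate the penalized solution `u^ρ`, and are uniformly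
bounded in `n`. -/
theorem auxiliary_iterates_monotone_bounded
    {d d' M : ℕ} {𝒜 𝒵 : Type} [MetricSpace 𝒜] [MetricSpace 𝒵]
    (P : HJBData d d' M 𝒜) (Q : ImpulseData d M 𝒵) (C lam0 κ₀ C4 : ℝ)
    (h1 : H1 P C lam0) (h2 : H2 Q κ₀) (h3 : H3 P lam0) (h4 : H4 Q C4)
    (ρ : ℝ) (hρ : 0 < ρ)
    (urn : ℕ → Fin M → E d → ℝ)
    (h0 : Bdd (urn 0) ∧ IsSolution (Fhjb P) (urn 0))
    (hstep : ∀ n : ℕ, Bdd (urn (n + 1)) ∧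
      IsSolution (FobPen P (fun i x => Q.Mop i (urn n) x) ρ) (urn (n + 1)))
    (urho : Fin M → E d → ℝ)
    (hrho : Bdd urho ∧ IsSolution (Fpen P Q ρ) urho) :
    (∀ (n : ℕ) (i : Fin M) (x : E d),
      urn (n + 1) i x ≤ urn n i x ∧ urho i x ≤ urn (n + 1) i x) ∧
    ∃ B : ℝ, ∀ (n : ℕ) (i : Fin M) (x : E d), |urn n i x| ≤ B := by
  have hbdd : ∀ n, Bdd (urn n) := fun n => n.casesOn h0.1 fun n => (hstep n).1
  have hcont : ∀ n i, Continuous (urn n i) := fun n => n.casesOn h0.2.1 fun n => (hstep n).2.1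
  have hobs : ∀ n i, Continuous fun x => Q.Mop i (urn n) x := fun n i =>
    continuous_Mop h2 (hbdd n) (hcont n) i
  have hrho_sub : IsSubsolution (FobPen P (fun i x => Q.Mop i urho x) ρ) urho := hrho.2.2.1
  have hdecr : ∀ n i x, urn (n + 1) i x ≤ urn n i x := by
    intro n
    induction n with
    | zero =>
      exact le_of_isSubsolution_fobPen h1 hρ.le (hcont 1) (hbdd 1) (hstep 0).2.2.1 h0.1 h0.2
    | succ n ih =>
      exact comparison h1 hρ.le (hobs n) (hcont _) (hcont _) (hbdd _) (hbdd _)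
        ((hstep (n + 1)).2.2.1.fobPen_anti hρ.le (Mop_mono h2 (hbdd _) ih)) (hstep n).2.2.2
  have hlower : ∀ n i x, urho i x ≤ urn n i x := by
    intro n
    induction n with
    | zero => exact le_of_isSubsolution_fobPen h1 hρ.le hrho.2.1 hrho.1 hrho_sub h0.1 h0.2
    | succ n ih =>
      exact comparison h1 hρ.le (hobs n) hrho.2.1 (hcont _) hrho.1 (hbdd _)
        (hrho_sub.fobPen_anti hρ.le (Mop_mono h2 hrho.1 ih)) (hstep n).2.2.2
  refine ⟨fun n i x => ⟨hdecr n i x, hlower (n + 1) i x⟩, ?_⟩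
  obtain ⟨B₀, hB₀⟩ := h0.1
  obtain ⟨B₁, hB₁⟩ := hrho.1
  refine ⟨max B₀ B₁, fun n i x => abs_le.2 ⟨?_, ?_⟩⟩
  · have := neg_le_of_abs_le (hB₁ i x)
    have := hlower n i x
    have := le_max_right B₀ B₁
    linarith
  · have hanti : Antitone fun n => urn n i x := antitone_nat_of_succ_le fun n => hdecr n i x
    have : urn n i x ≤ urn 0 i x := hanti n.zero_le
    exact this.trans ((le_of_abs_le (hB₀ i x)).trans (le_max_left _ _))

end HJBQVI
end
end
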